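/- arXiv:1809.04694 — 2 statements merged into one kernel-verified Lean document; each statement's English description precedes it below -/
import Mathlib

section
/- For every E ∈ ℝ and every real a ≥ ((2-α)/4)·π, there exists a continuous potential q : ℝ → ℝ with q(x) = 0 for x < 0 and limsup_{x→∞} x^{1-α/2}·|q(x)| = a such that there exists an L²(ℝ) eigenfunction for energy E of the perturbed Stark type operator -u'' + ṽ·u + q·u. -/
open Filter MeasureTheory Set Real

/-- An `L²(ℝ)` eigenfunction for energy `E` of the operator `-D² + ṽ + q`:
a twice continuously differentiable, not identically zero `u : ℝ → ℝ` with
`-u'' + ṽ·u + q·u = E·u` on `ℝ` and `∫_ℝ u² < ∞`. -/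
def HasL2Eigenfunction (vt q : ℝ → ℝ) (E : ℝ) : Prop :=
  ∃ u : ℝ → ℝ, ContDiff ℝ 2 u ∧
    (∀ x : ℝ, -(deriv (deriv u) x) + vt x * u x + q x * u x = E * u x) ∧
    (∃ x : ℝ, u x ≠ 0) ∧
    MeasureTheory.Integrable (fun x => (u x) ^ 2)


theorem sle_global_ode (H : ℝ → ℝ → ℝ) (κ : ℝ → ℝ) (hκ : Continuous κ)
    (hc : ∀ y, Continuous (fun t => H t y))
    (hb : ∀ t y, |H t y| ≤ κ t)
    (hl : ∀ t y z, |H t y - H t z| ≤ κ t * |y - z|) (t0 y0 : ℝ) :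
    ∃ θ : ℝ → ℝ, θ t0 = y0 ∧ ∀ t, HasDerivAt θ (H t (θ t)) t := by
  have hκ0 : ∀ t, 0 ≤ κ t := fun t => (abs_nonneg _).trans (hb t 0)
  have hK : ∀ n : ℕ, ∃ K : NNReal, ∀ t ∈ Icc (t0 - (n + 1)) (t0 + (n + 1)), κ t ≤ K := by
    intro n
    obtain ⟨C, hC⟩ := (isCompact_Icc (a := t0 - ((n:ℝ) + 1)) (b := t0 + (n + 1))).bddAbove_image
      hκ.continuousOn
    refine ⟨⟨max C 0, le_max_right _ _⟩, fun t ht => ?_⟩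
    exact (hC ⟨t, ht, rfl⟩).trans (le_max_left _ _)
  choose K hK using hK
  have hlip : ∀ n : ℕ, ∀ t ∈ Icc (t0 - ((n:ℝ) + 1)) (t0 + (n + 1)), ∀ s,
      LipschitzOnWith (K n) (H t) s := by
    intro n t ht s
    apply LipschitzWith.lipschitzOnWith
    apply LipschitzWith.of_dist_le_mul
    intro y z
    rw [Real.dist_eq, Real.dist_eq]
    exact (hl t y z).trans (mul_le_mul_of_nonneg_right (hK n t ht) (abs_nonneg _))
  have hsol : ∀ n : ℕ, ∃ θ : ℝ → ℝ, θ t0 = y0 ∧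
      ∀ t ∈ Ioo (t0 - ((n:ℝ) + 1)) (t0 + (n + 1)), HasDerivAt θ (H t (θ t)) t := by
    intro n
    have hn : (0:ℝ) ≤ n := Nat.cast_nonneg n
    have hmem : t0 ∈ Icc (t0 - ((n:ℝ) + 1)) (t0 + (n + 1)) := ⟨by linarith, by linarith⟩
    have hpl : IsPicardLindelof H (⟨t0, hmem⟩ : Icc (t0 - ((n:ℝ) + 1)) (t0 + (n + 1))) y0
        (K n * (n + 1)) 0 (K n) (K n) := by
      refine ⟨fun t ht => hlip n t ht _, fun x _ => (hc x).continuousOn, fun t ht x _ => ?_, ?_⟩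
      · rw [Real.norm_eq_abs]; exact (hb t x).trans (hK n t ht)
      · simp
    obtain ⟨θ, h0, hθ⟩ := hpl.exists_eq_forall_mem_Icc_hasDerivWithinAt₀
    refine ⟨θ, h0, fun t ht => ?_⟩
    exact (hθ t (Ioo_subset_Icc_self ht)).hasDerivAt (Icc_mem_nhds ht.1 ht.2)
  choose Θ hΘ0 hΘ using hsol
  have hmono : ∀ n m : ℕ, n ≤ m → EqOn (Θ n) (Θ m) (Ioo (t0 - ((n:ℝ) + 1)) (t0 + (n + 1))) := by
    intro n m hnm
    have hn : (0:ℝ) ≤ n := Nat.cast_nonneg n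
    have hnm' : (n:ℝ) ≤ m := by exact_mod_cast hnm
    refine ODE_solution_unique_of_mem_Ioo (v := H) (s := fun _ => univ) (K := K n) (t₀ := t0)
      (fun t ht => hlip n t (Ioo_subset_Icc_self ht) _) ⟨by linarith, by linarith⟩
      (fun t ht => ⟨hΘ n t ht, mem_univ _⟩) (fun t ht => ⟨hΘ m t ⟨?_, ?_⟩, mem_univ _⟩) ?_
    · linarith [ht.1]
    · linarith [ht.2]
    · rw [hΘ0, hΘ0]
  let N : ℝ → ℕ := fun t => ⌈|t - t0|⌉₊
  have hN : ∀ t, |t - t0| ≤ N t := fun t => Nat.le_ceil _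
  have key : ∀ (n : ℕ) (t : ℝ), |t - t0| < n + 1 → Θ (N t) t = Θ n t := by
    intro n t ht
    have h1 := abs_lt.1 ht
    have h2 := abs_le.1 (hN t)
    rcases le_total (N t) n with h | h
    · exact hmono _ _ h ⟨by linarith, by linarith⟩
    · exact (hmono _ _ h ⟨by linarith, by linarith⟩).symm
  refine ⟨fun t => Θ (N t) t, hΘ0 _, fun t => ?_⟩
  have h2 := abs_le.1 (hN t)
  have hd : HasDerivAt (Θ (N t)) (H t (Θ (N t) t)) t := hΘ _ t ⟨by linarith, by linarith⟩
  refine hd.congr_of_eventuallyEq ?_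
  have : ∀ᶠ s in nhds t, |s - t0| < N t + 1 := by
    have hcont : Continuous fun s : ℝ => |s - t0| := by fun_prop
    exact hcont.continuousAt.eventually_lt continuousAt_const (by linarith [hN t])
  filter_upwards [this] with s hs
  exact key _ s hs

theorem sle_backward (H : ℝ → ℝ → ℝ) (K : ℝ) (a b : ℝ) (hab : a ≤ b)
    (hl : ∀ t ∈ Icc a b, ∀ y z, |H t y - H t z| ≤ K * |y - z|)
    (f g : ℝ → ℝ) (hf : ∀ t, HasDerivAt f (H t (f t)) t) (hg : ∀ t, HasDerivAt g (H t (g t)) t) :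
    (f a - g a) ^ 2 ≤ exp (2 * K * (b - a)) * (f b - g b) ^ 2 := by
  have hd : ∀ t, HasDerivAt (fun t => exp (2 * K * (t - a)) * (f t - g t) ^ 2)
      (exp (2 * K * (t - a)) * (2 * K) * (f t - g t) ^ 2 +
        exp (2 * K * (t - a)) * (2 * (f t - g t) * (H t (f t) - H t (g t)))) t := by
    intro t
    have h1 : HasDerivAt (fun t => exp (2 * K * (t - a))) (exp (2 * K * (t - a)) * (2 * K)) t := by
      have := (((hasDerivAt_id t).sub_const a).const_mul (2 * K)).exp
      simpa using this
    have h2 := ((hf t).sub (hg t)).pow 2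
    refine (h1.mul h2).congr_deriv ?_
    simp
  have hm : MonotoneOn (fun t => exp (2 * K * (t - a)) * (f t - g t) ^ 2) (Icc a b) := by
    refine monotoneOn_of_deriv_nonneg (convex_Icc a b)
      (fun t _ => (hd t).continuousAt.continuousWithinAt)
      (fun t _ => (hd t).differentiableAt.differentiableWithinAt) ?_
    intro t ht
    rw [interior_Icc] at ht
    rw [(hd t).deriv]
    have h1 := hl t (Ioo_subset_Icc_self ht) (f t) (g t)
    have h2 : -(K * (f t - g t) ^ 2) ≤ (f t - g t) * (H t (f t) - H t (g t)) := by
      have : |(f t - g t) * (H t (f t) - H t (g t))| ≤ K * (f t - g t) ^ 2 := by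
        rw [abs_mul, ← sq_abs (f t - g t)]
        nlinarith [abs_nonneg (f t - g t)]
      exact (abs_le.1 this).1
    have h3 := exp_pos (2 * K * (t - a))
    have : exp (2 * K * (t - a)) * (2 * K) * (f t - g t) ^ 2 +
        exp (2 * K * (t - a)) * (2 * (f t - g t) * (H t (f t) - H t (g t))) =
        2 * exp (2 * K * (t - a)) * (K * (f t - g t) ^ 2 + (f t - g t) * (H t (f t) - H t (g t))) := by
      ring
    rw [this]
    apply mul_nonneg <;> linarith
  have := hm (left_mem_Icc.2 hab) (right_mem_Icc.2 hab) hab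
  simpa using this

theorem sle_left_ode (H : ℝ → ℝ → ℝ) (κ : ℝ → ℝ) (hκ : Continuous κ)
    (hc : ∀ y, Continuous (fun t => H t y))
    (hb : ∀ t y, |H t y| ≤ κ t)
    (hl : ∀ t y z, |H t y - H t z| ≤ κ t * |y - z|) (t0 : ℝ)
    (h0 : ∀ t ≤ t0, 0 < H t 0) (h1 : ∀ t ≤ t0, H t (π / 2) < 0) :
    ∃ θ : ℝ → ℝ, (∀ t, HasDerivAt θ (H t (θ t)) t) ∧ ∀ t ≤ t0, θ t ∈ Icc 0 (π / 2) := by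
  have hex := fun s y => sle_global_ode H κ hκ hc hb hl s y
  have hpi := Real.pi_pos
  choose Φ hΦ0 hΦ using hex
  -- forward invariance
  have inv : ∀ s, ∀ x ∈ Icc s t0, Φ s 0 x ∈ Icc 0 (π / 2) := by
    intro s x hx
    have hcont : Continuous (Φ s 0) :=
      continuous_iff_continuousAt.2 fun t => (hΦ s 0 t).continuousAt
    constructor
    · have := image_le_of_deriv_right_lt_deriv_boundary (f := fun t => -Φ s 0 t)
        (f' := fun t => -H t (Φ s 0 t)) (a := s) (b := t0) (B := fun _ => 0) (B' := fun _ => 0)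
        hcont.neg.continuousOn (fun t _ => (hΦ s 0 t).neg.hasDerivWithinAt)
        (by simp [hΦ0]) (fun t => hasDerivAt_const _ _)
        (fun t ht he => by
          have he' : Φ s 0 t = 0 := by linarith
          rw [he']; linarith [h0 t ht.2.le]) hx
      linarith
    · exact image_le_of_deriv_right_lt_deriv_boundary (f := fun t => Φ s 0 t)
        (f' := fun t => H t (Φ s 0 t)) (a := s) (b := t0) (B := fun _ => π / 2) (B' := fun _ => 0)
        hcont.continuousOn (fun t _ => (hΦ s 0 t).hasDerivWithinAt)
        (by simp only [hΦ0]; linarith) (fun t => hasDerivAt_const _ _)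
        (fun t ht he => by
          have he' : Φ s 0 t = π / 2 := he
          rw [he']; linarith [h1 t ht.2.le]) hx
  obtain ⟨c, hc', φ, hφ, hlim⟩ := (isCompact_Icc (a := (0:ℝ)) (b := π / 2)).tendsto_subseq
    (x := fun n : ℕ => Φ (t0 - n) 0 t0)
    (fun n => inv (t0 - n) t0 ⟨by linarith [Nat.cast_nonneg (α := ℝ) n], le_rfl⟩)
  refine ⟨Φ t0 c, hΦ t0 c, fun t ht => ?_⟩
  obtain ⟨K, hK⟩ := (isCompact_Icc (a := t) (b := t0)).bddAbove_image hκ.continuousOn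
  have hlim2 : Tendsto (fun n => Φ (t0 - (φ n : ℕ)) 0 t) atTop (nhds (Φ t0 c t)) := by
    rw [tendsto_iff_dist_tendsto_zero]
    have hz : Tendsto (fun n => Real.sqrt (exp (2 * K * (t0 - t)) *
        (Φ (t0 - (φ n : ℕ)) 0 t0 - c) ^ 2)) atTop (nhds 0) := by
      have h3 : Tendsto (fun n => Φ (t0 - (φ n : ℕ)) 0 t0) atTop (nhds c) := hlim
      have := (((h3.sub_const c).pow 2).const_mul (exp (2 * K * (t0 - t)))).sqrt
      simpa using this
    refine squeeze_zero (fun _ => dist_nonneg) (fun n => ?_) hz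
    rw [Real.dist_eq]
    apply Real.abs_le_sqrt
    have := sle_backward H K t t0 ht (fun s hs y z => (hl s y z).trans
      (mul_le_mul_of_nonneg_right (hK ⟨s, hs, rfl⟩) (abs_nonneg _)))
      (Φ (t0 - (φ n : ℕ)) 0) (Φ t0 c) (hΦ _ _) (hΦ _ _)
    rwa [hΦ0 t0 c] at this
  refine isClosed_Icc.mem_of_tendsto hlim2 ?_
  have hbig : ∀ᶠ n in atTop, t0 - t ≤ ((φ n : ℕ) : ℝ) :=
    (tendsto_natCast_atTop_atTop.comp hφ.tendsto_atTop).eventually_ge_atTop (t0 - t)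
  filter_upwards [hbig] with n hn
  exact inv _ t ⟨by linarith, ht⟩

theorem sle_G : ∃ (G : ℝ → ℝ) (G0 : ℝ), 0 ≤ G0 ∧ (∀ t, |G t| ≤ G0) ∧
    ∀ t, HasDerivAt G (|sin t| - 2 / π) t := by
  have hcont : Continuous fun s : ℝ => |sin s| - 2 / π := by fun_prop
  let G : ℝ → ℝ := fun t => ∫ s in (0:ℝ)..t, (|sin s| - 2 / π)
  have hG : ∀ t, HasDerivAt G (|sin t| - 2 / π) t := fun t =>
    intervalIntegral.integral_hasDerivAt_right (hcont.intervalIntegrable _ _)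
      (hcont.stronglyMeasurableAtFilter _ _) hcont.continuousAt
  have hper : Function.Periodic (fun s : ℝ => |sin s| - 2 / π) π := by
    intro s; simp [sin_add_pi]
  have hint : ∫ s in (0:ℝ)..π, (|sin s| - 2 / π) = 0 := by
    rw [intervalIntegral.integral_sub (by apply Continuous.intervalIntegrable; fun_prop) (by simp)]
    have : ∫ s in (0:ℝ)..π, |sin s| = ∫ s in (0:ℝ)..π, sin s := by
      apply intervalIntegral.integral_congr
      intro s hs
      rw [uIcc_of_le pi_pos.le] at hs
      exact abs_of_nonneg (sin_nonneg_of_mem_Icc hs)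
    rw [this, integral_sin]
    have := pi_pos.ne'
    simp
    field_simp
    norm_num
  have hGper : Function.Periodic G π := by
    intro t
    have h1 : G (t + π) - G t = ∫ s in t..(t + π), (|sin s| - 2 / π) := by
      exact intervalIntegral.integral_interval_sub_left (hcont.intervalIntegrable _ _)
        (hcont.intervalIntegrable _ _)
    have h2 := hper.intervalIntegral_add_eq t 0
    rw [h2, zero_add, hint] at h1
    linarith
  have hGc : Continuous G := continuous_iff_continuousAt.2 fun t => (hG t).continuousAt
  obtain ⟨B, hB⟩ := (isCompact_Icc (a := (0:ℝ)) (b := π)).exists_bound_of_continuousOn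
    hGc.continuousOn
  refine ⟨G, B, (norm_nonneg _).trans (hB 0 ⟨le_rfl, pi_pos.le⟩), fun t => ?_, hG⟩
  obtain ⟨y, hy, hyt⟩ := hGper.exists_mem_Ico₀ pi_pos t
  rw [hyt]
  exact hB y ⟨hy.1, hy.2.le⟩

set_option maxHeartbeats 2000000 in
theorem sle_pointwise (α a C G0 D r L f A p d S s c s2 c2 G : ℝ) (hα0 : 0 < α) (hα2 : α < 2)
    (ha : 0 ≤ a) (hC : a + 5 ≤ 2 / π * C) (hC0 : 0 ≤ C) (hL1 : 1 ≤ L) (hLC : C ≤ L)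
    (hG0 : 0 ≤ G0) (hG : |G| ≤ G0)
    (hD : D = 3 * (1 + (a + C) * G0) + C * G0 + (2 + a + C) * (1 + a + C))
    (hf : 0 ≤ f) (hfD : f * D ≤ 1 / L) (hr : |r| ≤ 1 / L)
    (hA : A = a + C / L) (hp : p = α / 2 * (1 - r)) (hd : d = p * s * c + A * S * s ^ 2)
    (hS : |S| ≤ 1) (hs : |s| ≤ 1) (hc : |c| ≤ 1) (hs2 : |s2| ≤ 1) (hc2 : |c2| ≤ 1)
    (hSs : |s2| - 1 / L ≤ S * s2) (hpi : 2 / π ≤ 1) (hpi0 : 0 ≤ 2 / π) :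
    |f * (α / 4 * s2 + A / 2 * G)| ≤ 1 ∧
    -p * (1 + c2) - A * (S * s2) + p + 2 * a / π + 2 / L - f * (1 + p) * (α / 4 * s2 + A / 2 * G)
      - f * (C / (2 * L ^ 2)) * G + (1 + f * d) * (α / 2 * c2 + A * (|s2| - 2 / π)) ≤ 0 := by
  have hL0 : 0 < L := by linarith
  have hiL : 1 / L ≤ 1 := by rw [div_le_one hL0]; exact hL1
  have hCL : 0 ≤ C / L := by positivity
  have hCL' : C / L ≤ C := div_le_self hC0 hL1
  have hCL1 : C / L ≤ 1 := by rw [div_le_one hL0]; exact hLC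
  have hA0 : 0 ≤ A := by linarith
  have hAC : A ≤ a + C := by linarith
  have hr1 := abs_le.1 (hr.trans hiL)
  have hpa : |p| ≤ 2 := by
    rw [hp, abs_le]; constructor <;> nlinarith
  have hda : |d| ≤ 2 + a + C := by
    have e1 : |p * s * c| ≤ 2 := by
      rw [abs_mul, abs_mul]
      have : |p| * |s| * |c| ≤ 2 * 1 * 1 := by gcongr
      linarith
    have e2 : |A * S * s ^ 2| ≤ a + C := by
      rw [abs_mul, abs_mul, abs_of_nonneg hA0, abs_pow]
      have : A * |S| * |s| ^ 2 ≤ (a + C) * 1 * 1 ^ 2 := by gcongr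
      linarith
    rw [hd]; exact (abs_add_le _ _).trans (by linarith)
  have hB1 : |α / 4 * s2 + A / 2 * G| ≤ 1 + (a + C) * G0 := by
    have e1 : |α / 4 * s2| ≤ 1 := by
      rw [abs_mul, abs_of_nonneg (by linarith : (0:ℝ) ≤ α / 4)]
      nlinarith [abs_nonneg s2]
    have e2 : |A / 2 * G| ≤ (a + C) * G0 := by
      rw [abs_mul, abs_of_nonneg (by linarith : (0:ℝ) ≤ A / 2)]
      have : A / 2 ≤ a + C := by linarith
      have h0 : 0 ≤ a + C := by linarith
      gcongr
    exact (abs_add_le _ _).trans (by linarith)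
  have hB2 : |α / 2 * c2 + A * (|s2| - 2 / π)| ≤ 1 + a + C := by
    have e1 : |α / 2 * c2| ≤ 1 := by
      rw [abs_mul, abs_of_nonneg (by linarith : (0:ℝ) ≤ α / 2)]
      nlinarith [abs_nonneg c2]
    have e2 : |A * (|s2| - 2 / π)| ≤ a + C := by
      rw [abs_mul, abs_of_nonneg hA0]
      have : |(|s2| - 2 / π)| ≤ 1 := by
        rw [abs_le]; constructor <;> linarith [abs_nonneg s2]
      have : A * |(|s2| - 2 / π)| ≤ (a + C) * 1 := by gcongr
      linarith
    exact (abs_add_le _ _).trans (by linarith)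
  have hX : 0 ≤ 1 + (a + C) * G0 := by positivity
  have hY : 0 ≤ 1 + a + C := by positivity
  have hErr : |-(1 + p) * (α / 4 * s2 + A / 2 * G) - C / (2 * L ^ 2) * G
      + d * (α / 2 * c2 + A * (|s2| - 2 / π))| ≤ D := by
    have e1 : |-(1 + p) * (α / 4 * s2 + A / 2 * G)| ≤ 3 * (1 + (a + C) * G0) := by
      rw [abs_mul, abs_neg]
      have : |1 + p| ≤ 3 := (abs_add_le _ _).trans (by rw [abs_one]; linarith)
      gcongr
    have e2 : |C / (2 * L ^ 2) * G| ≤ C * G0 := by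
      rw [abs_mul, abs_of_nonneg (by positivity)]
      have : C / (2 * L ^ 2) ≤ C := div_le_self hC0 (by nlinarith)
      gcongr
    have e3 : |d * (α / 2 * c2 + A * (|s2| - 2 / π))| ≤ (2 + a + C) * (1 + a + C) := by
      rw [abs_mul]
      have : 0 ≤ 2 + a + C := by positivity
      gcongr
    rw [hD]
    refine (abs_add_le _ _).trans ?_
    refine (add_le_add (abs_sub _ _) le_rfl).trans ?_
    linarith
  constructor
  · rw [abs_mul, abs_of_nonneg hf]
    have : |α / 4 * s2 + A / 2 * G| ≤ D := by
      rw [hD]; nlinarith [mul_nonneg hC0 hG0, mul_nonneg (add_nonneg (add_nonneg zero_le_two ha) hC0) hY]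
    calc f * |α / 4 * s2 + A / 2 * G| ≤ f * D := by gcongr
      _ ≤ 1 := hfD.trans hiL
  · have hfE : f * (-(1 + p) * (α / 4 * s2 + A / 2 * G) - C / (2 * L ^ 2) * G
      + d * (α / 2 * c2 + A * (|s2| - 2 / π))) ≤ 1 / L :=
      (mul_le_mul_of_nonneg_left ((le_abs_self _).trans hErr) hf).trans hfD
    have h1 : α / 2 * r * c2 ≤ 1 / L := by
      have : |α / 2 * r * c2| ≤ 1 / L := by
        rw [abs_mul, abs_mul, abs_of_nonneg (by linarith : (0:ℝ) ≤ α / 2)]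
        have : α / 2 * |r| * |c2| ≤ 1 * (1 / L) * 1 := by
          have : α / 2 ≤ 1 := by linarith
          gcongr
        linarith
      exact (le_abs_self _).trans this
    have h2 : A * |s2| - A * (S * s2) ≤ A * (1 / L) := by nlinarith
    have h3 : A * (1 / L) ≤ (a + 1) * (1 / L) := by
      apply mul_le_mul_of_nonneg_right _ (by positivity)
      linarith
    have h4 : A * (2 / π) = 2 * a / π + (2 / π * C) * (1 / L) := by rw [hA]; ring
    have h5 : (a + 5) * (1 / L) ≤ (2 / π * C) * (1 / L) := by gcongr
    have h6 : 2 / L = 2 * (1 / L) := by ring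
    have h7 : -p * c2 + α / 2 * c2 = α / 2 * r * c2 := by rw [hp]; ring
    rw [h6]
    linarith

theorem sle_evt (α E D : ℝ) (hα0 : 0 < α) :
    (∀ᶠ x : ℝ in atTop, x ^ α / 4 ≤ x ^ α + E) ∧
    (∀ᶠ x : ℝ in atTop, |E / (x ^ α + E)| ≤ 1 / log x) ∧
    (∀ᶠ x : ℝ in atTop, 1 / x * D ≤ 1 / log x) := by
  have hx : Tendsto (fun x : ℝ => x ^ α) atTop atTop := tendsto_rpow_atTop hα0
  have h1 : ∀ᶠ x : ℝ in atTop, x ^ α / 2 ≤ x ^ α + E := by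
    filter_upwards [hx.eventually_ge_atTop (2 * |E|)] with x hx
    linarith [neg_abs_le E]
  have hlogpos : ∀ᶠ x : ℝ in atTop, 0 < log x := tendsto_log_atTop.eventually_gt_atTop 0
  refine ⟨?_, ?_, ?_⟩
  · filter_upwards [h1, hx.eventually_ge_atTop 0] with x h h'
    linarith
  · have h2 := (isLittleO_log_rpow_atTop hα0).def (show (0:ℝ) < 1 / (2 * (|E| + 1)) by positivity)
    filter_upwards [h1, h2, hlogpos, eventually_gt_atTop 0] with x h h' hl h0
    have hp : 0 < x ^ α := rpow_pos_of_pos h0 α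
    have hh : 0 < x ^ α + E := by linarith
    rw [norm_eq_abs, norm_eq_abs, abs_of_pos hl, abs_of_pos hp] at h'
    rw [abs_div, abs_of_pos hh, div_le_div_iff₀ hh hl]
    have e : (0:ℝ) < |E| + 1 := by positivity
    rw [div_mul_eq_mul_div, one_mul, le_div_iff₀ (by positivity)] at h'
    nlinarith [abs_nonneg E]
  · have h2 := isLittleO_log_id_atTop.def (show (0:ℝ) < 1 / (|D| + 1) by positivity)
    filter_upwards [h2, hlogpos, eventually_gt_atTop 0] with x h' hl h0
    simp only [id, norm_eq_abs, abs_of_pos hl, abs_of_pos h0] at h'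
    rw [div_mul_eq_mul_div, one_mul, le_div_iff₀ (by positivity)] at h'
    rw [div_mul_eq_mul_div, one_mul, div_le_div_iff₀ h0 hl]
    nlinarith [le_abs_self D]

theorem sle_decay (α a E C M : ℝ) (hα0 : 0 < α) (hα2 : α < 2) (ha : ((2 - α) / 4) * π ≤ a)
    (hC : a + 5 ≤ 2 / π * C) (hC0 : 0 ≤ C) (hM : 0 < M)
    (k l θ lnR S : ℝ → ℝ)
    (hk0 : ∀ x, M ≤ x → 1 ≤ k x) (hk2 : ∀ x, M ≤ x → k x ^ 2 = x ^ α + E)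
    (hl : ∀ x, M ≤ x → l x = α / (2 * x) * (1 - E / (x ^ α + E)))
    (hk : ∀ x, M ≤ x → HasDerivAt k (l x * k x) x)
    (hS : ∀ x, |S x| ≤ 1)
    (hS2 : ∀ x, M ≤ x → |sin (2 * θ x)| - 1 / log x ≤ S x * sin (2 * θ x))
    (hθ : ∀ x, M ≤ x → HasDerivAt θ (k x + l x * sin (θ x) * cos (θ x) +
      (a + C / log x) / x * S x * sin (θ x) ^ 2) x)
    (hR : ∀ x, M ≤ x → HasDerivAt lnR (-l x * cos (θ x) ^ 2 -
      (a + C / log x) / x * S x * (sin (θ x) * cos (θ x))) x) :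
    ∃ X c : ℝ, 1 < X ∧ ∀ x, X ≤ x → exp (2 * lnR x) ≤ c * (1 / (x * log x ^ 2)) := by
  obtain ⟨G, G0, hG0, hGb, hGd⟩ := sle_G
  have hpi := pi_pos
  have hpi3 := pi_gt_three
  have ha0 : 0 ≤ a := le_trans (by have : 0 < 2 - α := by linarith
                                   positivity) ha
  set D := 3 * (1 + (a + C) * G0) + C * G0 + (2 + a + C) * (1 + a + C) with hD
  have hD0 : 0 ≤ D := by positivity
  obtain ⟨e1, e2, e3⟩ := sle_evt α E D hα0
  have e4 : ∀ᶠ x : ℝ in atTop, max 1 C ≤ log x := tendsto_log_atTop.eventually_ge_atTop _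
  obtain ⟨X, hX⟩ := eventually_atTop.1
    (((e1.and e2).and (e3.and e4)).and ((eventually_ge_atTop M).and (eventually_gt_atTop 1)))
  let Λ : ℝ → ℝ := fun x => 2 * lnR x + log (k x) + 2 * a / π * log x + 2 * log (log x)
    + 1 / (x * k x) * (α / 4 * sin (2 * θ x) + (a + C / log x) / 2 * G (2 * θ x))
  have key : ∀ x, X ≤ x → |1 / (x * k x) * (α / 4 * sin (2 * θ x) +
      (a + C / log x) / 2 * G (2 * θ x))| ≤ 1 ∧
      ∃ Λ', HasDerivAt Λ Λ' x ∧ Λ' ≤ 0 := by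
    intro x hx
    obtain ⟨⟨⟨h1, h2⟩, h3, h4⟩, h5, h6⟩ := hX x hx
    have hx0 : 0 < x := by linarith
    have hL1 : 1 ≤ log x := (le_max_left _ _).trans h4
    have hLC : C ≤ log x := (le_max_right _ _).trans h4
    have hL0 : 0 < log x := by linarith
    have hkx := hk0 x h5
    have hkx0 : 0 < k x := by linarith
    have hf : 1 / (x * k x) ≤ 1 / x := by
      apply one_div_le_one_div_of_le hx0; nlinarith
    have hfD : 1 / (x * k x) * D ≤ 1 / log x :=
      (mul_le_mul_of_nonneg_right hf hD0).trans h3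
    obtain ⟨P1, P2⟩ := sle_pointwise α a C G0 D (E / (x ^ α + E)) (log x) (1 / (x * k x))
      (a + C / log x) (α / 2 * (1 - E / (x ^ α + E))) _ (S x) (sin (θ x)) (cos (θ x))
      (sin (2 * θ x)) (cos (2 * θ x)) (G (2 * θ x)) hα0 hα2 ha0 hC hC0 hL1 hLC hG0 (hGb _) hD
      (by positivity) hfD h2 rfl rfl rfl (hS x) (abs_sin_le_one _) (abs_cos_le_one _)
      (abs_sin_le_one _) (abs_cos_le_one _) (hS2 x h5) (by rw [div_le_one hpi]; linarith)
      (by positivity)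
    refine ⟨P1, ?_⟩
    have d1 := (hR x h5).const_mul 2
    have d2 := (hk x h5).log hkx0.ne'
    have d3 := (hasDerivAt_log hx0.ne')
    have d4 := (d3.log hL0.ne').const_mul 2
    have d5 := (hasDerivAt_const x (1:ℝ)).div ((hasDerivAt_id x).mul (hk x h5))
      (mul_pos hx0 hkx0).ne'
    have d6 := (hθ x h5).const_mul 2
    have d7 := d6.sin
    have d8 := (hGd (2 * θ x)).comp x d6
    have d9 := (((hasDerivAt_const x C).div d3 hL0.ne').const_add a).div_const 2
    have d10 := (((d1.add d2).add (d3.const_mul (2 * a / π))).add d4).add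
      (d5.mul ((d7.const_mul (α / 4)).add (d9.mul d8)))
    refine ⟨_, d10, ?_⟩
    have P3 := mul_nonpos_of_nonneg_of_nonpos (show 0 ≤ 1 / x by positivity) P2
    refine le_of_eq_of_le ?_ P3
    have hlx := hl x h5
    have hc2 : cos (θ x) ^ 2 = (1 + cos (2 * θ x)) / 2 := by rw [cos_two_mul]; ring
    have hsc : sin (θ x) * cos (θ x) = sin (2 * θ x) / 2 := by rw [sin_two_mul]; ring
    have hsc' : ∀ y, y * sin (θ x) * cos (θ x) = y * (sin (2 * θ x) / 2) := by
      intro y; rw [← hsc]; ring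
    simp only [hsc', hc2, hsc, hlx, id, Function.comp, Pi.mul_apply, Pi.add_apply, Pi.div_apply]
    generalize E / (x ^ α + E) = r
    generalize |sin (2 * θ x)| = w
    generalize sin (2 * θ x) = s2
    generalize cos (2 * θ x) = c2
    generalize sin (θ x) = s
    generalize G (2 * θ x) = g
    generalize S x = T
    generalize log x = L at *
    generalize k x = K at *
    field_simp
    ring
  have hanti : AntitoneOn Λ (Ici X) := by
    refine antitoneOn_of_deriv_nonpos (convex_Ici X) ?_ ?_ ?_
    · intro x hx
      obtain ⟨-, _, h, -⟩ := key x hx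
      exact h.continuousAt.continuousWithinAt
    · intro x hx
      rw [interior_Ici] at hx
      obtain ⟨-, _, h, -⟩ := key x hx.le
      exact h.differentiableAt.differentiableWithinAt
    · intro x hx
      rw [interior_Ici] at hx
      obtain ⟨-, _, h, h'⟩ := key x hx.le
      rw [h.deriv]; exact h'
  refine ⟨X, exp (Λ X + 1 + log 2), (hX X le_rfl).2.2, fun x hx => ?_⟩
  have h0 := hanti self_mem_Ici hx hx
  obtain ⟨P1, -⟩ := key x hx
  obtain ⟨⟨⟨h1, h2⟩, h3, h4⟩, h5, h6⟩ := hX x hx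
  have hx0 : 0 < x := by linarith
  have hL1 : 1 ≤ log x := (le_max_left _ _).trans h4
  have hL0 : 0 < log x := by linarith
  have hkx0 : 0 < k x := by linarith [hk0 x h5]
  have hlk : α / 2 * log x - log 2 ≤ log (k x) := by
    have e1 : log (x ^ α / 4) ≤ log (k x ^ 2) := by
      rw [hk2 x h5]
      exact log_le_log (by positivity) h1
    rw [log_div (by positivity) (by norm_num), log_rpow hx0, log_pow] at e1
    have : log 4 = 2 * log 2 := by
      rw [show (4:ℝ) = 2 ^ 2 by norm_num, log_pow]; norm_num
    rw [this] at e1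
    push_cast at e1
    linarith
  have hcrit : 1 ≤ α / 2 + 2 * a / π := by
    have : (2 - α) / 2 ≤ 2 * a / π := by
      rw [le_div_iff₀ hpi]; linarith
    linarith
  have hm : log x ≤ (α / 2 + 2 * a / π) * log x := by nlinarith
  have hfin : 2 * lnR x ≤ (Λ X + 1 + log 2) - log x - 2 * log (log x) := by
    have := (abs_le.1 P1).1
    simp only [Λ] at h0 ⊢
    nlinarith
  calc exp (2 * lnR x) ≤ exp ((Λ X + 1 + log 2) - log x - 2 * log (log x)) := exp_le_exp.2 hfin
    _ = _ := by
      rw [exp_sub, exp_sub, exp_log hx0, show 2 * log (log x) = log (log x ^ 2) by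
        rw [log_pow]; norm_num, exp_log (by positivity)]
      field_simp

theorem sle_limsup (f p : ℝ → ℝ) (a : ℝ) (hp : Tendsto p atTop (nhds a))
    (hle : ∀ᶠ x in atTop, f x ≤ p x) (hnn : ∀ᶠ x in atTop, 0 ≤ f x)
    (hfr : ∃ᶠ x in atTop, f x = p x) : limsup f atTop = a := by
  have hbdd : IsBoundedUnder (· ≤ ·) atTop f := hp.isBoundedUnder_le.mono_le hle
  have hcob : IsCoboundedUnder (· ≤ ·) atTop f :=
    (isBoundedUnder_of_eventually_ge hnn).isCoboundedUnder_le
  apply le_antisymm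
  · rw [← hp.limsup_eq]
    exact limsup_le_limsup hle hcob hp.isBoundedUnder_le
  · apply le_of_forall_lt
    intro c hc
    obtain ⟨c', h1, h2⟩ := exists_between hc
    refine h1.trans_le (le_limsup_of_frequently_le ?_ hbdd)
    have := hp.eventually_const_lt h2
    exact (hfr.and_eventually this).mono fun x hx => by rw [hx.1]; exact hx.2.le

/-- clamp -/
noncomputable def sleCl (z : ℝ) : ℝ := max (-1) (min 1 z)

theorem sleCl_abs (z : ℝ) : |sleCl z| ≤ 1 := by
  unfold sleCl; rw [abs_le]; constructor
  · exact le_max_left _ _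
  · exact max_le (by norm_num) (min_le_left _ _)

theorem sleCl_lip (y z : ℝ) : |sleCl y - sleCl z| ≤ |y - z| := by
  unfold sleCl
  exact (abs_max_sub_max_le_max _ _ _ _).trans (by
    simp only [sub_self, abs_zero]
    exact max_le (abs_nonneg _) ((abs_min_sub_min_le_max _ _ _ _).trans (by simp)))

theorem sleCl_cont : Continuous sleCl := by unfold sleCl; fun_prop

theorem sleCl_mul (L s : ℝ) (hL : 0 < L) : |s| - 1 / L ≤ sleCl (L * s) * s := by
  have hi : L * (1 / L) = 1 := by field_simp
  have hi0 : 0 < 1 / L := by positivity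
  unfold sleCl
  rcases le_total s 0 with h | h
  · rw [abs_of_nonpos h, min_eq_right (by nlinarith)]
    rcases le_total (-1) (L * s) with h1 | h1
    · rw [max_eq_right h1]
      have : -s ≤ 1 / L := by
        by_contra hh
        push Not at hh
        nlinarith
      nlinarith [mul_nonneg hL.le (sq_nonneg s)]
    · rw [max_eq_left h1]; linarith
  · rw [abs_of_nonneg h, max_eq_right (le_min (by norm_num) (by nlinarith))]
    rcases le_total 1 (L * s) with h1 | h1
    · rw [min_eq_left h1]; linarith
    · rw [min_eq_right h1]
      have : s ≤ 1 / L := by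
        by_contra hh
        push Not at hh
        nlinarith
      nlinarith [mul_nonneg hL.le (sq_nonneg s)]

/-- phase field -/
noncomputable def sleH (k l g b L θ : ℝ) : ℝ :=
  k * cos θ ^ 2 + l * (sin θ * cos θ) + g * sin θ ^ 2 + b * (sleCl (L * sin (2 * θ)) * sin θ ^ 2)

theorem sle_mul_lip (p q p' q' A B δ : ℝ) (hp : |p| ≤ 1) (hq' : |q'| ≤ 1) (h1 : |p - p'| ≤ A * δ)
    (h2 : |q - q'| ≤ B * δ) : |p * q - p' * q'| ≤ (A + B) * δ := by
  have : p * q - p' * q' = p * (q - q') + (p - p') * q' := by ring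
  rw [this]
  refine (abs_add_le _ _).trans ?_
  rw [abs_mul, abs_mul]
  nlinarith [abs_nonneg (q - q'), abs_nonneg (p - p')]

theorem sle_sin_lip (y z : ℝ) : |sin y - sin z| ≤ 1 * |y - z| := by
  have := Real.lipschitzWith_sin.dist_le_mul y z
  simpa [Real.dist_eq] using this

theorem sle_cos_lip (y z : ℝ) : |cos y - cos z| ≤ 1 * |y - z| := by
  have := Real.lipschitzWith_cos.dist_le_mul y z
  simpa [Real.dist_eq] using this

theorem sleH_lip (k l g b L y z : ℝ) :
    |sleH k l g b L y - sleH k l g b L z| ≤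
      (2 * |k| + 2 * |l| + 2 * |g| + |b| * (2 * |L| + 2)) * |y - z| := by
  have hs := sle_sin_lip y z
  have hc := sle_cos_lip y z
  have s1 := abs_sin_le_one
  have c1 := abs_cos_le_one
  have e1 := sle_mul_lip _ _ _ _ _ _ _ (c1 y) (c1 z) hc hc
  have e2 := sle_mul_lip _ _ _ _ _ _ _ (s1 y) (c1 z) hs hc
  have e3 := sle_mul_lip _ _ _ _ _ _ _ (s1 y) (s1 z) hs hs
  have e4 : |sleCl (L * sin (2 * y)) - sleCl (L * sin (2 * z))| ≤ (2 * |L|) * |y - z| := by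
    refine (sleCl_lip _ _).trans ?_
    rw [← mul_sub, abs_mul]
    have := sle_sin_lip (2 * y) (2 * z)
    rw [← mul_sub, abs_mul, abs_two] at this
    nlinarith [abs_nonneg L]
  have hs2 : |sin z * sin z| ≤ 1 := by
    rw [abs_mul]; nlinarith [s1 z, abs_nonneg (sin z)]
  have e5 := sle_mul_lip _ _ _ _ _ _ _ (sleCl_abs _) hs2 e4 e3
  have e : sleH k l g b L y - sleH k l g b L z =
      k * (cos y * cos y - cos z * cos z) + l * (sin y * cos y - sin z * cos z)
      + g * (sin y * sin y - sin z * sin z)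
      + b * (sleCl (L * sin (2 * y)) * (sin y * sin y) -
        sleCl (L * sin (2 * z)) * (sin z * sin z)) := by
    unfold sleH; ring
  rw [e]
  have f1 := mul_le_mul_of_nonneg_left e1 (abs_nonneg k)
  have f2 := mul_le_mul_of_nonneg_left e2 (abs_nonneg l)
  have f3 := mul_le_mul_of_nonneg_left e3 (abs_nonneg g)
  have f5 := mul_le_mul_of_nonneg_left e5 (abs_nonneg b)
  rw [← abs_mul] at f1 f2 f3 f5
  refine (abs_add_le _ _).trans ((add_le_add ((abs_add_le _ _).trans
    (add_le_add (abs_add_le _ _) le_rfl)) le_rfl).trans ?_)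
  linarith

theorem sleH_bdd (k l g b L y : ℝ) :
    |sleH k l g b L y| ≤ 2 * |k| + 2 * |l| + 2 * |g| + |b| * (2 * |L| + 2) := by
  have s1 := abs_sin_le_one y
  have c1 := abs_cos_le_one y
  have e1 : |k * cos y ^ 2| ≤ |k| := by
    rw [abs_mul, abs_pow]
    exact mul_le_of_le_one_right (abs_nonneg _) (pow_le_one₀ (abs_nonneg _) c1)
  have e2 : |l * (sin y * cos y)| ≤ |l| := by
    rw [abs_mul, abs_mul]
    exact mul_le_of_le_one_right (abs_nonneg _) (mul_le_one₀ s1 (abs_nonneg _) c1)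
  have e3 : |g * sin y ^ 2| ≤ |g| := by
    rw [abs_mul, abs_pow]
    exact mul_le_of_le_one_right (abs_nonneg _) (pow_le_one₀ (abs_nonneg _) s1)
  have e4 : |b * (sleCl (L * sin (2 * y)) * sin y ^ 2)| ≤ |b| := by
    rw [abs_mul, abs_mul, abs_pow]
    exact mul_le_of_le_one_right (abs_nonneg _) (mul_le_one₀ (sleCl_abs _)
      (pow_nonneg (abs_nonneg _) _) (pow_le_one₀ (abs_nonneg _) s1))
  unfold sleH
  refine (abs_add_le _ _).trans ((add_le_add ((abs_add_le _ _).trans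
    (add_le_add (abs_add_le _ _) le_rfl)) le_rfl).trans ?_)
  nlinarith [abs_nonneg k, abs_nonneg l, abs_nonneg g, abs_nonneg b, abs_nonneg L,
    mul_nonneg (abs_nonneg b) (abs_nonneg L)]

theorem sle_pruefer (k l W θ : ℝ → ℝ) (hk0 : ∀ x, 0 < k x) (hlc : Continuous l)
    (hWc : Continuous W)
    (hk : ∀ x, HasDerivAt k (l x * k x) x)
    (hθ : ∀ x, HasDerivAt θ (k x * cos (θ x) ^ 2 + l x * (sin (θ x) * cos (θ x)) +
      W x / k x * sin (θ x) ^ 2) x) :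
    ∃ lnR : ℝ → ℝ,
      (∀ x, HasDerivAt lnR (-l x * cos (θ x) ^ 2 + (k x - W x / k x) * (sin (θ x) * cos (θ x))) x) ∧
      (∀ x, HasDerivAt (fun x => exp (lnR x) * sin (θ x)) (exp (lnR x) * k x * cos (θ x)) x) ∧
      (∀ x, HasDerivAt (fun x => exp (lnR x) * k x * cos (θ x))
        (-W x * (exp (lnR x) * sin (θ x))) x) := by
  have hkc : Continuous k := continuous_iff_continuousAt.2 fun t => (hk t).continuousAt
  have hθc : Continuous θ := continuous_iff_continuousAt.2 fun t => (hθ t).continuousAt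
  have hWk : Continuous fun x => W x / k x := hWc.div hkc (fun x => (hk0 x).ne')
  have hρ : Continuous fun x => -l x * cos (θ x) ^ 2 +
      (k x - W x / k x) * (sin (θ x) * cos (θ x)) := by fun_prop
  refine ⟨fun x => ∫ s in (0:ℝ)..x, (-l s * cos (θ s) ^ 2 +
      (k s - W s / k s) * (sin (θ s) * cos (θ s))), ?_⟩
  have h1 : ∀ x, HasDerivAt (fun x => ∫ s in (0:ℝ)..x, (-l s * cos (θ s) ^ 2 +
      (k s - W s / k s) * (sin (θ s) * cos (θ s)))) (-l x * cos (θ x) ^ 2 +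
      (k x - W x / k x) * (sin (θ x) * cos (θ x))) x := fun t =>
    intervalIntegral.integral_hasDerivAt_right (hρ.intervalIntegrable _ _)
      (hρ.stronglyMeasurableAtFilter _ _) hρ.continuousAt
  generalize (fun x => ∫ s in (0:ℝ)..x, (-l s * cos (θ s) ^ 2 +
      (k s - W s / k s) * (sin (θ s) * cos (θ s)))) = lnR at h1
  refine ⟨h1, fun x => ?_, fun x => ?_⟩
  · refine ((h1 x).exp.mul (hθ x).sin).congr_deriv ?_
    have hs : sin (θ x) ^ 2 = 1 - cos (θ x) ^ 2 := sin_sq _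
    linear_combination (exp (lnR x) * cos (θ x) * k x) * hs
  · refine (((h1 x).exp.mul (hk x)).mul (hθ x).cos).congr_deriv ?_
    have hs : sin (θ x) ^ 2 = 1 - cos (θ x) ^ 2 := sin_sq _
    have hne := (hk0 x).ne'
    have hW : W x = W x / k x * k x := by field_simp
    rw [Pi.mul_apply]
    generalize W x / k x = w at *
    rw [hW]
    linear_combination (-(exp (lnR x) * k x * (w * sin (θ x) + l x * cos (θ x)))) * hs

theorem sle_left_int (u u' W : ℝ → ℝ) (t0 : ℝ) (hW : Continuous W)
    (hu : ∀ x, HasDerivAt u (u' x) x) (hu' : ∀ x, HasDerivAt u' (-W x * u x) x)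
    (hu0 : ∀ x ≤ t0, 0 ≤ u x) (hu1 : ∀ x ≤ t0, 0 ≤ u' x) (hW1 : ∀ x ≤ t0, 1 ≤ -W x) :
    IntegrableOn (fun x => u x ^ 2) (Iic t0) := by
  have huc : Continuous u := continuous_iff_continuousAt.2 fun t => (hu t).continuousAt
  have hmono : MonotoneOn u (Iic t0) := by
    refine monotoneOn_of_deriv_nonneg (convex_Iic t0) huc.continuousOn
      (fun t _ => (hu t).differentiableAt.differentiableWithinAt) ?_
    intro x hx
    rw [(hu x).deriv]
    rw [interior_Iic] at hx
    exact hu1 x (le_of_lt hx)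
  refine integrableOn_Iic_of_intervalIntegral_norm_bounded (l := atTop)
    (a := fun n : ℕ => t0 - n) (u t0 * u' t0) t0 (fun i => ?_) ?_ ?_
  · exact ((huc.pow 2).continuousOn.integrableOn_Icc).mono_set Ioc_subset_Icc_self
  · exact tendsto_atBot_add_const_left _ t0 (tendsto_neg_atTop_atBot.comp tendsto_natCast_atTop_atTop)
  · refine Eventually.of_forall fun n => ?_
    have hn : t0 - (n:ℝ) ≤ t0 := by linarith [Nat.cast_nonneg (α := ℝ) n]
    have hc2 : Continuous fun x => u t0 * (-W x * u x) := by fun_prop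
    calc ∫ x in (t0 - n)..t0, ‖u x ^ 2‖ ≤ ∫ x in (t0 - n)..t0, u t0 * (-W x * u x) := by
          apply intervalIntegral.integral_mono_on hn
            ((huc.pow 2).norm.intervalIntegrable _ _) (hc2.intervalIntegrable _ _)
          intro x hx
          have h0 := hu0 x hx.2
          have h1 := hmono (mem_Iic.2 hx.2) self_mem_Iic hx.2
          have h2 := hW1 x hx.2
          have hnn : ‖u x ^ 2‖ = u x ^ 2 := by rw [norm_eq_abs, abs_of_nonneg (sq_nonneg _)]
          change ‖u x ^ 2‖ ≤ _
          rw [hnn]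
          have h3 : u x ≤ -W x * u x := by nlinarith
          have h4 := mul_le_mul h1 h3 h0 (h0.trans h1)
          calc u x ^ 2 = u x * u x := by ring
            _ ≤ _ := h4
      _ = u t0 * (u' t0 - u' (t0 - n)) := by
          rw [intervalIntegral.integral_const_mul]
          congr 1
          apply intervalIntegral.integral_eq_sub_of_hasDerivAt (fun x _ => hu' x)
          apply Continuous.intervalIntegrable
          fun_prop
      _ ≤ u t0 * u' t0 := by
          have h1 := hu1 _ hn
          have h2 := hu0 t0 le_rfl
          nlinarith

theorem sle_right_int (u : ℝ → ℝ) (hu : Continuous u) (X c : ℝ) (hX : 1 < X)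
    (h : ∀ x, X ≤ x → u x ^ 2 ≤ c * (1 / (x * log x ^ 2))) :
    IntegrableOn (fun x => u x ^ 2) (Ioi X) := by
  have hI : IntegrableOn (fun x : ℝ => 1 / (x * log x ^ 2)) (Ioi X) := by
    refine integrableOn_Ioi_deriv_of_nonneg' (g := fun x => -(log x)⁻¹) (l := -0) ?_ ?_ ?_
    · intro x hx
      have hx1 : 1 < x := lt_of_lt_of_le hX hx
      have hl : 0 < log x := log_pos hx1
      refine ((hasDerivAt_log (by linarith)).inv hl.ne').neg.congr_deriv ?_
      have : x ≠ 0 := by linarith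
      field_simp
    · intro x hx
      have hx1 : 1 < x := lt_trans hX hx
      have hl : 0 < log x := log_pos hx1
      positivity
    · exact (tendsto_inv_atTop_zero.comp tendsto_log_atTop).neg
  refine Integrable.mono' (hI.const_mul c) (hu.pow 2).aestronglyMeasurable.restrict ?_
  refine (ae_restrict_mem measurableSet_Ioi).mono fun x hx => ?_
  rw [norm_eq_abs, abs_of_nonneg (sq_nonneg _)]
  exact h x (le_of_lt hx)

theorem sle_contDiff (u u' u'' : ℝ → ℝ) (h1 : ∀ x, HasDerivAt u (u' x) x)
    (h2 : ∀ x, HasDerivAt u' (u'' x) x) (hc : Continuous u'') :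
    ContDiff ℝ 2 u ∧ ∀ x, deriv (deriv u) x = u'' x := by
  have e1 : deriv u = u' := funext fun x => (h1 x).deriv
  have e2 : deriv u' = u'' := funext fun x => (h2 x).deriv
  refine ⟨?_, fun x => by rw [e1, e2]⟩
  rw [show (2 : WithTop ℕ∞) = 1 + 1 by norm_num, contDiff_succ_iff_deriv]
  refine ⟨fun x => (h1 x).differentiableAt, by simp, ?_⟩
  rw [e1, contDiff_one_iff_deriv, e2]
  exact ⟨fun x => (h2 x).differentiableAt, hc⟩

theorem sle_k (α E M : ℝ) (hM : 0 < M) (hh : ∀ x, M ≤ x → 1 ≤ x ^ α + E) :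
    ∃ k l : ℝ → ℝ, (∀ x, 0 < k x) ∧ Continuous l ∧ (∀ x, HasDerivAt k (l x * k x) x) ∧
      (∀ x, M ≤ x → l x = α / (2 * x) * (1 - E / (x ^ α + E))) ∧
      (∀ x, M ≤ x → k x ^ 2 = x ^ α + E) := by
  let l : ℝ → ℝ := fun x => α / (2 * max x M) * (1 - E / (max x M ^ α + E))
  have hy : ∀ x, 0 < max x M := fun x => lt_max_of_lt_right hM
  have hlc : Continuous l := by
    have h1 : Continuous fun x : ℝ => max x M := by fun_prop
    have h2 : Continuous fun x : ℝ => max x M ^ α :=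
      h1.rpow_const (fun x => Or.inl (hy x).ne')
    have h3 : ∀ x, max x M ^ α + E ≠ 0 := fun x => by
      have := hh (max x M) (le_max_right _ _); linarith
    have h4 : ∀ x, 2 * max x M ≠ 0 := fun x => by have := hy x; positivity
    exact (continuous_const.div (by fun_prop) h4).mul
      (continuous_const.sub (continuous_const.div (by fun_prop) h3))
  have hI : ∀ x, HasDerivAt (fun x => ∫ s in M..x, l s) (l x) x := fun x =>
    intervalIntegral.integral_hasDerivAt_right (hlc.intervalIntegrable _ _)
      (hlc.stronglyMeasurableAtFilter _ _) hlc.continuousAt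
  have hlM : ∀ x, M ≤ x → l x = α / (2 * x) * (1 - E / (x ^ α + E)) := fun x hx => by
    simp only [l, max_eq_left hx]
  have hM1 := hh M le_rfl
  refine ⟨fun x => sqrt (M ^ α + E) * exp (∫ s in M..x, l s), l, fun x => ?_, hlc, fun x => ?_,
    hlM, fun x hx => ?_⟩
  · have : 0 < sqrt (M ^ α + E) := sqrt_pos.2 (by linarith)
    positivity
  · refine ((hI x).exp.const_mul (sqrt (M ^ α + E))).congr_deriv ?_
    ring
  · have hint : ∫ s in M..x, l s = 1 / 2 * log (x ^ α + E) - 1 / 2 * log (M ^ α + E) := by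
      apply intervalIntegral.integral_eq_sub_of_hasDerivAt (f := fun x => 1 / 2 * log (x ^ α + E))
        _ (hlc.intervalIntegrable _ _)
      intro s hs
      rw [uIcc_of_le hx] at hs
      have hs0 : 0 < s := by linarith [hs.1]
      have hs1 := hh s hs.1
      have hne : s ^ α + E ≠ 0 := by linarith
      have := (((hasDerivAt_rpow_const (p := α) (Or.inl hs0.ne')).add_const E).log hne).const_mul
        (1 / 2)
      refine this.congr_deriv ?_
      rw [hlM s hs.1, rpow_sub_one hs0.ne']
      field_simp
      ring
    have hx1 := hh x hx
    simp only [hint]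
    rw [mul_pow, sq_sqrt (by linarith), ← exp_nat_mul]
    have : ((2:ℕ):ℝ) * (1 / 2 * log (x ^ α + E) - 1 / 2 * log (M ^ α + E)) =
      log (x ^ α + E) - log (M ^ α + E) := by push_cast; ring
    rw [this, exp_sub, exp_log (by linarith), exp_log (by linarith)]
    field_simp

theorem sle_freq (θ θ' : ℝ → ℝ) (X1 : ℝ) (h : ∀ x, HasDerivAt θ (θ' x) x)
    (h1 : ∀ x, X1 ≤ x → 1 ≤ θ' x) : ∃ᶠ x in atTop, sin (2 * θ x) = 1 := by
  have hc : Continuous θ := continuous_iff_continuousAt.2 fun t => (h t).continuousAt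
  have hm : MonotoneOn (fun x => θ x - x) (Ici X1) := by
    refine monotoneOn_of_deriv_nonneg (convex_Ici X1) (by fun_prop)
      (fun t _ => ((h t).sub (hasDerivAt_id t)).differentiableAt.differentiableWithinAt) ?_
    intro x hx
    rw [interior_Ici] at hx
    have : deriv (fun x => θ x - x) x = θ' x - 1 := ((h x).sub (hasDerivAt_id x)).deriv
    rw [this]; linarith [h1 x (le_of_lt hx)]
  rw [frequently_atTop]
  intro Y
  set X := max Y X1
  have hXX : X1 ≤ X := le_max_right _ _
  obtain ⟨n, hn⟩ := exists_nat_gt (θ X / π)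
  have hpi := pi_pos
  rw [div_lt_iff₀ hpi] at hn
  set v := π / 4 + n * π with hv
  have hv1 : θ X ≤ v := by linarith
  set X' := X + (v - θ X)
  have hX' : X ≤ X' := by simp only [X']; linarith
  have hv2 : v ≤ θ X' := by
    have := hm (mem_Ici.2 hXX) (mem_Ici.2 (hXX.trans hX')) hX'
    simp only [X'] at this ⊢
    linarith
  obtain ⟨x, hx, hxv⟩ := intermediate_value_Icc hX' hc.continuousOn ⟨hv1, hv2⟩
  refine ⟨x, (le_max_left _ _).trans hx.1, ?_⟩
  rw [hxv, hv, show 2 * (π / 4 + n * π) = π / 2 + n * (2 * π) by ring, sin_add_nat_mul_two_pi,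
    sin_pi_div_two]

theorem stark_line_eigenvalue_exists
    (α : ℝ) (hα0 : 0 < α) (hα2 : α < 2)
    (vt : ℝ → ℝ) (hvt : Continuous vt)
    (hvt0 : ∀ x : ℝ, 0 ≤ x → vt x = -(x ^ α))
    (hvtop : Filter.Tendsto vt Filter.atBot Filter.atTop)
    (E a : ℝ) (ha : ((2 - α) / 4) * Real.pi ≤ a) :
    ∃ q : ℝ → ℝ, Continuous q ∧ (∀ x : ℝ, x < 0 → q x = 0) ∧
      Filter.limsup (fun x : ℝ => x ^ (1 - α / 2) * |q x|) Filter.atTop = a ∧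
      HasL2Eigenfunction vt q E := by
  have hpi := pi_pos
  have ha0 : 0 ≤ a := le_trans (by have : 0 < 2 - α := by linarith
                                   positivity) ha
  set C := π / 2 * (a + 5) with hCdef
  have hC0 : 0 ≤ C := by positivity
  have hC : a + 5 ≤ 2 / π * C := by
    rw [hCdef]; apply le_of_eq; field_simp
  have hxα : Tendsto (fun x : ℝ => x ^ α) atTop atTop := tendsto_rpow_atTop hα0
  obtain ⟨M, hM⟩ := eventually_atTop.1
    ((hxα.eventually_ge_atTop (1 - E)).and (eventually_ge_atTop (exp 1)))
  have hMe : exp 1 ≤ M := (hM M le_rfl).2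
  have hM0 : 0 < M := (exp_pos 1).trans_le hMe
  have hM1 : 1 ≤ M := (one_le_exp zero_le_one).trans hMe
  have hh : ∀ x, M ≤ x → 1 ≤ x ^ α + E := fun x hx => by linarith [(hM x hx).1]
  have hlog : ∀ x, M ≤ x → 1 ≤ log x := fun x hx => by
    rw [le_log_iff_exp_le (by linarith)]; linarith
  obtain ⟨k, l, hk0, hlc, hk, hl, hk2⟩ := sle_k α E M hM0 hh
  have hkc : Continuous k := continuous_iff_continuousAt.2 fun t => (hk t).continuousAt
  obtain ⟨t1, ht1⟩ := eventually_atBot.1 (hvtop.eventually_ge_atTop (E + 1))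
  set t0 := min t1 0 with ht0
  have hVt : ∀ x ≤ t0, 1 ≤ vt x - E := fun x hx => by
    linarith [ht1 x (hx.trans (min_le_left _ _))]
  have ht00 : t0 ≤ 0 := min_le_right _ _
  -- amplitude
  let Lg : ℝ → ℝ := fun x => log (max x M)
  have hy0 : ∀ x, 0 < max x M := fun x => lt_max_of_lt_right hM0
  have hLgc : Continuous Lg := Continuous.log (by fun_prop) (fun x => (hy0 x).ne')
  have hLg1 : ∀ x, 1 ≤ Lg x := fun x => hlog _ (le_max_right _ _)
  let b : ℝ → ℝ := fun x => min 1 (max 0 (x - M)) * ((a + C / Lg x) / max x M)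
  have hbc : Continuous b := by
    refine Continuous.mul (by fun_prop) (Continuous.div ?_ (by fun_prop) (fun x => (hy0 x).ne'))
    exact continuous_const.add (continuous_const.div hLgc (fun x => by linarith [hLg1 x]))
  have hb0 : ∀ x, x ≤ M → b x = 0 := fun x hx => by
    simp only [b]; rw [max_eq_left (by linarith)]; simp
  have hb1 : ∀ x, M + 1 ≤ x → b x = (a + C / log x) / x := fun x hx => by
    simp only [b, Lg]
    rw [max_eq_left (by linarith : M ≤ x), max_eq_right (by linarith : 0 ≤ x - M),
      min_eq_left (by linarith), one_mul]
  have hgc : Continuous fun x => (E - vt x) / k x :=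
    (continuous_const.sub hvt).div hkc (fun x => (hk0 x).ne')
  -- the phase
  obtain ⟨θ, hθ, hθ0⟩ := sle_left_ode (fun x y => sleH (k x) (l x) ((E - vt x) / k x) (b x) (Lg x) y)
    (fun x => 2 * |k x| + 2 * |l x| + 2 * |(E - vt x) / k x| + |b x| * (2 * |Lg x| + 2))
    (by fun_prop)
    (fun y => by
      have : Continuous fun t => sleCl (Lg t * sin (2 * y)) := sleCl_cont.comp (by fun_prop)
      unfold sleH; fun_prop)
    (fun t y => sleH_bdd _ _ _ _ _ _) (fun t y z => sleH_lip _ _ _ _ _ _ _) t0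
    (fun t ht => by simp [sleH, hk0 t])
    (fun t ht => by
      have h1 := hb0 t (by linarith)
      have h2 : (E - vt t) / k t < 0 := div_neg_of_neg_of_pos (by linarith [hVt t ht]) (hk0 t)
      simp only [sleH, h1]; simp [h2])
  have hθc : Continuous θ := continuous_iff_continuousAt.2 fun t => (hθ t).continuousAt
  let S : ℝ → ℝ := fun x => sleCl (Lg x * sin (2 * θ x))
  have hSc : Continuous S := sleCl_cont.comp (by fun_prop)
  let q : ℝ → ℝ := fun x => -(b x * k x * S x)
  have hqc : Continuous q := by fun_prop
  let W : ℝ → ℝ := fun x => E - vt x - q x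
  have hWc : Continuous W := by fun_prop
  have hWk : ∀ x, W x / k x = (E - vt x) / k x + b x * S x := fun x => by
    have := (hk0 x).ne'
    simp only [W, q]; field_simp; ring
  have hθ' : ∀ x, HasDerivAt θ (k x * cos (θ x) ^ 2 + l x * (sin (θ x) * cos (θ x)) +
      W x / k x * sin (θ x) ^ 2) x := fun x => by
    refine (hθ x).congr_deriv ?_
    rw [hWk]; simp only [sleH, S]; ring
  obtain ⟨lnR, hR, hu, hu'⟩ := sle_pruefer k l W θ hk0 hlc hWc hk hθ'
  set u : ℝ → ℝ := fun x => exp (lnR x) * sin (θ x) with hudef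
  set u1 : ℝ → ℝ := fun x => exp (lnR x) * k x * cos (θ x) with hu1def
  have huc : Continuous u := continuous_iff_continuousAt.2 fun t => (hu t).continuousAt
  have hEv : ∀ x, M ≤ x → (E - vt x) / k x = k x := fun x hx => by
    rw [hvt0 x (by linarith), div_eq_iff (hk0 x).ne', ← sq, hk2 x hx]; ring
  have hk1 : ∀ x, M ≤ x → 1 ≤ k x := fun x hx => by
    have h1 := hk2 x hx
    have h2 := hh x hx
    nlinarith [hk0 x]
  have hθ2 : ∀ x, M + 1 ≤ x → k x * cos (θ x) ^ 2 + l x * (sin (θ x) * cos (θ x)) +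
      W x / k x * sin (θ x) ^ 2 = k x + l x * sin (θ x) * cos (θ x) +
      (a + C / log x) / x * S x * sin (θ x) ^ 2 := fun x hx => by
    rw [hWk, hEv x (by linarith), hb1 x hx, sin_sq]; ring
  -- decay
  obtain ⟨X, c, hX1, hX⟩ := sle_decay α a E C (M + 1) hα0 hα2 ha hC hC0 (by linarith) k l θ lnR S
    (fun x hx => hk1 x (by linarith)) (fun x hx => hk2 x (by linarith))
    (fun x hx => hl x (by linarith)) (fun x _ => hk x) (fun x => sleCl_abs _)
    (fun x hx => by
      have hLx : Lg x = log x := by simp only [Lg]; rw [max_eq_left (by linarith)]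
      have := sleCl_mul (Lg x) (sin (2 * θ x)) (by linarith [hLg1 x])
      simp only [S]; rw [← hLx]; exact this)
    (fun x hx => (hθ' x).congr_deriv (hθ2 x hx))
    (fun x hx => (hR x).congr_deriv (by
      rw [hWk, hEv x (by linarith), hb1 x hx]; ring))
  refine ⟨q, hqc, fun x hx => ?_, ?_, ?_⟩
  · simp only [q]; rw [hb0 x (by linarith)]; simp
  · -- limsup
    have hkk : Tendsto (fun x => k x / x ^ (α / 2)) atTop (nhds 1) := by
      have h1 : Tendsto (fun x : ℝ => sqrt (1 + E / x ^ α)) atTop (nhds 1) := by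
        have := ((hxα.const_div_atTop E).const_add 1).sqrt
        simpa using this
      refine h1.congr' ?_
      filter_upwards [eventually_ge_atTop M] with x hx
      have hx0 : 0 < x := by linarith
      have hp : 0 < x ^ (α / 2) := rpow_pos_of_pos hx0 _
      have hp2 : x ^ α = (x ^ (α / 2)) ^ 2 := by
        rw [← rpow_natCast, ← rpow_mul hx0.le]; congr 1; push_cast; ring
      rw [sqrt_eq_iff_mul_self_eq_of_pos (by have := hk0 x; positivity), ← sq, div_pow, hk2 x hx,
        ← hp2]
      have : x ^ α ≠ 0 := (rpow_pos_of_pos hx0 _).ne'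
      field_simp
    have hp : Tendsto (fun x => (a + C / log x) * (k x / x ^ (α / 2))) atTop (nhds a) := by
      have := ((tendsto_log_atTop.const_div_atTop C).const_add a).mul hkk
      simpa using this
    have heq : ∀ x, M + 1 ≤ x → x ^ (1 - α / 2) * |q x| =
        (a + C / log x) * (k x / x ^ (α / 2)) * |S x| := fun x hx => by
      have hx0 : 0 < x := by linarith
      have hL := hlog x (by linarith)
      have hA : 0 ≤ (a + C / log x) / x := by positivity
      simp only [q]
      rw [hb1 x hx, abs_neg, abs_mul, abs_mul, abs_of_nonneg hA, abs_of_pos (hk0 x),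
        rpow_sub hx0, rpow_one]
      have := (rpow_pos_of_pos hx0 (α / 2)).ne'
      field_simp
    have hnn : ∀ x, M + 1 ≤ x → 0 ≤ (a + C / log x) * (k x / x ^ (α / 2)) := fun x hx => by
      have hx0 : 0 < x := by linarith
      have hL := hlog x (by linarith)
      have := hk0 x
      positivity
    refine sle_limsup _ _ a hp ?_ ?_ ?_
    · filter_upwards [eventually_ge_atTop (M + 1)] with x hx
      rw [heq x hx]
      exact mul_le_of_le_one_right (hnn x hx) (sleCl_abs _)
    · filter_upwards [eventually_ge_atTop (M + 1)] with x hx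
      rw [heq x hx]
      exact mul_nonneg (hnn x hx) (abs_nonneg _)
    · obtain ⟨X2, hX2⟩ := eventually_atTop.1
        ((hxα.eventually_ge_atTop ((3 + |E| + a + C) ^ 2 - E)).and (eventually_ge_atTop (M + 1)))
      have hfr := sle_freq θ _ X2 hθ' (fun x hx => by
        obtain ⟨h1, h2⟩ := hX2 x hx
        have hx0 : 0 < x := by linarith
        rw [hθ2 x h2]
        have hkb : 3 + |E| + a + C ≤ k x := by
          apply le_of_sq_le_sq _ (hk0 x).le
          rw [hk2 x (by linarith)]; linarith
        have hlb : |l x| ≤ 1 + |E| := by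
          rw [hl x (by linarith), abs_mul]
          have e1 : |α / (2 * x)| ≤ 1 := by
            rw [abs_of_nonneg (by positivity), div_le_one (by positivity)]; linarith
          have e2 : |1 - E / (x ^ α + E)| ≤ 1 + |E| := by
            have h3 := hh x (by linarith)
            refine (abs_sub _ _).trans ?_
            rw [abs_one, abs_div, abs_of_pos (by linarith : 0 < x ^ α + E)]
            linarith [div_le_self (abs_nonneg E) h3]
          nlinarith [abs_nonneg (1 - E / (x ^ α + E))]
        have hL := hlog x (by linarith)
        have hA0 : 0 ≤ (a + C / log x) / x := by positivity
        have hA : (a + C / log x) / x ≤ a + C := by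
          refine (div_le_self (by positivity) (by linarith)).trans ?_
          linarith [div_le_self hC0 hL]
        have f1 : |l x * sin (θ x) * cos (θ x)| ≤ 1 + |E| := by
          rw [abs_mul, abs_mul, mul_assoc]
          exact (mul_le_of_le_one_right (abs_nonneg _) (mul_le_one₀ (abs_sin_le_one _)
            (abs_nonneg _) (abs_cos_le_one _))).trans hlb
        have f2 : |(a + C / log x) / x * S x * sin (θ x) ^ 2| ≤ a + C := by
          rw [abs_mul, abs_mul, mul_assoc, abs_of_nonneg hA0, abs_pow]
          exact (mul_le_of_le_one_right hA0 (mul_le_one₀ (sleCl_abs _)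
            (pow_nonneg (abs_nonneg _) _) (pow_le_one₀ (abs_nonneg _) (abs_sin_le_one _)))).trans hA
        linarith [(abs_le.1 f1).1, (abs_le.1 f2).1])
      refine (hfr.and_eventually (eventually_ge_atTop (M + 1))).mono fun x hx => ?_
      rw [heq x hx.2]
      have : S x = 1 := by
        simp only [S]
        rw [hx.1, mul_one]
        unfold sleCl
        rw [min_eq_left (hLg1 x), max_eq_right (by norm_num)]
      rw [this]; simp
  · obtain ⟨g1, g2⟩ := sle_contDiff u u1 (fun x => -W x * u x) hu hu' (by fun_prop)
    refine ⟨u, g1, fun x => ?_, ?_, ?_⟩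
    · rw [g2]; simp only [W]; ring
    · by_contra hne
      push Not at hne
      have hu0 : u = fun _ => 0 := funext hne
      have h1 : u1 0 = 0 := by
        have h5 : deriv u 0 = u1 0 := (hu 0).deriv
        rw [← h5, hu0]; simp
      have h2 : u 0 = 0 := hne 0
      simp only [hu1def, hudef] at h1 h2
      have h3 : sin (θ 0) = 0 := by
        rcases mul_eq_zero.1 h2 with h | h
        · exact absurd h (exp_pos _).ne'
        · exact h
      have h4 : cos (θ 0) = 0 := by
        rcases mul_eq_zero.1 h1 with h | h
        · exact absurd h (mul_pos (exp_pos _) (hk0 0)).ne'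
        · exact h
      have := sin_sq_add_cos_sq (θ 0)
      rw [h3, h4] at this
      norm_num at this
    · have i1 : IntegrableOn (fun x => u x ^ 2) (Iic t0) := by
        refine sle_left_int u u1 W t0 hWc hu hu' (fun x hx => ?_) (fun x hx => ?_) (fun x hx => ?_)
        · have h := hθ0 x hx
          exact mul_nonneg (exp_pos _).le (sin_nonneg_of_nonneg_of_le_pi h.1 (by linarith [h.2]))
        · have h := hθ0 x hx
          exact mul_nonneg (mul_pos (exp_pos _) (hk0 x)).le
            (cos_nonneg_of_neg_pi_div_two_le_of_le (by linarith [h.1]) h.2)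
        · simp only [W, q]; rw [hb0 x (by linarith)]; linarith [hVt x hx]
      have i2 : IntegrableOn (fun x => u x ^ 2) (Ioi X) := by
        refine sle_right_int u huc X c hX1 (fun x hx => le_trans ?_ (hX x hx))
        simp only [hudef]
        rw [mul_pow, ← exp_nat_mul]
        push_cast
        exact mul_le_of_le_one_right (exp_pos _).le (sin_sq_le_one _)
      have i3 : IntegrableOn (fun x => u x ^ 2) (Icc t0 X) :=
        (huc.pow 2).continuousOn.integrableOn_Icc
      rw [← integrableOn_univ]
      refine ((i1.union i3).union i2).mono_set fun x _ => ?_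
      rcases le_total x t0 with h | h
      · exact Or.inl (Or.inl h)
      · rcases le_or_gt x X with h' | h'
        · exact Or.inl (Or.inr ⟨h, h'⟩)
        · exact Or.inr h'
end

section
/- Let h : (0,∞) → (0,∞) be any function with h(x) → ∞ as x → ∞, and let (E_j)_{j≥1} be any sequence of distinct real numbers. Then there exists a function q ∈ C^∞(ℝ) with |q(x)| ≤ h(x)/(1 + x^{1-α/2}) for all x > 0 such that, for every j, there exists an L²(ℝ) eigenfunction for energy E_j of -u'' + ṽ·u + q·u. -/
open Filter MeasureTheory Set Real

open scoped Topology NNReal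

lemma ode_unique {F : Type*} [NormedAddCommGroup F] [NormedSpace ℝ F] (v : ℝ → F → F)
    (hv : ∀ n : ℕ, ∃ L : ℝ≥0, ∀ x : ℝ, |x| ≤ n → LipschitzWith L (v x))
    (f g : ℝ → F) (a b t₀ : ℝ) (ht : t₀ ∈ Ioo a b)
    (hf : ∀ x ∈ Ioo a b, HasDerivAt f (v x (f x)) x)
    (hg : ∀ x ∈ Ioo a b, HasDerivAt g (v x (g x)) x) (h0 : f t₀ = g t₀) :
    EqOn f g (Ioo a b) := by
  obtain ⟨n, hn⟩ := exists_nat_ge (max |a| |b|)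
  obtain ⟨L, hL⟩ := hv n
  refine ODE_solution_unique_of_mem_Ioo (v := v) (s := fun _ => univ) (K := L) ?_ ht
    (fun x hx => ⟨hf x hx, trivial⟩) (fun x hx => ⟨hg x hx, trivial⟩) h0
  intro x hx
  exact (hL x ((abs_le_max_abs_abs hx.1.le hx.2.le).trans hn)).lipschitzOnWith

lemma ode_global {F : Type*} [NormedAddCommGroup F] [NormedSpace ℝ F] [CompleteSpace F]
    (v : ℝ → F → F)
    (hv : ∀ n : ℕ, ∃ L : ℝ≥0, ∀ x : ℝ, |x| ≤ n → LipschitzWith L (v x))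
    (hb : ∀ n : ℕ, ∃ L : ℝ≥0, ∀ x : ℝ, |x| ≤ n → ∀ y, ‖v x y‖ ≤ L)
    (hc : ∀ y, Continuous (fun x => v x y)) (t₀ : ℝ) (y₀ : F) :
    ∃ f : ℝ → F, f t₀ = y₀ ∧ ∀ x, HasDerivAt f (v x (f x)) x := by
  have key : ∀ n : ℕ, ∃ f : ℝ → F, f t₀ = y₀ ∧
      ∀ x ∈ Ioo (t₀ - (n+1)) (t₀ + (n+1)), HasDerivAt f (v x (f x)) x := by
    intro n
    obtain ⟨m, hm⟩ := exists_nat_ge (|t₀| + (n+1))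
    obtain ⟨K, hK⟩ := hv m
    obtain ⟨L, hL⟩ := hb m
    have hxm : ∀ x ∈ Icc (t₀ - (n+1)) (t₀ + (n+1)), |x| ≤ m := by
      intro x hx
      refine le_trans ?_ hm
      rw [abs_le]
      constructor
      · linarith [hx.1, neg_abs_le t₀]
      · linarith [hx.2, le_abs_self t₀]
    have hp : IsPicardLindelof v (tmin := t₀ - (n+1)) (tmax := t₀ + (n+1))
        ⟨t₀, by constructor <;> linarith [(Nat.cast_nonneg n : (0:ℝ) ≤ n)]⟩ y₀ (L * (n+1)) 0 L K := by
      refine ⟨fun t ht => (hK t (hxm t ht)).lipschitzOnWith, fun y _ => (hc y).continuousOn,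
        fun t ht y _ => hL t (hxm t ht) y, ?_⟩
      simp
    obtain ⟨f, hf0, hf⟩ := hp.exists_eq_forall_mem_Icc_hasDerivWithinAt₀
    exact ⟨f, hf0, fun x hx => (hf x (Ioo_subset_Icc_self hx)).hasDerivAt (Icc_mem_nhds hx.1 hx.2)⟩
  choose f hf0 hf using key
  have agree : ∀ m n : ℕ, m ≤ n → EqOn (f m) (f n) (Ioo (t₀ - (m+1)) (t₀ + (m+1))) := by
    intro m n hmn
    have hmn' : (m:ℝ) ≤ n := by exact_mod_cast hmn
    have hm0 : (0:ℝ) ≤ m := Nat.cast_nonneg m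
    refine ode_unique v hv _ _ _ _ t₀ ⟨by linarith, by linarith⟩ (hf m) ?_ (by rw [hf0, hf0])
    intro x hx
    exact hf n x ⟨by linarith [hx.1], by linarith [hx.2]⟩
  have hval : ∀ (n : ℕ) (x : ℝ), x ∈ Ioo (t₀ - (n+1)) (t₀ + (n+1)) →
      f ⌈|x - t₀|⌉₊ x = f n x := by
    intro n x hx
    have h1 : |x - t₀| ≤ ⌈|x - t₀|⌉₊ := Nat.le_ceil _
    have h2 := abs_le.1 h1
    rcases le_total ⌈|x - t₀|⌉₊ n with h | h
    · exact agree _ _ h ⟨by linarith [h2.1], by linarith [h2.2]⟩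
    · exact (agree _ _ h hx).symm
  refine ⟨fun x => f ⌈|x - t₀|⌉₊ x, by simp [hf0], ?_⟩
  intro x
  obtain ⟨n, hn⟩ := exists_nat_ge (|x - t₀|)
  have h2 := abs_le.1 hn
  have hx : x ∈ Ioo (t₀ - (n+1)) (t₀ + (n+1)) := ⟨by linarith [h2.1], by linarith [h2.2]⟩
  have := hf n x hx
  show HasDerivAt _ (v x (f ⌈|x - t₀|⌉₊ x)) x
  rw [hval n x hx]
  refine this.congr_of_eventuallyEq ?_
  filter_upwards [Ioo_mem_nhds hx.1 hx.2] with y hy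
  exact hval n y hy

/-- Prüfer vector field -/
noncomputable def pv (b t : ℝ) : ℝ := sin t ^ 2 + b * cos t ^ 2

lemma sin_sq_lip (s t : ℝ) : |sin s ^ 2 - sin t ^ 2| ≤ 2 * |s - t| := by
  have h1 : |sin s - sin t| ≤ |s - t| := by
    have := abs_sin_sub_sin_le s t
    exact this
  have h2 : |sin s + sin t| ≤ 2 := by
    rw [abs_le]; constructor <;> linarith [neg_one_le_sin s, neg_one_le_sin t, sin_le_one s, sin_le_one t]
  have : sin s ^ 2 - sin t ^ 2 = (sin s + sin t) * (sin s - sin t) := by ring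
  rw [this, abs_mul]
  exact mul_le_mul h2 h1 (abs_nonneg _) (by norm_num)

lemma pv_bound (b t : ℝ) : |pv b t| ≤ 1 + |b| := by
  unfold pv
  refine (abs_add_le _ _).trans (add_le_add ?_ ?_)
  · rw [abs_of_nonneg (sq_nonneg _)]; exact sin_sq_le_one t
  · rw [abs_mul, abs_of_nonneg (sq_nonneg (cos t))]
    exact mul_le_of_le_one_right (abs_nonneg _) (cos_sq_le_one t)

lemma pv_lip (b b' s t : ℝ) : |pv b s - pv b' t| ≤ (2 + 2 * |b|) * |s - t| + |b - b'| := by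
  have e : pv b s - pv b' t = (1 - b) * (sin s ^ 2 - sin t ^ 2) + (b - b') * cos t ^ 2 := by
    unfold pv; rw [cos_sq', cos_sq']; ring
  rw [e]
  refine (abs_add_le _ _).trans (add_le_add ?_ ?_)
  · rw [abs_mul]
    have h1 : |1 - b| ≤ 1 + |b| := by simpa using abs_sub (1:ℝ) b
    calc |1 - b| * |sin s ^ 2 - sin t ^ 2| ≤ (1 + |b|) * (2 * |s - t|) :=
          mul_le_mul h1 (sin_sq_lip s t) (abs_nonneg _) (by positivity)
      _ = _ := by ring
  · rw [abs_mul, abs_of_nonneg (sq_nonneg (cos t))]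
    exact mul_le_of_le_one_right (abs_nonneg _) (cos_sq_le_one t)

/-- Finite systems. -/
lemma finite_system (K : ℕ) (b : ℕ → ℝ → ℝ) (hb : ∀ j, Continuous (b j)) (Q : ℕ → ℝ → ℝ → ℝ)
    (hQc : ∀ i t, Continuous (fun x => Q i x t))
    (hQ : ∀ (n : ℕ), ∃ L : ℝ≥0, ∀ i < K, ∀ x : ℝ, |x| ≤ n → ∀ s t, |Q i x t| ≤ L ∧
      |Q i x s - Q i x t| ≤ L * |s - t|) :
    ∃ v : ℝ → (Fin K → ℝ) → (Fin K → ℝ),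
      (∀ x y j, v x y j = pv (b j x - ∑ i : Fin K, Q i x (y i)) (y j)) ∧
      (∀ n : ℕ, ∃ L : ℝ≥0, ∀ x : ℝ, |x| ≤ n → LipschitzWith L (v x)) ∧
      (∀ n : ℕ, ∃ L : ℝ≥0, ∀ x : ℝ, |x| ≤ n → ∀ y, ‖v x y‖ ≤ L) ∧
      (∀ y, Continuous (fun x => v x y)) := by
  have hbb : ∀ n : ℕ, ∃ L : ℝ≥0, ∀ j < K, ∀ x : ℝ, |x| ≤ n → |b j x| ≤ L := by
    intro n
    have : ∀ j, ∃ L : ℝ≥0, ∀ x : ℝ, |x| ≤ n → |b j x| ≤ L := by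
      intro j
      obtain ⟨C, hC⟩ := (isCompact_Icc (a := -(n:ℝ)) (b := n)).exists_bound_of_continuousOn (hb j).continuousOn
      refine ⟨⟨max C 0, le_max_right _ _⟩, fun x hx => ?_⟩
      exact (hC x (abs_le.1 hx)).trans (le_max_left _ _)
    choose L hL using this
    refine ⟨∑ j ∈ Finset.range K, L j, fun j hj x hx => (hL j x hx).trans ?_⟩
    exact_mod_cast Finset.single_le_sum (f := L) (fun i _ => zero_le) (Finset.mem_range.2 hj)
  refine ⟨fun x y j => pv (b j x - ∑ i : Fin K, Q i x (y i)) (y j), fun _ _ _ => rfl, ?_, ?_, ?_⟩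
  · intro n
    obtain ⟨B, hB⟩ := hbb n
    obtain ⟨L, hL⟩ := hQ n
    refine ⟨(2 + 2 * (B + K * L)) + K * L, fun x hx => LipschitzWith.of_dist_le_mul ?_⟩
    intro y z
    rw [dist_pi_le_iff (by positivity)]
    intro j
    rw [Real.dist_eq]
    have hd : ∀ i : Fin K, |y i - z i| ≤ dist y z := fun i => by
      rw [← Real.dist_eq]; exact dist_le_pi_dist y z i
    refine (pv_lip _ _ _ _).trans ?_
    push_cast
    rw [add_mul _ _ (dist y z)]
    have hs1 : |∑ i : Fin K, Q i x (y i)| ≤ K * L := by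
      refine (Finset.abs_sum_le_sum_abs _ _).trans ?_
      refine (Finset.sum_le_sum (fun (i : Fin K) _ => (hL (i:ℕ) i.2 x hx (y i) (y i)).1)).trans ?_
      simp
    have hs2 : |∑ i : Fin K, (Q i x (z i) - Q i x (y i))| ≤ K * L * dist y z := by
      refine (Finset.abs_sum_le_sum_abs _ _).trans ?_
      have : ∀ i ∈ (Finset.univ : Finset (Fin K)), |Q i x (z i) - Q i x (y i)| ≤ L * dist y z := by
        intro i _
        refine (hL i i.2 x hx (z i) (y i)).2.trans ?_
        rw [abs_sub_comm]
        exact mul_le_mul_of_nonneg_left (hd i) L.2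
      refine (Finset.sum_le_sum this).trans ?_
      simp [mul_assoc]
    refine add_le_add (mul_le_mul ?_ (hd j) (abs_nonneg _) ?_) ?_
    · have : |b j x - ∑ i : Fin K, Q i x (y i)| ≤ B + K * L :=
        (abs_sub _ _).trans (add_le_add (hB j j.2 x hx) hs1)
      linarith
    · have := B.2; have := L.2; positivity
    · refine le_trans (le_of_eq ?_) hs2
      rw [Finset.sum_sub_distrib]; congr 1; ring
  · intro n
    obtain ⟨B, hB⟩ := hbb n
    obtain ⟨L, hL⟩ := hQ n
    refine ⟨1 + (B + K * L), fun x hx y => ?_⟩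
    rw [pi_norm_le_iff_of_nonneg (by positivity)]
    intro j
    rw [Real.norm_eq_abs]
    refine (pv_bound _ _).trans ?_
    push_cast
    have hs1 : |∑ i : Fin K, Q i x (y i)| ≤ K * L := by
      refine (Finset.abs_sum_le_sum_abs _ _).trans ?_
      refine (Finset.sum_le_sum (fun (i : Fin K) _ => (hL (i:ℕ) i.2 x hx (y i) (y i)).1)).trans ?_
      simp
    have := (abs_sub (b j x) (∑ i : Fin K, Q i x (y i))).trans (add_le_add (hB j j.2 x hx) hs1)
    linarith
  · intro y
    refine continuous_pi fun j => ?_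
    unfold pv
    have := hb j
    have h2 : Continuous (fun x => ∑ i : Fin K, Q i x (y i)) :=
      continuous_finsetSum _ (fun i _ => hQc i (y i))
    fun_prop

lemma infinite_system (b : ℕ → ℝ → ℝ) (hb : ∀ j, Continuous (b j)) (Q : ℕ → ℝ → ℝ → ℝ)
    (hQc : ∀ i t, Continuous (fun x => Q i x t))
    (hQ : ∀ (i : ℕ) (n : ℕ), ∃ L : ℝ≥0, ∀ x : ℝ, |x| ≤ n → ∀ s t, |Q i x t| ≤ L ∧
      |Q i x s - Q i x t| ≤ L * |s - t|)
    (X : ℕ → ℝ) (hXm : Monotone X) (hX : ∀ i : ℕ, (i:ℝ) + 1 ≤ X i)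
    (hQ0 : ∀ i x t, x ≤ X i → Q i x t = 0) (t0 : ℕ → ℝ) :
    ∃ θ : ℕ → ℝ → ℝ, (∀ j, θ j 0 = t0 j) ∧
      ∀ j M x, x < X M → HasDerivAt (θ j)
        (pv (b j x - ∑ i ∈ Finset.range M, Q i x (θ i x)) (θ j x)) x := by
  have hQ' : ∀ K : ℕ, ∀ (n : ℕ), ∃ L : ℝ≥0, ∀ i < K, ∀ x : ℝ, |x| ≤ n → ∀ s t, |Q i x t| ≤ L ∧
      |Q i x s - Q i x t| ≤ L * |s - t| := by
    intro K n
    choose L hL using fun i => hQ i n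
    refine ⟨∑ j ∈ Finset.range K, L j, fun i hi x hx s t => ?_⟩
    have h1 : (L i : ℝ) ≤ (∑ j ∈ Finset.range K, L j : ℝ≥0) := by
      exact_mod_cast Finset.single_le_sum (f := L) (fun i _ => zero_le) (Finset.mem_range.2 hi)
    have := hL i x hx s t
    exact ⟨this.1.trans h1, this.2.trans (mul_le_mul_of_nonneg_right h1 (abs_nonneg _))⟩
  choose v hv hvL hvb hvc using fun K => finite_system K b hb Q hQc (hQ' K)
  choose f hf0 hf using fun K => ode_global (v K) (hvL K) (hvb K) (hvc K) 0 (fun j => t0 j)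
  -- component form
  have hfc : ∀ K (j : Fin K) x, HasDerivAt (fun x => f K x j)
      (pv (b j x - ∑ i : Fin K, Q i x (f K x i)) (f K x j)) x := by
    intro K j x
    have := (hasDerivAt_pi.1 (hf K x)) j
    rwa [hv] at this
  have agree : ∀ K K' (h : K ≤ K'), ∀ x < X K, ∀ j : Fin K, f K x j = f K' x (Fin.castLE h j) := by
    intro K K' h x hx j
    have hX0 : 0 < X K := by have := hX K; have : (0:ℝ) ≤ K := Nat.cast_nonneg K; linarith
    have := ode_unique (v K) (hvL K) (f K) (fun x j => f K' x (Fin.castLE h j)) (-(|x| + 1)) (X K) 0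
      ⟨by linarith [abs_nonneg x], hX0⟩ (fun y _ => hf K y) ?_ ?_
    · have h3 := this (x := x) ⟨by linarith [neg_abs_le x], hx⟩
      exact congrFun h3 j
    · intro y hy
      rw [hasDerivAt_pi]
      intro j
      have h4 := hfc K' (Fin.castLE h j) y
      rw [hv]
      suffices hs : ∑ i : Fin K, Q i y (f K' y (Fin.castLE h i)) = ∑ i : Fin K', Q i y (f K' y i) by
        rw [hs]; exact h4
      have e1 := Finset.sum_range (n := K) (fun i => if hi : i < K' then Q i y (f K' y ⟨i, hi⟩) else 0)
      have e2 := Finset.sum_range (n := K') (fun i => if hi : i < K' then Q i y (f K' y ⟨i, hi⟩) else 0)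
      have e3 : ∑ i : Fin K, Q i y (f K' y (Fin.castLE h i)) =
          ∑ i : Fin K, (if hi : (i:ℕ) < K' then Q i y (f K' y ⟨i, hi⟩) else 0) := by
        refine Finset.sum_congr rfl fun i _ => ?_
        rw [dif_pos (lt_of_lt_of_le i.2 h)]; rfl
      have e4 : ∑ i : Fin K', Q i y (f K' y i) =
          ∑ i : Fin K', (if hi : (i:ℕ) < K' then Q i y (f K' y ⟨i, hi⟩) else 0) := by
        refine Finset.sum_congr rfl fun i _ => ?_
        rw [dif_pos i.2]
      rw [e3, e4, ← e1, ← e2]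
      refine Finset.sum_subset (Finset.range_mono h) ?_
      intro i hi hi'
      rw [dif_pos (Finset.mem_range.1 hi)]
      exact hQ0 _ _ _ (hy.2.le.trans (hXm (not_lt.1 (fun h => hi' (Finset.mem_range.2 h)))))
    · rw [hf0]; ext j; simp [hf0]
  let κ : ℕ → ℝ → ℕ := fun j x => max (j+1) ⌈|x|⌉₊
  have hκ1 : ∀ j x, j < κ j x := fun j x => lt_of_lt_of_le (Nat.lt_succ_self j) (le_max_left _ _)
  have hκ2 : ∀ j x, x < X (κ j x) := by
    intro j x
    have h1 : x ≤ ⌈|x|⌉₊ := (le_abs_self x).trans (Nat.le_ceil _)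
    have h2 : ((⌈|x|⌉₊ : ℕ) : ℝ) ≤ (κ j x : ℕ) := by exact_mod_cast le_max_right _ _
    linarith [hX (κ j x)]
  let θ : ℕ → ℝ → ℝ := fun j x => f (κ j x) x ⟨j, hκ1 j x⟩
  have hθ : ∀ K j (hj : j < K) x, x < X K → θ j x = f K x ⟨j, hj⟩ := by
    intro K j hj x hx
    rcases le_total (κ j x) K with h | h
    · exact agree _ _ h x (hκ2 j x) ⟨j, hκ1 j x⟩
    · exact (agree _ _ h x hx ⟨j, hj⟩).symm
  refine ⟨θ, fun j => by simp [θ, hf0], ?_⟩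
  intro j M x hx
  set K := max M (j+1) with hK
  have hjK : j < K := lt_of_lt_of_le (Nat.lt_succ_self j) (le_max_right _ _)
  have hxK : x < X K := hx.trans_le (hXm (le_max_left _ _))
  have h1 := hfc K ⟨j, hjK⟩ x
  have h2 : ∑ i : Fin K, Q i x (f K x i) = ∑ i ∈ Finset.range M, Q i x (θ i x) := by
    have e1 := Finset.sum_range (n := K) (fun i => Q i x (θ i x))
    have e2 : ∑ i : Fin K, Q i x (f K x i) = ∑ i : Fin K, Q i x (θ i x) :=
      Finset.sum_congr rfl fun i _ => by rw [hθ K i i.2 x hxK]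
    rw [e2, ← e1]
    symm
    refine Finset.sum_subset (Finset.range_mono (le_max_left _ _)) ?_
    intro i hi hi'
    exact hQ0 _ _ _ (hx.le.trans (hXm (not_lt.1 (fun h => hi' (Finset.mem_range.2 h)))))
  rw [h2, ← hθ K j hjK x hxK] at h1
  refine h1.congr_of_eventuallyEq ?_
  filter_upwards [Iio_mem_nhds hxK] with y hy
  exact hθ K j hjK y hy

structure IsSol (b u u' : ℝ → ℝ) : Prop where
  d1 : ∀ x, HasDerivAt u (u' x) x
  d2 : ∀ x, HasDerivAt u' (-(b x) * u x) x

lemma IsSol.comb {b u u' w w' : ℝ → ℝ} (h1 : IsSol b u u') (h2 : IsSol b w w') (c d : ℝ) :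
    IsSol b (fun x => c * u x + d * w x) (fun x => c * u' x + d * w' x) := by
  refine ⟨fun x => ((h1.d1 x).const_mul c).add ((h2.d1 x).const_mul d), fun x => ?_⟩
  refine HasDerivAt.congr_deriv (((h1.d2 x).const_mul c).add ((h2.d2 x).const_mul d)) ?_
  ring

lemma prufer_rho (b : ℝ → ℝ) (hb : Continuous b) (θ : ℝ → ℝ)
    (hθ : ∀ x, HasDerivAt θ (pv (b x) (θ x)) x) :
    ∃ ρ : ℝ → ℝ, ∀ x, HasDerivAt ρ ((b x - 1) * (sin (θ x) * cos (θ x))) x := by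
  have hc : Continuous θ := continuous_iff_continuousAt.2 fun x => (hθ x).continuousAt
  have hc2 : Continuous (fun x => (b x - 1) * (sin (θ x) * cos (θ x))) := by fun_prop
  refine ⟨fun x => ∫ t in (0:ℝ)..x, (b t - 1) * (sin (θ t) * cos (θ t)), fun x => ?_⟩
  exact intervalIntegral.integral_hasDerivAt_right (hc2.intervalIntegrable _ _)
    (hc2.stronglyMeasurableAtFilter _ _) hc2.continuousAt

lemma prufer_sol (b : ℝ → ℝ) (θ ρ : ℝ → ℝ)
    (hθ : ∀ x, HasDerivAt θ (pv (b x) (θ x)) x)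
    (hρ : ∀ x, HasDerivAt ρ ((b x - 1) * (sin (θ x) * cos (θ x))) x) :
    IsSol b (fun x => exp (ρ x) * cos (θ x)) (fun x => -(exp (ρ x) * sin (θ x))) := by
  constructor
  · intro x
    refine HasDerivAt.congr_deriv ((hρ x).exp.mul (hθ x).cos) ?_
    unfold pv
    linear_combination (-(exp (ρ x) * sin (θ x))) * (sin_sq_add_cos_sq (θ x))
  · intro x
    refine HasDerivAt.congr_deriv (((hρ x).exp.mul (hθ x).sin).neg) ?_
    unfold pv
    linear_combination (-exp (ρ x) * cos (θ x) * b x) * (sin_sq_add_cos_sq (θ x))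

lemma polar (A B : ℝ) : ∃ r φ : ℝ, A = r * cos φ ∧ B = -(r * sin φ) := by
  refine ⟨‖(⟨A, -B⟩ : ℂ)‖, Complex.arg ⟨A, -B⟩, ?_, ?_⟩
  · rw [Complex.norm_mul_cos_arg]
  · rw [Complex.norm_mul_sin_arg]; simp

lemma lin_ivp (b : ℝ → ℝ) (hb : Continuous b) (t₀ A B : ℝ) :
    ∃ u u' : ℝ → ℝ, IsSol b u u' ∧ u t₀ = A ∧ u' t₀ = B := by
  obtain ⟨r, φ, hA, hB⟩ := polar A B
  have hbd : ∀ n : ℕ, ∃ C : ℝ≥0, ∀ x : ℝ, |x| ≤ n → |b x| ≤ C := by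
    intro n
    obtain ⟨C, hC⟩ := (isCompact_Icc (a := -(n:ℝ)) (b := n)).exists_bound_of_continuousOn hb.continuousOn
    exact ⟨⟨max C 0, le_max_right _ _⟩, fun x hx => (hC x (abs_le.1 hx)).trans (le_max_left _ _)⟩
  obtain ⟨θ, h0, hθ⟩ := ode_global (fun x t => pv (b x) t) (by
      intro n
      obtain ⟨C, hC⟩ := hbd n
      refine ⟨2 + 2 * C, fun x hx => LipschitzWith.of_dist_le_mul fun s t => ?_⟩
      have := pv_lip (b x) (b x) s t
      rw [Real.dist_eq, Real.dist_eq]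
      simp only [sub_self, abs_zero, add_zero] at this
      refine this.trans (mul_le_mul_of_nonneg_right ?_ (abs_nonneg _))
      push_cast
      linarith [hC x hx]) (by
      intro n
      obtain ⟨C, hC⟩ := hbd n
      refine ⟨1 + C, fun x hx t => ?_⟩
      rw [Real.norm_eq_abs]; push_cast
      exact (pv_bound _ _).trans (by linarith [hC x hx])) (by
      intro y; unfold pv; fun_prop) t₀ φ
  obtain ⟨ρ, hρ⟩ := prufer_rho b hb θ hθ
  have hs := prufer_sol b θ ρ hθ hρ
  refine ⟨_, _, hs.comb hs (r * exp (-ρ t₀)) 0, ?_, ?_⟩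
  · simp only [h0, hA, zero_mul, add_zero]
    have : exp (-ρ t₀) * exp (ρ t₀) = 1 := by rw [← exp_add]; simp
    linear_combination (r * cos φ) * this
  · simp only [h0, hB, zero_mul, add_zero]
    have : exp (-ρ t₀) * exp (ρ t₀) = 1 := by rw [← exp_add]; simp
    linear_combination (-(r * sin φ)) * this

lemma sol_unique (b b' : ℝ → ℝ) (hb : Continuous b) (u u' w w' : ℝ → ℝ) (h1 : IsSol b u u')
    (h2 : IsSol b' w w') (c : ℝ) (hc : 0 < c) (hbb : ∀ x < c, b' x = b x) (e1 : u 0 = w 0)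
    (e2 : u' 0 = w' 0) : ∀ x < c, u x = w x := by
  intro x hx
  have := ode_unique (fun x (y : ℝ × ℝ) => (y.2, -(b x) * y.1)) (by
      intro n
      obtain ⟨C, hC⟩ := (isCompact_Icc (a := -(n:ℝ)) (b := n)).exists_bound_of_continuousOn hb.continuousOn
      refine ⟨⟨max C 1, by positivity⟩, fun x hx => LipschitzWith.of_dist_le_mul fun s t => ?_⟩
      have hd : 0 ≤ dist s t := dist_nonneg
      have hs1 : dist s.1 t.1 ≤ dist s t := by rw [Prod.dist_eq]; exact le_max_left _ _
      have hs2 : dist s.2 t.2 ≤ dist s t := by rw [Prod.dist_eq]; exact le_max_right _ _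
      rw [Prod.dist_eq]
      refine max_le ?_ ?_
      · refine hs2.trans (le_mul_of_one_le_left hd (le_max_right _ _))
      · simp only [Real.dist_eq]
        rw [← mul_sub, abs_mul, abs_neg, ← Real.dist_eq]
        refine mul_le_mul ?_ hs1 dist_nonneg (le_trans zero_le_one (le_max_right C 1))
        exact (hC x (abs_le.1 hx)).trans (le_max_left _ _))
    (fun x => (u x, u' x)) (fun x => (w x, w' x)) (-(|x| + 1)) c 0 ⟨by linarith [abs_nonneg x], hc⟩
    (fun y _ => (h1.d1 y).prodMk (h1.d2 y)) (fun y hy => by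
      have := (h2.d1 y).prodMk (h2.d2 y)
      rwa [hbb y hy.2] at this) (by simp [e1, e2])
  have := this (x := x) ⟨by linarith [neg_abs_le x], hx⟩
  exact congrArg Prod.fst this

lemma mono_Iic {f f' : ℝ → ℝ} {a : ℝ} (hf : ∀ x ≤ a, HasDerivAt f (f' x) x)
    (h : ∀ x ≤ a, 0 ≤ f' x) : MonotoneOn f (Iic a) := by
  refine monotoneOn_of_deriv_nonneg (convex_Iic a) (fun x hx => (hf x hx).continuousAt.continuousWithinAt) ?_ ?_
  · intro x hx
    rw [interior_Iic] at hx
    exact (hf x hx.le).differentiableAt.differentiableWithinAt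
  · intro x hx
    rw [interior_Iic] at hx
    rw [(hf x hx.le).deriv]; exact h x hx.le

lemma anti_Iic {f f' : ℝ → ℝ} {a : ℝ} (hf : ∀ x ≤ a, HasDerivAt f (f' x) x)
    (h : ∀ x ≤ a, f' x ≤ 0) : AntitoneOn f (Iic a) := by
  have := mono_Iic (f := fun x => -f x) (f' := fun x => -f' x) (fun x hx => (hf x hx).neg)
    (fun x hx => by simpa using h x hx)
  intro x hx y hy hxy
  simpa using this hx hy hxy

lemma left_sol (b : ℝ → ℝ) (hb : Continuous b) (hlim : Tendsto b atBot atBot) :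
    ∃ u u' : ℝ → ℝ, IsSol b u u' ∧ ¬ (u 0 = 0 ∧ u' 0 = 0) ∧
      IntegrableOn (fun x => (u x)^2) (Iic 0) := by
  obtain ⟨a₁, ha₁⟩ := eventually_atBot.1 (hlim.eventually (eventually_le_atBot (-1 : ℝ)))
  set a := min a₁ 0 with ha
  have hba : ∀ x ≤ a, b x ≤ -1 := fun x hx => ha₁ x (hx.trans (min_le_left _ _))
  obtain ⟨f, f', hf, hfa, hfa'⟩ := lin_ivp b hb a 1 (-1)
  obtain ⟨g, g', hg, hga, hga'⟩ := lin_ivp b hb a 0 1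
  have h1 : ∀ x ≤ a, f x * f' x ≤ -1 := by
    have := mono_Iic (a := a) (f := fun x => f x * f' x) (fun x _ => (hf.d1 x).mul (hf.d2 x)) (by
      intro x hx
      have := hba x hx
      nlinarith [mul_self_nonneg (f' x), mul_self_nonneg (f x), mul_nonneg (mul_self_nonneg (f x)) (by linarith : 0 ≤ - b x)])
    intro x hx
    have := this (a := x) hx (b := a) (le_refl a) hx
    simpa [hfa, hfa'] using this
  have hfc : Continuous f := continuous_iff_continuousAt.2 fun x => (hf.d1 x).continuousAt
  have h2 : ∀ x ≤ a, 0 < f x := by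
    intro x hx
    by_contra hneg
    push Not at hneg
    have := intermediate_value_Icc hx (hfc.continuousOn)
    obtain ⟨z, hz, hz0⟩ := this ⟨hneg, by rw [hfa]; norm_num⟩
    have := h1 z hz.2
    rw [hz0] at this
    norm_num at this
  have h3 : ∀ x ≤ a, f' x ≤ - f x := by
    have := mono_Iic (a := a) (f := fun x => exp (-x) * (f x + f' x))
      (fun x _ => ((hasDerivAt_id x).neg.exp).mul ((hf.d1 x).add (hf.d2 x))) (by
      intro x hx
      have e : exp (-id x) * -1 * (f x + f' x) + exp (-id x) * (f' x + -b x * f x)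
        = exp (-id x) * ((-b x - 1) * f x) := by ring
      show 0 ≤ exp (-id x) * -1 * (f x + f' x) + exp (-id x) * (f' x + -b x * f x)
      rw [e]
      exact mul_nonneg (exp_pos _).le (mul_nonneg (by linarith [hba x hx]) (h2 x hx).le))
    intro x hx
    have := this (a := x) hx (b := a) (le_refl a) hx
    simp only [hfa, hfa', add_neg_cancel, mul_zero] at this
    have := nonpos_of_mul_nonpos_right this (exp_pos _)
    linarith
  have h4 : ∀ x ≤ a, exp (a - x) ≤ f x := by
    have := anti_Iic (a := a) (f := fun x => exp x * f x)
      (fun x _ => (hasDerivAt_exp x).mul (hf.d1 x)) (by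
      intro x hx
      have := h3 x hx
      have := exp_pos x
      nlinarith)
    intro x hx
    have := this (a := x) hx (b := a) (le_refl a) hx
    simp only [hfa, mul_one] at this
    rw [exp_sub, div_le_iff₀ (exp_pos x)]
    linarith
  have hW : ∀ x, f x * g' x - f' x * g x = 1 := by
    intro x
    have hd : ∀ y, HasDerivAt (fun x => f x * g' x - f' x * g x) 0 y := by
      intro y
      refine HasDerivAt.congr_deriv (((hf.d1 y).mul (hg.d2 y)).sub ((hf.d2 y).mul (hg.d1 y))) ?_
      ring
    have := is_const_of_deriv_eq_zero (fun y => (hd y).differentiableAt) (fun y => (hd y).deriv) x a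
    rw [this, hfa, hga', hga]; ring
  have hgd : ∀ x ≤ a, HasDerivAt (fun x => g x / f x) (1 / f x ^ 2) x := by
    intro x hx
    refine HasDerivAt.congr_deriv ((hg.d1 x).div (hf.d1 x) (h2 x hx).ne') ?_
    rw [← hW x]; ring
  have hmon := mono_Iic hgd (fun x hx => by positivity)
  have hanti := anti_Iic (a := a) (f := fun x => g x / f x - 1 / (2 * f x ^ 2))
    (f' := fun x => 1 / f x ^ 2 + f' x / f x ^ 3) (by
      intro x hx
      have hfx := (h2 x hx).ne'
      have h5 := (hgd x hx).sub ((((hf.d1 x).pow 2).const_mul 2).inv (by have := h2 x hx; show 2 * f x ^ 2 ≠ 0; positivity))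
      simp only [one_div] at h5 ⊢
      refine HasDerivAt.congr_deriv (h5) ?_
      field_simp
      simp only [Pi.pow_apply]
      ring) (by
      intro x hx
      have hfx := h2 x hx
      have e : 1 / f x ^ 2 + f' x / f x ^ 3 = (f x + f' x) / f x ^ 3 := by field_simp
      rw [e]
      exact div_nonpos_of_nonpos_of_nonneg (by linarith [h3 x hx]) (by positivity))
  have hbdd : ∀ x ≤ a, ∀ y ≤ a, g x / f x - 1 / (2 * f x ^ 2) ≤ g y / f y := by
    intro x hx y hy
    have p1 : 0 ≤ 1 / (2 * f x ^ 2) := by positivity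
    have p2 : 0 ≤ 1 / (2 * f y ^ 2) := by positivity
    rcases le_total x y with hxy | hxy
    · have := hmon (a := x) hx (b := y) hy hxy
      simp only at this; linarith
    · have := hanti (a := y) hy (b := x) hx hxy
      simp only at this; linarith
  set l := sInf ((fun x => g x / f x) '' Iic a) with hl
  have hl1 : ∀ x ≤ a, l ≤ g x / f x := by
    intro x hx
    refine csInf_le ⟨g a / f a - 1 / (2 * f a ^ 2), ?_⟩ ⟨x, hx, rfl⟩
    rintro _ ⟨y, hy, rfl⟩
    exact hbdd a le_rfl y hy
  have hl2 : ∀ x ≤ a, g x / f x - 1 / (2 * f x ^ 2) ≤ l := by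
    intro x hx
    refine le_csInf ⟨_, x, hx, rfl⟩ ?_
    rintro _ ⟨y, hy, rfl⟩
    exact hbdd x hx y hy
  have hsol := hg.comb hf 1 (-l)
  refine ⟨_, _, hsol, ?_, ?_⟩
  · rintro ⟨e1, e2⟩
    have := hW 0
    have e : f 0 * g' 0 - f' 0 * g 0 = 0 := by linear_combination f 0 * e2 - f' 0 * e1
    rw [e] at this; norm_num at this
  · have hcu : Continuous (fun x => (1 * g x + -l * f x)^2) := by
      have : Continuous g := continuous_iff_continuousAt.2 fun x => (hg.d1 x).continuousAt
      fun_prop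
    have hsplit : Iic (0:ℝ) = Iic a ∪ Icc a 0 := (Iic_union_Icc_eq_Iic (min_le_right _ _)).symm
    rw [hsplit]
    refine IntegrableOn.union ?_ (hcu.continuousOn.integrableOn_compact isCompact_Icc)
    have hexp : IntegrableOn (fun x => exp x * exp (-a)) (Iic a) := (integrableOn_exp_Iic a).mul_const _
    refine Integrable.mono' hexp hcu.aestronglyMeasurable ?_
    rw [ae_restrict_iff' measurableSet_Iic]
    refine Eventually.of_forall fun x hx => ?_
    have hx : x ≤ a := hx
    have hfx := h2 x hx
    rw [Real.norm_eq_abs, abs_of_nonneg (sq_nonneg _)]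
    have e1 : 1 * g x + -l * f x = f x * (g x / f x - l) := by field_simp; ring
    have n0 : 0 ≤ f x * (g x / f x - l) := mul_nonneg hfx.le (by linarith [hl1 x hx])
    have n1 : f x * (g x / f x - l) ≤ f x * (1 / (2 * f x ^ 2)) :=
      mul_le_mul_of_nonneg_left (by linarith [hl2 x hx]) hfx.le
    have n2 : f x * (1 / (2 * f x ^ 2)) = 1 / 2 * (f x)⁻¹ := by field_simp
    have n3 : (f x)⁻¹ ≤ exp (x - a) := by
      rw [inv_le_comm₀ hfx (exp_pos _), ← exp_neg]; simpa using h4 x hx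
    have n4 : exp (x - a) ≤ 1 := by rw [exp_le_one_iff]; linarith
    have n5 : exp x * exp (-a) = exp (x - a) := by rw [← exp_add]; rfl
    rw [e1, n5]
    have hp := exp_pos (x - a)
    nlinarith

def Symb (m : ℝ) (f : ℝ → ℝ) : Prop :=
  ∃ C : ℝ, 0 ≤ C ∧ ∀ᶠ x in atTop, DifferentiableAt ℝ f x ∧ |f x| ≤ C * x ^ m ∧
    |deriv f x| ≤ C * x ^ (m - 1)

lemma Symb.mul {m n : ℝ} {f g : ℝ → ℝ} (hf : Symb m f) (hg : Symb n g) :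
    Symb (m + n) (fun x => f x * g x) := by
  obtain ⟨C, hC, h1⟩ := hf
  obtain ⟨D, hD, h2⟩ := hg
  refine ⟨2 * (C * D), by positivity, ?_⟩
  filter_upwards [h1, h2, eventually_gt_atTop 0] with x h1 h2 hx
  refine ⟨h1.1.mul h2.1, ?_, ?_⟩
  · rw [abs_mul, rpow_add hx]
    have := mul_le_mul h1.2.1 h2.2.1 (abs_nonneg _) (by positivity)
    have h3 : 0 ≤ C * x ^ m * (D * x ^ n) := by positivity
    linarith
  · have hd : deriv (fun x => f x * g x) x = deriv f x * g x + f x * deriv g x :=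
      (h1.1.hasDerivAt.mul h2.1.hasDerivAt).deriv
    rw [hd]
    refine (abs_add_le _ _).trans ?_
    rw [abs_mul, abs_mul]
    have a1 := mul_le_mul h1.2.2 h2.2.1 (abs_nonneg _) (by positivity)
    have a2 := mul_le_mul h1.2.1 h2.2.2 (abs_nonneg _) (by positivity)
    have e1 : C * x ^ (m - 1) * (D * x ^ n) = C * D * x ^ (m + n - 1) := by
      rw [show m + n - 1 = (m - 1) + n by ring, rpow_add hx]; ring
    have e2 : C * x ^ m * (D * x ^ (n - 1)) = C * D * x ^ (m + n - 1) := by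
      rw [show m + n - 1 = m + (n - 1) by ring, rpow_add hx]; ring
    linarith

lemma Symb.add {m : ℝ} {f g : ℝ → ℝ} (hf : Symb m f) (hg : Symb m g) :
    Symb m (fun x => f x + g x) := by
  obtain ⟨C, hC, h1⟩ := hf
  obtain ⟨D, hD, h2⟩ := hg
  refine ⟨C + D, by positivity, ?_⟩
  filter_upwards [h1, h2] with x h1 h2
  refine ⟨h1.1.add h2.1, ?_, ?_⟩
  · refine (abs_add_le _ _).trans ?_
    linarith [h1.2.1, h2.2.1]
  · have hd : deriv (fun x => f x + g x) x = deriv f x + deriv g x :=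
      (h1.1.hasDerivAt.add h2.1.hasDerivAt).deriv
    rw [hd]
    refine (abs_add_le _ _).trans ?_
    linarith [h1.2.2, h2.2.2]

lemma Symb.const_mul {m : ℝ} {f : ℝ → ℝ} (hf : Symb m f) (c : ℝ) :
    Symb m (fun x => c * f x) := by
  obtain ⟨C, hC, h1⟩ := hf
  refine ⟨|c| * C, by positivity, ?_⟩
  filter_upwards [h1] with x h1
  refine ⟨h1.1.const_mul c, ?_, ?_⟩
  · rw [abs_mul, mul_assoc]; exact mul_le_mul_of_nonneg_left h1.2.1 (abs_nonneg _)
  · have hd : deriv (fun x => c * f x) x = c * deriv f x := (h1.1.hasDerivAt.const_mul c).deriv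
    rw [hd, abs_mul, mul_assoc]; exact mul_le_mul_of_nonneg_left h1.2.2 (abs_nonneg _)

lemma Symb.mono {m n : ℝ} {f : ℝ → ℝ} (hf : Symb m f) (h : m ≤ n) : Symb n f := by
  obtain ⟨C, hC, h1⟩ := hf
  refine ⟨C, hC, ?_⟩
  filter_upwards [h1, eventually_ge_atTop 1] with x h1 hx
  refine ⟨h1.1, h1.2.1.trans ?_, h1.2.2.trans ?_⟩
  · exact mul_le_mul_of_nonneg_left (rpow_le_rpow_of_exponent_le hx h) hC
  · exact mul_le_mul_of_nonneg_left (rpow_le_rpow_of_exponent_le hx (by linarith)) hC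

lemma Symb.congr {m : ℝ} {f g : ℝ → ℝ} (hf : Symb m f) (h : f =ᶠ[atTop] g) : Symb m g := by
  obtain ⟨C, hC, h1⟩ := hf
  obtain ⟨X, hX⟩ := eventually_atTop.1 h
  refine ⟨C, hC, ?_⟩
  filter_upwards [h1, eventually_gt_atTop X] with x h1 hx
  have he : f =ᶠ[𝓝 x] g := by
    filter_upwards [Ioi_mem_nhds hx] with y hy
    exact hX y (le_of_lt hy)
  refine ⟨(he.differentiableAt_iff).1 h1.1, ?_, ?_⟩
  · rw [← he.eq_of_nhds]; exact h1.2.1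
  · rw [← he.deriv_eq]; exact h1.2.2

lemma Symb.rpow (m : ℝ) : Symb m (fun x => x ^ m) := by
  refine ⟨1 + |m|, by positivity, ?_⟩
  filter_upwards [eventually_gt_atTop 0] with x hx
  have hd : HasDerivAt (fun x : ℝ => x ^ m) (m * x ^ (m - 1)) x :=
    Real.hasDerivAt_rpow_const (Or.inl hx.ne')
  refine ⟨hd.differentiableAt, ?_, ?_⟩
  · rw [abs_of_pos (rpow_pos_of_pos hx m)]
    have := rpow_pos_of_pos hx m
    nlinarith [abs_nonneg m]
  · rw [hd.deriv, abs_mul, abs_of_pos (rpow_pos_of_pos hx _)]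
    have := rpow_pos_of_pos hx (m-1)
    nlinarith [abs_nonneg m]

noncomputable def pp (α e x : ℝ) : ℝ := √(x ^ α + e)
noncomputable def pd (α e x : ℝ) : ℝ := α * x ^ (α - 1) / (2 * pp α e x)

lemma pp_sq {α e x : ℝ} (h : 0 ≤ x ^ α + e) : pp α e x ^ 2 = x ^ α + e := Real.sq_sqrt h

lemma pp_ge_one {α e x : ℝ} (h : 1 ≤ x ^ α + e) : 1 ≤ pp α e x := Real.one_le_sqrt.2 h

lemma pp_deriv {α e x : ℝ} (hx : 0 < x) (h : 1 ≤ x ^ α + e) :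
    HasDerivAt (pp α e) (pd α e x) x := by
  have hd : HasDerivAt (fun x : ℝ => x ^ α + e) (α * x ^ (α - 1)) x :=
    (Real.hasDerivAt_rpow_const (Or.inl hx.ne')).add_const e
  exact hd.sqrt (by positivity)

lemma pp_fact {α : ℝ} (hα : 0 < α) (e : ℝ) : ∀ᶠ x in atTop, 1 ≤ x ^ α + e ∧
    (pp α e x)⁻¹ ≤ 2 * x ^ (-(α/2)) ∧ pp α e x ≤ 2 * x ^ (α/2) := by
  filter_upwards [(tendsto_rpow_atTop hα).eventually_ge_atTop (2 * |e| + 2), eventually_gt_atTop 0]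
    with x h hx
  have he := neg_abs_le e
  have he2 := le_abs_self e
  have h1 : 1 ≤ x ^ α + e := by linarith [abs_nonneg e]
  have hp := pp_ge_one h1
  have hsq := pp_sq (α := α) (e := e) (x := x) (by linarith)
  have hx2 : (x ^ (α/2)) ^ 2 = x ^ α := by rw [← rpow_natCast, ← rpow_mul hx.le]; congr 1; push_cast; ring
  have hxp := rpow_pos_of_pos hx (α/2)
  refine ⟨h1, ?_, ?_⟩
  · rw [rpow_neg hx.le, inv_le_comm₀ (by linarith) (by positivity), mul_inv, inv_inv]
    refine abs_le_of_sq_le_sq' ?_ (by linarith) |>.2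
    rw [hsq, mul_pow, hx2]
    nlinarith [abs_nonneg e]
  · refine abs_le_of_sq_le_sq' ?_ (by linarith) |>.2
    rw [hsq, mul_pow, hx2]
    nlinarith [abs_nonneg e]

lemma Symb.pinv {α : ℝ} (hα : 0 < α) (e : ℝ) : Symb (-(α/2)) (fun x => (pp α e x)⁻¹) := by
  refine ⟨2 + 4 * α, by positivity, ?_⟩
  filter_upwards [pp_fact hα e, eventually_gt_atTop 0] with x h hx
  have hp := pp_ge_one h.1
  have hd := (pp_deriv hx h.1).inv (by linarith)
  have hxp := rpow_pos_of_pos hx (-(α/2))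
  refine ⟨hd.differentiableAt, ?_, ?_⟩
  · rw [abs_of_pos (by positivity)]
    nlinarith [h.2.1]
  · have hd' : deriv (fun x => (pp α e x)⁻¹) x = -pd α e x / pp α e x ^ 2 := hd.deriv
    have e1 : -pd α e x / pp α e x ^ 2 = -(α / 2 * x ^ (α - 1) * ((pp α e x)⁻¹) ^ 3) := by
      unfold pd; field_simp
    rw [hd', e1, abs_neg, abs_of_nonneg (by positivity)]
    have h3 : ((pp α e x)⁻¹) ^ 3 ≤ (2 * x ^ (-(α/2))) ^ 3 :=
      pow_le_pow_left₀ (by positivity) h.2.1 3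
    have e2 : α / 2 * x ^ (α - 1) * (2 * x ^ (-(α/2))) ^ 3 = 4 * α * x ^ (-(α/2) - 1) := by
      rw [show -(α/2) - 1 = (α - 1) + (-(α/2)) + (-(α/2)) + (-(α/2)) by ring,
        rpow_add hx, rpow_add hx, rpow_add hx]; ring
    have h4 : α / 2 * x ^ (α - 1) * ((pp α e x)⁻¹) ^ 3 ≤ α / 2 * x ^ (α - 1) * (2 * x ^ (-(α/2))) ^ 3 :=
      mul_le_mul_of_nonneg_left h3 (by positivity)
    have := rpow_pos_of_pos hx (-(α/2) - 1)
    nlinarith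

lemma Symb.pp {α : ℝ} (hα : 0 < α) (e : ℝ) : Symb (α/2) (pp α e) := by
  have h1 : Symb α (fun x => x ^ α + e * x ^ (0:ℝ)) :=
    (Symb.rpow α).add (((Symb.rpow 0).const_mul e).mono hα.le)
  have h2 := (h1.mul (Symb.pinv hα e)).mono (n := α/2) (by linarith)
  refine h2.congr ?_
  filter_upwards [pp_fact hα e] with x h
  have hp := pp_ge_one h.1
  have hs := pp_sq (α := α) (e := e) (x := x) (by linarith [h.1])
  rw [rpow_zero, mul_one, ← hs]
  field_simp

/-- error bound for the phase speed -/
noncomputable def ebar (α e x : ℝ) : ℝ :=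
  32 * x ^ (-((1 - α/2)/2)) * (pp α e x)⁻¹ + pd α e x * (pp α e x)⁻¹

lemma ebar_nonneg {α : ℝ} (hα : 0 < α) {e x : ℝ} (hx : 0 < x) : 0 ≤ ebar α e x := by
  unfold ebar pd pp; positivity

lemma ebar_bound {α : ℝ} (hα : 0 < α) (hα2 : α < 2) (e : ℝ) :
    ∃ C, 0 ≤ C ∧ ∀ᶠ x in atTop, ebar α e x ≤ C * x ^ ((1 - α/2)/2 - 1) := by
  refine ⟨64 + 2 * α, by positivity, ?_⟩
  filter_upwards [pp_fact hα e, eventually_ge_atTop 1] with x h hx1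
  have hx : 0 < x := by linarith
  have hp := pp_ge_one h.1
  unfold ebar
  have e0 : pd α e x * (pp α e x)⁻¹ = α / 2 * x ^ (α - 1) * ((pp α e x)⁻¹) ^ 2 := by
    unfold pd; field_simp
  have h3 : ((pp α e x)⁻¹) ^ 2 ≤ (2 * x ^ (-(α/2))) ^ 2 :=
      pow_le_pow_left₀ (by positivity) h.2.1 2
  have e2 : α / 2 * x ^ (α - 1) * (2 * x ^ (-(α/2))) ^ 2 = 2 * α * x ^ (-1 : ℝ) := by
      rw [show (-1 : ℝ) = (α - 1) + (-(α/2)) + (-(α/2)) by ring,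
        rpow_add hx, rpow_add hx]; ring
  have h4 : α / 2 * x ^ (α - 1) * ((pp α e x)⁻¹) ^ 2 ≤ α / 2 * x ^ (α - 1) * (2 * x ^ (-(α/2))) ^ 2 :=
      mul_le_mul_of_nonneg_left h3 (by positivity)
  have h5 : x ^ (-1 : ℝ) ≤ x ^ ((1 - α/2)/2 - 1) := rpow_le_rpow_of_exponent_le hx1 (by linarith)
  have e6 : 32 * x ^ (-((1 - α/2)/2)) * (2 * x ^ (-(α/2))) = 64 * x ^ ((1 - α/2)/2 - 1) := by
    rw [show ((1 - α/2)/2 - 1) = -((1 - α/2)/2) + (-(α/2)) by ring, rpow_add hx]; ring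
  have h7 : 32 * x ^ (-((1 - α/2)/2)) * (pp α e x)⁻¹ ≤ 32 * x ^ (-((1 - α/2)/2)) * (2 * x ^ (-(α/2))) :=
    mul_le_mul_of_nonneg_left h.2.1 (by positivity)
  rw [e0]
  nlinarith

/-- smallness package -/
structure Gd (F : ℝ → ℝ) (B η eb x : ℝ) : Prop where
  diff : DifferentiableAt ℝ F x
  small : |F x| ≤ η
  smallB : B * |F x| ≤ η
  dsmall : |deriv F x| ≤ η / x
  esmall : |F x| * eb ≤ η / x

lemma Gd_of_Symb {α : ℝ} (hα2 : α < 2) {F : ℝ → ℝ} (hF : Symb (-(1 - α/2)) F)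
    (B η : ℝ) (hB : 0 ≤ B) (hη : 0 < η) (eb : ℝ → ℝ)
    (heb : ∃ C, 0 ≤ C ∧ ∀ᶠ x in atTop, eb x ≤ C * x ^ ((1 - α/2)/2 - 1)) :
    ∀ᶠ x in atTop, Gd F B η (eb x) x := by
  obtain ⟨C, hC, h1⟩ := hF
  obtain ⟨D, hD, h2⟩ := heb
  set δ := (1 - α/2)/2 with hδ
  have hδ0 : 0 < δ := by rw [hδ]; linarith
  have hβ : -(1 - α/2) = -(2*δ) := by rw [hδ]; ring
  rw [hβ] at h1
  have t1 : Tendsto (fun x : ℝ => x ^ (-δ)) atTop (𝓝 0) := tendsto_rpow_neg_atTop hδ0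
  have hM : 0 < η / (1 + C * (1 + B + D)) := by positivity
  filter_upwards [h1, h2, eventually_ge_atTop 1, t1.eventually_le_const hM] with x h1 h2 hx1 ht
  have hx : 0 < x := by linarith
  have hxd := rpow_pos_of_pos hx (-δ)
  have k1 : x ^ (-(2*δ)) ≤ x ^ (-δ) := rpow_le_rpow_of_exponent_le hx1 (by linarith)
  have k0 : (C * (1 + B + D)) * x ^ (-δ) ≤ η := by
    rw [le_div_iff₀ (by positivity)] at ht
    nlinarith
  have kC : C * x ^ (-δ) ≤ η := le_trans (by nlinarith [mul_nonneg (mul_nonneg hC hB) hxd.le, mul_nonneg (mul_nonneg hC hD) hxd.le]) k0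
  have f1 : |F x| ≤ C * x ^ (-δ) := h1.2.1.trans (mul_le_mul_of_nonneg_left k1 hC)
  refine ⟨h1.1, f1.trans kC, ?_, ?_, ?_⟩
  · refine (mul_le_mul_of_nonneg_left f1 hB).trans (le_trans ?_ k0)
    nlinarith [mul_nonneg hC hxd.le, mul_nonneg (mul_nonneg hC hD) hxd.le]
  · refine h1.2.2.trans ?_
    rw [rpow_sub_one hx.ne', ← mul_div_assoc]
    exact div_le_div_of_nonneg_right ((mul_le_mul_of_nonneg_left k1 hC).trans kC) hx.le
  · have := mul_le_mul_of_nonneg_left h2 (abs_nonneg (F x))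
    refine this.trans ?_
    have := mul_le_mul_of_nonneg_right h1.2.1 (by positivity : 0 ≤ D * x ^ (δ - 1))
    refine this.trans ?_
    have e : C * x ^ (-(2*δ)) * (D * x ^ (δ - 1)) = (C * D * x ^ (-δ)) / x := by
      rw [rpow_sub_one hx.ne', show -(δ) = -(2*δ) + δ by ring, rpow_add hx]; ring
    rw [e]
    refine div_le_div_of_nonneg_right (le_trans ?_ k0) hx.le
    nlinarith [mul_nonneg hC hxd.le, mul_nonneg (mul_nonneg hC hB) hxd.le]

noncomputable def F1 (α e : ℝ) (x : ℝ) : ℝ := pd α e x * ((pp α e x)⁻¹) ^ 2 / 2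
noncomputable def F2 (α e : ℝ) (x : ℝ) : ℝ := 2 * x ^ (α/2 - 1) * ((pp α e x)⁻¹) ^ 2
noncomputable def F3 (α e e' : ℝ) (x : ℝ) : ℝ :=
  4 * x ^ (α/2 - 1) * (pp α e x)⁻¹ * (pp α e x + pp α e' x) / (e - e')
noncomputable def F4 (α e e' : ℝ) (x : ℝ) : ℝ :=
  4 * x ^ (α/2 - 1) * (pp α e x)⁻¹ * (pp α e x - pp α e' x) / (e - e')

lemma F1_symb {α : ℝ} (hα : 0 < α) (e : ℝ) : Symb (-(1 - α/2)) (F1 α e) := by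
  have h := ((Symb.rpow (α - 1)).mul ((Symb.pinv hα e).mul ((Symb.pinv hα e).mul (Symb.pinv hα e)))).const_mul (α/4)
  refine (h.mono (by linarith)).congr (Eventually.of_forall fun x => ?_)
  simp only [F1, pd, div_eq_mul_inv, mul_inv]; ring

lemma F2_symb {α : ℝ} (hα : 0 < α) (e : ℝ) : Symb (-(1 - α/2)) (F2 α e) := by
  have h := ((Symb.rpow (α/2 - 1)).mul ((Symb.pinv hα e).mul (Symb.pinv hα e))).const_mul 2
  refine (h.mono (by linarith)).congr (Eventually.of_forall fun x => ?_)
  simp only [F2]; ring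

lemma F3_symb {α : ℝ} (hα : 0 < α) (e e' : ℝ) : Symb (-(1 - α/2)) (F3 α e e') := by
  have h := ((Symb.rpow (α/2 - 1)).mul ((Symb.pinv hα e).mul ((Symb.pp hα e).add (Symb.pp hα e')))).const_mul (4/(e-e'))
  refine (h.mono (by linarith)).congr (Eventually.of_forall fun x => ?_)
  simp only [F3]; ring

lemma F4_symb {α : ℝ} (hα : 0 < α) (e e' : ℝ) : Symb (-(1 - α/2)) (F4 α e e') := by
  have h := ((Symb.rpow (α/2 - 1)).mul ((Symb.pinv hα e).mul ((Symb.pp hα e).add ((Symb.pp hα e').const_mul (-1))))).const_mul (4/(e-e'))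
  refine (h.mono (by linarith)).congr (Eventually.of_forall fun x => ?_)
  simp only [F4]; ring

structure Good (α B η e e' x : ℝ) : Prop where
  one : 1 ≤ x ^ α + e
  up : pp α e x ≤ 2 * x ^ (α/2)
  g1 : Gd (F1 α e) B η (2 * ebar α e x + 2 * ebar α e' x) x
  g2 : Gd (F2 α e) B η (2 * ebar α e x + 2 * ebar α e' x) x
  g3 : Gd (F3 α e e') B η (2 * ebar α e x + 2 * ebar α e' x) x
  g4 : Gd (F4 α e e') B η (2 * ebar α e x + 2 * ebar α e' x) x

lemma good_eventually {α : ℝ} (hα : 0 < α) (hα2 : α < 2) (B η : ℝ) (hB : 0 ≤ B) (hη : 0 < η)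
    (e e' : ℝ) : ∀ᶠ x in atTop, Good α B η e e' x := by
  have heb : ∃ C, 0 ≤ C ∧ ∀ᶠ x in atTop, (2 * ebar α e x + 2 * ebar α e' x) ≤ C * x ^ ((1 - α/2)/2 - 1) := by
    obtain ⟨C, hC, h1⟩ := ebar_bound hα hα2 e
    obtain ⟨D, hD, h2⟩ := ebar_bound hα hα2 e'
    refine ⟨2 * C + 2 * D, by positivity, ?_⟩
    filter_upwards [h1, h2] with x h1 h2
    linarith
  filter_upwards [pp_fact hα e, Gd_of_Symb hα2 (F1_symb hα e) B η hB hη _ heb,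
    Gd_of_Symb hα2 (F2_symb hα e) B η hB hη _ heb, Gd_of_Symb hα2 (F3_symb hα e e') B η hB hη _ heb,
    Gd_of_Symb hα2 (F4_symb hα e e') B η hB hη _ heb] with x h1 h2 h3 h4 h5
  exact ⟨h1.1, h1.2.2, h2, h3, h4, h5⟩

noncomputable def DD (p t : ℝ) : ℝ := p ^ 2 * cos t ^ 2 + sin t ^ 2
noncomputable def SS (p t : ℝ) : ℝ := 2 * p * cos t * sin t / DD p t
noncomputable def KK (p t : ℝ) : ℝ := (p ^ 2 * cos t ^ 2 - sin t ^ 2) / DD p t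

lemma DD_pos {p : ℝ} (hp : 1 ≤ p) (t : ℝ) : 1 ≤ DD p t := by
  unfold DD
  have := sin_sq_add_cos_sq t
  nlinarith [mul_nonneg (by nlinarith : 0 ≤ p ^ 2 - 1) (sq_nonneg (cos t))]

lemma SK_sq {p : ℝ} (hp : 1 ≤ p) (t : ℝ) : KK p t ^ 2 + SS p t ^ 2 = 1 := by
  have h := DD_pos hp t
  have h0 : DD p t ≠ 0 := by linarith
  unfold KK SS
  rw [div_pow, div_pow, ← add_div, div_eq_one_iff_eq (by positivity)]
  unfold DD; ring

lemma DD_deriv {p θ : ℝ → ℝ} {x p' τ : ℝ} (hp : HasDerivAt p p' x) (hθ : HasDerivAt θ τ x) :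
    HasDerivAt (fun x => DD (p x) (θ x))
      (2 * p x * p' * cos (θ x) ^ 2 + (1 - p x ^ 2) * (2 * sin (θ x) * cos (θ x)) * τ) x := by
  refine HasDerivAt.congr_deriv (((hp.pow 2).mul (hθ.cos.pow 2)).add (hθ.sin.pow 2)) ?_
  simp only [Pi.pow_apply]; ring

noncomputable def nu (p p' q t : ℝ) : ℝ := 2 * p - q / p * (1 + KK p t) - p' / p * SS p t

lemma S_deriv {p θ : ℝ → ℝ} {x p' q : ℝ} (hp1 : 1 ≤ p x) (hp : HasDerivAt p p' x)
    (hθ : HasDerivAt θ (pv (p x ^ 2 - q) (θ x)) x) :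
    HasDerivAt (fun x => SS (p x) (θ x)) (nu (p x) p' q (θ x) * KK (p x) (θ x)) x := by
  have hD := DD_pos hp1 (θ x)
  have hD0 : DD (p x) (θ x) ≠ 0 := by linarith
  have hp0 : p x ≠ 0 := by linarith
  have h1 := (((hp.const_mul 2).mul hθ.cos).mul hθ.sin).div (DD_deriv hp hθ) hD0
  refine HasDerivAt.congr_deriv h1 ?_
  have hcs := sin_sq_add_cos_sq (θ x)
  have hτ : pv (p x ^ 2 - q) (θ x) = DD (p x) (θ x) - q * cos (θ x) ^ 2 := by unfold pv DD; ring
  rw [hτ]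
  have e : nu (p x) p' q (θ x) * KK (p x) (θ x) =
      (sin (θ x) ^ 2 + cos (θ x) ^ 2) * KK (p x) (θ x) * (2 * p x - q / p x * (1 + KK (p x) (θ x)))
        - KK (p x) (θ x) * (p' / p x * SS (p x) (θ x)) := by rw [hcs]; unfold nu; ring
  rw [e]
  simp only [Pi.mul_apply]
  unfold KK SS
  generalize hs : sin (θ x) = s at *
  generalize hc : cos (θ x) = c at *
  have hDe : DD (p x) (θ x) = p x ^ 2 * c ^ 2 + s ^ 2 := by unfold DD; rw [hs, hc]
  clear hτ e h1 hcs hD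
  generalize DD (p x) (θ x) = D at *
  generalize p x = P at *
  field_simp
  rw [hDe]
  ring

lemma K_deriv {p θ : ℝ → ℝ} {x p' q : ℝ} (hp1 : 1 ≤ p x) (hp : HasDerivAt p p' x)
    (hθ : HasDerivAt θ (pv (p x ^ 2 - q) (θ x)) x) :
    HasDerivAt (fun x => KK (p x) (θ x)) (-(nu (p x) p' q (θ x) * SS (p x) (θ x))) x := by
  have hD := DD_pos hp1 (θ x)
  have hD0 : DD (p x) (θ x) ≠ 0 := by linarith
  have hp0 : p x ≠ 0 := by linarith
  have h1 := (((hp.pow 2).mul (hθ.cos.pow 2)).sub (hθ.sin.pow 2)).div (DD_deriv hp hθ) hD0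
  refine HasDerivAt.congr_deriv h1 ?_
  have hcs := sin_sq_add_cos_sq (θ x)
  have hτ : pv (p x ^ 2 - q) (θ x) = DD (p x) (θ x) - q * cos (θ x) ^ 2 := by unfold pv DD; ring
  rw [hτ]
  have e : nu (p x) p' q (θ x) * SS (p x) (θ x) =
      (sin (θ x) ^ 2 + cos (θ x) ^ 2) * SS (p x) (θ x) * (2 * p x - q / p x * (1 + KK (p x) (θ x)))
        - SS (p x) (θ x) * (p' / p x * SS (p x) (θ x)) := by rw [hcs]; unfold nu; ring
  rw [e]
  simp only [Pi.mul_apply, Pi.pow_apply, Pi.sub_apply]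
  unfold KK SS
  generalize hs : sin (θ x) = s at *
  generalize hc : cos (θ x) = c at *
  have hDe : DD (p x) (θ x) = p x ^ 2 * c ^ 2 + s ^ 2 := by unfold DD; rw [hs, hc]
  clear hτ e h1 hcs hD
  generalize DD (p x) (θ x) = D at *
  generalize p x = P at *
  field_simp
  rw [hDe]
  ring

/-- log of the modified amplitude -/
lemma ell_deriv {p θ ρ : ℝ → ℝ} {x p' q : ℝ} (hp1 : 1 ≤ p x) (hp : HasDerivAt p p' x)
    (hθ : HasDerivAt θ (pv (p x ^ 2 - q) (θ x)) x)
    (hρ : HasDerivAt ρ ((p x ^ 2 - q - 1) * (sin (θ x) * cos (θ x))) x) :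
    HasDerivAt (fun x => 2 * ρ x + (log (DD (p x) (θ x)) - log (p x)))
      (p' / p x * KK (p x) (θ x) - q / p x * SS (p x) (θ x)) x := by
  have hD := DD_pos hp1 (θ x)
  have hD0 : DD (p x) (θ x) ≠ 0 := by linarith
  have hp0 : p x ≠ 0 := by linarith
  have h1 := (hρ.const_mul 2).add (((DD_deriv hp hθ).log hD0).sub (hp.log hp0))
  refine HasDerivAt.congr_deriv h1 ?_
  have hcs := sin_sq_add_cos_sq (θ x)
  have hτ : pv (p x ^ 2 - q) (θ x) = DD (p x) (θ x) - q * cos (θ x) ^ 2 := by unfold pv DD; ring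
  rw [hτ]
  have e : q / p x * SS (p x) (θ x) = (sin (θ x) ^ 2 + cos (θ x) ^ 2) * (q / p x * SS (p x) (θ x)) := by
    rw [hcs]; ring
  rw [e]
  unfold KK SS
  generalize hs : sin (θ x) = s at *
  generalize hc : cos (θ x) = c at *
  have hDe : DD (p x) (θ x) = p x ^ 2 * c ^ 2 + s ^ 2 := by unfold DD; rw [hs, hc]
  clear hτ e h1 hcs hD
  generalize DD (p x) (θ x) = D at *
  generalize p x = P at *
  field_simp
  rw [hDe]
  ring

lemma osc {c F Sn Cs : ℝ → ℝ} {c' μ Ω B η eb x : ℝ} (hx : 0 < x) (hc : HasDerivAt c c' x)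
    (hc1 : |c x| ≤ 1) (hc2 : |c'| ≤ B / x) (hF : Gd F B η eb x)
    (hS : HasDerivAt Sn (μ * Cs x) x) (hS1 : |Sn x| ≤ 1) (hC1 : |Cs x| ≤ 1) (hμ : |μ - Ω| ≤ eb) :
    (∃ err, |err| ≤ 3 * η / x ∧
      HasDerivAt (fun y => c y * F y * Sn y) (c x * F x * Ω * Cs x + err) x) ∧
      |c x * F x * Sn x| ≤ η := by
  refine ⟨⟨c' * F x * Sn x + c x * deriv F x * Sn x + c x * F x * (μ - Ω) * Cs x, ?_, ?_⟩, ?_⟩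
  · have a1 : |c' * F x * Sn x| ≤ η / x := by
      rw [abs_mul, abs_mul]
      calc |c'| * |F x| * |Sn x| ≤ (B / x * |F x|) * 1 :=
            mul_le_mul (mul_le_mul_of_nonneg_right hc2 (abs_nonneg _)) hS1 (abs_nonneg _)
              (mul_nonneg ((abs_nonneg _).trans hc2) (abs_nonneg _))
        _ = (B * |F x|) / x := by ring
        _ ≤ η / x := div_le_div_of_nonneg_right hF.smallB hx.le
    have a2 : |c x * deriv F x * Sn x| ≤ η / x := by
      rw [abs_mul, abs_mul]
      calc |c x| * |deriv F x| * |Sn x| ≤ (1 * |deriv F x|) * 1 :=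
            mul_le_mul (mul_le_mul_of_nonneg_right hc1 (abs_nonneg _)) hS1 (abs_nonneg _) (by positivity)
        _ ≤ η / x := by simpa using hF.dsmall
    have a3 : |c x * F x * (μ - Ω) * Cs x| ≤ η / x := by
      rw [abs_mul, abs_mul, abs_mul]
      calc |c x| * |F x| * |μ - Ω| * |Cs x| ≤ (1 * |F x|) * eb * 1 :=
            mul_le_mul (mul_le_mul (mul_le_mul_of_nonneg_right hc1 (abs_nonneg _)) hμ
              (abs_nonneg _) (by positivity)) hC1 (abs_nonneg _)
              (mul_nonneg (by positivity) ((abs_nonneg _).trans hμ))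
        _ ≤ η / x := by simpa using hF.esmall
    have := abs_add_le (c' * F x * Sn x + c x * deriv F x * Sn x) (c x * F x * (μ - Ω) * Cs x)
    have := abs_add_le (c' * F x * Sn x) (c x * deriv F x * Sn x)
    have e : 3 * η / x = η / x + η / x + η / x := by ring
    rw [e]; linarith
  · refine HasDerivAt.congr_deriv ((hc.mul hF.diff.hasDerivAt).mul hS) ?_
    simp only [Pi.mul_apply]; ring
  · rw [abs_mul, abs_mul]
    calc |c x| * |F x| * |Sn x| ≤ (1 * |F x|) * 1 :=
            mul_le_mul (mul_le_mul_of_nonneg_right hc1 (abs_nonneg _)) hS1 (abs_nonneg _) (by positivity)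
      _ ≤ η := by simpa using hF.small

lemma abs_le_one_of_sq {a b : ℝ} (h : a ^ 2 + b ^ 2 = 1) : |a| ≤ 1 ∧ |b| ≤ 1 := by
  constructor <;> rw [abs_le] <;> constructor <;> nlinarith [sq_nonneg a, sq_nonneg b]

lemma nu_err {α e x q t : ℝ} (hα : 0 < α) (hx : 0 < x) (h1 : 1 ≤ x ^ α + e)
    (hq : |q| ≤ 16 * x ^ (-((1 - α/2)/2))) :
    |nu (pp α e x) (pd α e x) q t - 2 * pp α e x| ≤ ebar α e x := by
  have hp := pp_ge_one h1
  have hsk := abs_le_one_of_sq (SK_sq hp t)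
  unfold nu ebar
  have hpd : 0 ≤ pd α e x := by unfold pd; positivity
  have e1 : 2 * pp α e x - q / pp α e x * (1 + KK (pp α e x) t) - pd α e x / pp α e x * SS (pp α e x) t
      - 2 * pp α e x = -(q * (pp α e x)⁻¹ * (1 + KK (pp α e x) t) + pd α e x * (pp α e x)⁻¹ * SS (pp α e x) t) := by
    ring
  rw [e1, abs_neg]
  have hi : 0 ≤ (pp α e x)⁻¹ := by positivity
  refine (abs_add_le _ _).trans (add_le_add ?_ ?_)
  · rw [abs_mul, abs_mul, abs_of_nonneg hi]
    have k2 : |1 + KK (pp α e x) t| ≤ 2 := by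
      refine (abs_add_le _ _).trans ?_
      rw [abs_one]; linarith [hsk.1]
    calc |q| * (pp α e x)⁻¹ * |1 + KK (pp α e x) t|
        ≤ (16 * x ^ (-((1 - α/2)/2))) * (pp α e x)⁻¹ * 2 :=
          mul_le_mul (mul_le_mul_of_nonneg_right hq hi) k2 (abs_nonneg _) (by positivity)
      _ = _ := by ring
  · rw [abs_mul, abs_of_nonneg (mul_nonneg hpd hi)]
    exact mul_le_of_le_one_right (mul_nonneg hpd hi) hsk.2

noncomputable def cc (X x : ℝ) : ℝ := Real.smoothTransition (x / X - 1)

lemma cc_zero {X x : ℝ} (hX : 1 ≤ X) (h : x ≤ X) : cc X x = 0 := by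
  apply Real.smoothTransition.zero_of_nonpos
  have : x / X ≤ 1 := by rw [div_le_one (by linarith)]; exact h
  linarith

lemma cc_one {X x : ℝ} (hX : 1 ≤ X) (h : 2 * X ≤ x) : cc X x = 1 := by
  apply Real.smoothTransition.one_of_one_le
  have : 2 ≤ x / X := by rw [le_div_iff₀ (by linarith)]; exact h
  linarith

lemma cc_nonneg (X x : ℝ) : 0 ≤ cc X x := Real.smoothTransition.nonneg _
lemma cc_le_one (X x : ℝ) : cc X x ≤ 1 := Real.smoothTransition.le_one _
lemma cc_abs (X x : ℝ) : |cc X x| ≤ 1 := by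
  rw [abs_of_nonneg (cc_nonneg X x)]; exact cc_le_one X x

lemma cc_contDiff (X : ℝ) (n : ℕ∞) : ContDiff ℝ n (cc X) := by
  unfold cc
  exact (Real.smoothTransition.contDiff (n := n)).comp ((contDiff_id.div_const X).sub contDiff_const)

lemma cc_deriv : ∃ B : ℝ, 0 ≤ B ∧ ∀ X : ℝ, 1 ≤ X → ∀ x : ℝ, 0 < x →
    ∃ c', HasDerivAt (cc X) c' x ∧ |c'| ≤ B / x ∧ (x ≤ X → c' = 0) := by
  have hcd : ContDiff ℝ 1 Real.smoothTransition := Real.smoothTransition.contDiff (n := 1)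
  have hc : Continuous (deriv Real.smoothTransition) := hcd.continuous_deriv le_rfl
  obtain ⟨C, hC⟩ := (isCompact_Icc (a := (0:ℝ)) (b := 1)).exists_bound_of_continuousOn hc.continuousOn
  have hC0 : 0 ≤ C := (norm_nonneg _).trans (hC 0 (by simp))
  have z1 : ∀ y : ℝ, y ≤ 0 → deriv Real.smoothTransition y = 0 := by
    intro y hy
    apply IsLocalMin.deriv_eq_zero
    refine Eventually.of_forall fun z => ?_
    rw [Real.smoothTransition.zero_of_nonpos hy]
    exact Real.smoothTransition.nonneg z
  have z2 : ∀ y : ℝ, 1 ≤ y → deriv Real.smoothTransition y = 0 := by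
    intro y hy
    apply IsLocalMax.deriv_eq_zero
    refine Eventually.of_forall fun z => ?_
    rw [Real.smoothTransition.one_of_one_le hy]
    exact Real.smoothTransition.le_one z
  refine ⟨2 * C, by positivity, fun X hX x hx => ⟨deriv Real.smoothTransition (x / X - 1) * (1 / X), ?_, ?_, ?_⟩⟩
  · have h1 : HasDerivAt (fun x : ℝ => x / X - 1) (1 / X) x := ((hasDerivAt_id x).div_const X).sub_const 1
    have h2 := ((hcd.differentiable (by norm_num)) (x / X - 1)).hasDerivAt
    exact h2.comp x h1
  · rcases le_total (x / X - 1) 0 with h | h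
    · rw [z1 _ h]; simp; positivity
    rcases le_total 1 (x / X - 1) with h' | h'
    · rw [z2 _ h']; simp; positivity
    rw [abs_mul]
    have hX0 : 0 < X := by linarith
    have k : 1 / X ≤ 2 / x := by
      rw [div_le_div_iff₀ hX0 hx]
      have : x / X ≤ 2 := by linarith
      rw [div_le_iff₀ hX0] at this
      linarith
    calc _ ≤ C * (2 / x) := by
          refine mul_le_mul (hC _ ⟨h, h'⟩) ?_ (abs_nonneg _) hC0
          rwa [abs_of_nonneg (by positivity)]
      _ = _ := by ring
  · intro h
    rw [z1, zero_mul]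
    have : x / X ≤ 1 := by rw [div_le_one (by linarith)]; exact h
    linarith

noncomputable def QQ (α e X x t : ℝ) : ℝ := 16 * cc X x * x ^ (α/2 - 1) * SS (pp α e x) t

lemma QQ_zero {α e X x t : ℝ} (hX : 1 ≤ X) (h : x ≤ X) : QQ α e X x t = 0 := by
  unfold QQ; rw [cc_zero hX h]; ring

lemma SS_abs {p t : ℝ} (hp : 1 ≤ p) : |SS p t| ≤ 1 := (abs_le_one_of_sq (SK_sq hp t)).2
lemma KK_abs {p t : ℝ} (hp : 1 ≤ p) : |KK p t| ≤ 1 := (abs_le_one_of_sq (SK_sq hp t)).1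

lemma SS_lip {p : ℝ} (hp : 1 ≤ p) (s t : ℝ) : |SS p s - SS p t| ≤ 4 * p * |s - t| := by
  have hd : ∀ y : ℝ, HasDerivAt (fun t => SS p t) (nu p 0 (p^2-1) y * KK p y) y := by
    intro y
    have := S_deriv (p := fun _ => p) (θ := fun t => t) (x := y) (p' := 0) (q := p^2-1) hp
      (hasDerivAt_const _ _) (by
        refine HasDerivAt.congr_deriv (hasDerivAt_id y) ?_
        unfold pv
        have := sin_sq_add_cos_sq y
        linear_combination -this)
    exact this
  have := Convex.norm_image_sub_le_of_norm_hasDerivWithin_le (f := fun t => SS p t) (s := univ) (C := 4 * p)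
    (x := t) (y := s) (fun y _ => (hd y).hasDerivWithinAt) (fun y _ => ?_) convex_univ (mem_univ _) (mem_univ _)
  · simpa using this
  · rw [Real.norm_eq_abs, abs_mul]
    have hk := KK_abs (t := y) hp
    have : |nu p 0 (p^2-1) y| ≤ 4 * p := by
      unfold nu
      have hk' := abs_le.1 hk
      have h1 : (p^2-1)/p ≤ p := by rw [div_le_iff₀ (by linarith)]; nlinarith
      have h2 : 0 ≤ (p^2-1)/p := div_nonneg (by nlinarith) (by linarith)
      have h3 : (p^2-1)/p * (1 + KK p y) ≤ p * 2 := mul_le_mul h1 (by linarith) (by linarith) (by linarith)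
      have h4 : 0 ≤ (p^2-1)/p * (1 + KK p y) := mul_nonneg h2 (by linarith)
      rw [abs_le]
      constructor <;> simp <;> linarith
    calc _ ≤ 4 * p * 1 := mul_le_mul this hk (abs_nonneg _) (by linarith)
      _ = _ := by ring

lemma pp_contDiffAt {α e x : ℝ} (hx : 0 < x) (h : 1 ≤ x ^ α + e) (n : ℕ∞) : ContDiffAt ℝ n (pp α e) x := by
  unfold pp
  exact ((contDiffAt_id.rpow_const_of_ne hx.ne').add contDiffAt_const).sqrt (by
    simp only [id]; linarith)

lemma QQ_contDiffAt {α e X : ℝ} (hX : 1 ≤ X) (h : ∀ x, X ≤ x → 1 ≤ x ^ α + e) (n : ℕ∞) (z : ℝ × ℝ) :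
    ContDiffAt ℝ n (fun z : ℝ × ℝ => QQ α e X z.1 z.2) z := by
  rcases lt_or_ge z.1 X with hz | hz
  · have : (fun z : ℝ × ℝ => QQ α e X z.1 z.2) =ᶠ[𝓝 z] fun _ => 0 := by
      have : ∀ᶠ y : ℝ × ℝ in 𝓝 z, y.1 < X := continuous_fst.continuousAt.eventually (eventually_lt_nhds hz)
      filter_upwards [this] with y hy
      exact QQ_zero hX hy.le
    exact contDiffAt_const.congr_of_eventuallyEq this
  · have hz0 : 0 < z.1 := by linarith
    have hp := pp_ge_one (h _ hz)
    have hD := DD_pos hp z.2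
    have c1 : ContDiffAt ℝ n (fun z : ℝ × ℝ => pp α e z.1) z :=
      (pp_contDiffAt hz0 (h _ hz) n).comp z contDiffAt_fst
    have c2 : ContDiffAt ℝ n (fun z : ℝ × ℝ => cos z.2) z :=
      (Real.contDiff_cos (n := n)).contDiffAt.comp z contDiffAt_snd
    have c3 : ContDiffAt ℝ n (fun z : ℝ × ℝ => sin z.2) z :=
      (Real.contDiff_sin (n := n)).contDiffAt.comp z contDiffAt_snd
    have c4 : ContDiffAt ℝ n (fun z : ℝ × ℝ => cc X z.1) z :=
      (cc_contDiff X n).contDiffAt.comp z contDiffAt_fst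
    have c5 : ContDiffAt ℝ n (fun z : ℝ × ℝ => z.1 ^ (α/2 - 1)) z :=
      contDiffAt_fst.rpow_const_of_ne hz0.ne'
    unfold QQ SS DD
    refine ((contDiffAt_const.mul c4).mul c5).mul ?_
    refine (((contDiffAt_const.mul c1).mul c2).mul c3).div (((c1.pow 2).mul (c2.pow 2)).add (c3.pow 2)) ?_
    unfold DD at hD
    linarith

lemma QQ_bound {α e X : ℝ} (hα2 : α < 2) (hX : 1 ≤ X) (h : ∀ x, X ≤ x → 1 ≤ x ^ α + e) (x t : ℝ) :
    |QQ α e X x t| ≤ 16 * cc X x * |x ^ (α/2 - 1)| := by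
  rcases lt_or_ge x X with hx | hx
  · rw [QQ_zero hX hx.le, cc_zero hX hx.le]; simp
  · unfold QQ
    have := SS_abs (t := t) (pp_ge_one (h x hx))
    rw [abs_mul, abs_mul, abs_mul, abs_of_nonneg (cc_nonneg X x)]
    have h0 := cc_nonneg X x
    rw [abs_of_nonneg (by norm_num : (0:ℝ) ≤ 16)]
    exact mul_le_of_le_one_right (by positivity) this

lemma QQ_lip {α e X : ℝ} (hα : 0 < α) (hα2 : α < 2) (hX : 1 ≤ X) (h : ∀ x, X ≤ x → 1 ≤ x ^ α + e) (n : ℕ) :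
    ∃ L : ℝ≥0, ∀ x : ℝ, |x| ≤ n → ∀ s t, |QQ α e X x t| ≤ L ∧ |QQ α e X x s - QQ α e X x t| ≤ L * |s - t| := by
  refine ⟨⟨64 * √((n:ℝ) ^ α + |e|) + 16, by positivity⟩, fun x hx s t => ?_⟩
  change |QQ α e X x t| ≤ 64 * √((n:ℝ) ^ α + |e|) + 16 ∧ |QQ α e X x s - QQ α e X x t| ≤ (64 * √((n:ℝ) ^ α + |e|) + 16) * |s - t|
  have hs : 0 ≤ √((n:ℝ) ^ α + |e|) := by positivity
  rcases lt_or_ge x X with hxX | hxX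
  · rw [QQ_zero hX hxX.le, QQ_zero hX hxX.le]
    simp; constructor <;> positivity
  · have hx1 : 1 ≤ x := by linarith
    have hw : x ^ (α/2-1) ≤ 1 := Real.rpow_le_one_of_one_le_of_nonpos hx1 (by linarith)
    have hw0 : 0 ≤ x ^ (α/2-1) := by positivity
    have hp := pp_ge_one (h x hxX)
    have hc := cc_nonneg X x
    have hc1 := cc_le_one X x
    have hcw : cc X x * x ^ (α/2-1) ≤ 1 := mul_le_one₀ hc1 hw0 hw
    constructor
    · refine (QQ_bound hα2 hX h x t).trans ?_
      rw [abs_of_nonneg hw0]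
      nlinarith
    · have hpp : pp α e x ≤ √((n:ℝ) ^ α + |e|) := by
        apply Real.sqrt_le_sqrt
        have := Real.rpow_le_rpow (by linarith) ((le_abs_self x).trans hx) hα.le
        linarith [le_abs_self e]
      have e1 : QQ α e X x s - QQ α e X x t = 16 * (cc X x * x ^ (α/2-1)) * (SS (pp α e x) s - SS (pp α e x) t) := by
        unfold QQ; ring
      rw [e1, abs_mul, abs_of_nonneg (by positivity)]
      have hl := SS_lip hp s t
      calc _ ≤ 16 * 1 * (4 * pp α e x * |s - t|) := by
            apply mul_le_mul (by linarith) hl (abs_nonneg _) (by norm_num)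
        _ = (64 * pp α e x) * |s - t| := by ring
        _ ≤ _ := by
          apply mul_le_mul_of_nonneg_right _ (abs_nonneg _)
          linarith

structure Setup (α B : ℝ) (E : ℕ → ℝ) (h : ℝ → ℝ) (X : ℕ → ℝ) : Prop where
  mono : Monotone X
  ge : ∀ i : ℕ, (i:ℝ) + 1 ≤ X i
  good : ∀ i j x, X i ≤ x → X j ≤ x → Good α B ((1/2)^j/6) (E i) (E j) x
  del : ∀ (m : ℕ) x, X m ≤ x → (m:ℝ) + 1 ≤ x ^ ((1 - α/2)/2)
  hh : ∀ (m : ℕ) x, X m ≤ x → 32 * ((m:ℝ) + 1) ≤ h x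

lemma setup_exists {α : ℝ} (hα : 0 < α) (hα2 : α < 2) {B : ℝ} (hB : 0 ≤ B) (E : ℕ → ℝ) (h : ℝ → ℝ)
    (htop : Tendsto h atTop atTop) : ∃ X, Setup α B E h X := by
  have key : ∀ K : ℕ, ∃ Y : ℝ, ∀ x, Y ≤ x → (∀ i ∈ Finset.range (K+1), ∀ j ∈ Finset.range (K+1),
      Good α B ((1/2)^j/6) (E i) (E j) x) ∧ (K:ℝ) + 1 ≤ x ∧ (K:ℝ) + 1 ≤ x ^ ((1 - α/2)/2) ∧
      32 * ((K:ℝ) + 1) ≤ h x := by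
    intro K
    apply eventually_atTop.1
    refine Eventually.and ?_ ((eventually_ge_atTop _).and (Eventually.and ?_ (htop.eventually_ge_atTop _)))
    · rw [Finset.eventually_all]
      intro i _
      rw [Finset.eventually_all]
      intro j _
      exact good_eventually hα hα2 B _ hB (by positivity) _ _
    · exact (tendsto_rpow_atTop (by linarith)).eventually_ge_atTop _
  choose Y hY using key
  have hle : ∀ K, Y K ≤ partialSups Y K := fun K => le_partialSups Y K
  refine ⟨fun K => partialSups Y K, ?_, ?_, ?_, ?_, ?_⟩
  · exact (partialSups Y).monotone
  · intro i; exact ((hY i _ (hle i)).2.1)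
  · intro i j x hi hj
    have hm : partialSups Y (max i j) ≤ x := by
      rcases le_total i j with hij | hij
      · rwa [max_eq_right hij]
      · rwa [max_eq_left hij]
    refine (hY (max i j) x ((hle _).trans hm)).1 i ?_ j ?_ <;> simp
  · intro m x hx; exact (hY m x ((hle m).trans hx)).2.2.1
  · intro m x hx; exact (hY m x ((hle m).trans hx)).2.2.2

section
variable {α B : ℝ} {E : ℕ → ℝ} {h : ℝ → ℝ} {X : ℕ → ℝ}

lemma Setup.one_le (S : Setup α B E h X) (i : ℕ) : 1 ≤ X i := by
  have := S.ge i
  have h0 : (0:ℝ) ≤ i := by positivity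
  linarith

lemma Setup.one (S : Setup α B E h X) (i : ℕ) (x : ℝ) (hx : X i ≤ x) : 1 ≤ x ^ α + E i :=
  (S.good i i x hx hx).one

lemma Setup.count (S : Setup α B E h X) (x : ℝ) (M : ℕ) :
    (∀ i < M, cc (X i) x = 0) ∨ ∃ m, X m ≤ x ∧ ∑ i ∈ Finset.range M, cc (X i) x ≤ m + 1 := by
  induction M with
  | zero => left; intro i hi; omega
  | succ M ih =>
    rcases le_or_gt (X M) x with hM | hM
    · right
      refine ⟨M, hM, ?_⟩
      calc _ ≤ ∑ i ∈ Finset.range (M+1), (1:ℝ) := Finset.sum_le_sum fun i _ => cc_le_one _ _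
        _ = _ := by simp
    · have h0 := cc_zero (S.one_le M) hM.le
      rcases ih with ih | ⟨m, hm, ih⟩
      · left
        intro i hi
        rcases Nat.lt_succ_iff_lt_or_eq.1 hi with h | h
        · exact ih i h
        · rw [h]; exact h0
      · right
        refine ⟨m, hm, ?_⟩
        rw [Finset.sum_range_succ, h0]; linarith

lemma Setup.sum_le (S : Setup α B E h X) (hα2 : α < 2) (θ : ℕ → ℝ) (x : ℝ) (M : ℕ) :
    |∑ i ∈ Finset.range M, QQ α (E i) (X i) x (θ i)| ≤
      16 * (∑ i ∈ Finset.range M, cc (X i) x) * |x ^ (α/2 - 1)| := by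
  refine (Finset.abs_sum_le_sum_abs _ _).trans ?_
  rw [Finset.mul_sum, Finset.sum_mul]
  exact Finset.sum_le_sum fun i _ => QQ_bound hα2 (S.one_le i) (S.one i) x _

lemma Setup.q_small (S : Setup α B E h X) (hα : 0 < α) (hα2 : α < 2) (θ : ℕ → ℝ) (x : ℝ) (hx : 0 < x) (M : ℕ) :
    |∑ i ∈ Finset.range M, QQ α (E i) (X i) x (θ i)| ≤ 16 * x ^ (-((1 - α/2)/2)) := by
  have h1 := S.sum_le hα2 θ x M
  rw [abs_of_nonneg (by positivity : 0 ≤ x ^ (α/2-1))] at h1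
  rcases S.count x M with h0 | ⟨m, hm, h0⟩
  · rw [Finset.sum_eq_zero (fun i hi => h0 i (Finset.mem_range.1 hi))] at h1
    have : 0 ≤ 16 * x ^ (-((1 - α/2)/2)) := by positivity
    linarith
  · refine h1.trans ?_
    have h2 := h0.trans (S.del m x hm)
    have e : x ^ (-((1 - α/2)/2)) = x ^ ((1 - α/2)/2) * x ^ (α/2-1) := by
      rw [← Real.rpow_add hx]; congr 1; ring
    rw [e, mul_assoc]
    gcongr

lemma Setup.q_bound (S : Setup α B E h X) (hα : 0 < α) (hα2 : α < 2) (hpos : ∀ x, 0 < x → 0 < h x) (θ : ℕ → ℝ)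
    (x : ℝ) (hx : 0 < x) (M : ℕ) :
    |∑ i ∈ Finset.range M, QQ α (E i) (X i) x (θ i)| ≤ h x / (1 + x ^ (1 - α/2)) := by
  have h1 := S.sum_le hα2 θ x M
  rw [abs_of_nonneg (by positivity : 0 ≤ x ^ (α/2-1))] at h1
  have hh := hpos x hx
  rcases S.count x M with h0 | ⟨m, hm, h0⟩
  · rw [Finset.sum_eq_zero (fun i hi => h0 i (Finset.mem_range.1 hi))] at h1
    have : 0 ≤ h x / (1 + x ^ (1 - α/2)) := by positivity
    linarith
  · refine h1.trans ?_
    have h2 := S.hh m x hm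
    have hx1 : 1 ≤ x := (S.one_le m).trans hm
    have h3 : 1 ≤ x ^ (1 - α/2) := Real.one_le_rpow hx1 (by linarith)
    have e : x ^ (α/2-1) * x ^ (1 - α/2) = 1 := by
      rw [← Real.rpow_add hx]; simp
    have hw : 0 < x ^ (α/2-1) := by positivity
    rw [le_div_iff₀ (by positivity)]
    have h4 : x ^ (α/2-1) * (1 + x ^ (1 - α/2)) ≤ 2 := by nlinarith
    have h5 : 0 ≤ ∑ i ∈ Finset.range M, cc (X i) x := Finset.sum_nonneg fun i _ => cc_nonneg _ _
    calc _ = 16 * (∑ i ∈ Finset.range M, cc (X i) x) * (x ^ (α/2-1) * (1 + x ^ (1 - α/2))) := by ring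
      _ ≤ 16 * (∑ i ∈ Finset.range M, cc (X i) x) * 2 := by gcongr
      _ ≤ _ := by linarith
end

noncomputable def GP (α e e' : ℝ) (c θ θ' : ℝ → ℝ) (y : ℝ) : ℝ :=
  -(c y * F3 α e e' y * (SS (pp α e y) (θ y) * KK (pp α e' y) (θ' y) - KK (pp α e y) (θ y) * SS (pp α e' y) (θ' y)))
    + c y * F4 α e e' y * (SS (pp α e y) (θ y) * KK (pp α e' y) (θ' y) + KK (pp α e y) (θ y) * SS (pp α e' y) (θ' y))

noncomputable def GB (α e : ℝ) (θ : ℝ → ℝ) (y : ℝ) : ℝ :=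
  1 * F1 α e y * SS (pp α e y) (θ y) + 1 * F2 α e y * (2 * (SS (pp α e y) (θ y) * KK (pp α e y) (θ y)))

lemma sq_id {a b c d : ℝ} (h1 : a ^ 2 + b ^ 2 = 1) (h2 : c ^ 2 + d ^ 2 = 1) :
    |b * c - a * d| ≤ 1 ∧ |a * c + b * d| ≤ 1 := by
  apply abs_le_one_of_sq
  linear_combination h1 * (c ^ 2 + d ^ 2) + h2

lemma pair_deriv {α e e' B η x q c' : ℝ} {c θ θ' : ℝ → ℝ} (hα : 0 < α) (hx : 0 < x) (hne : e ≠ e')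
    (hG : Good α B η e e' x) (h1' : 1 ≤ x ^ α + e')
    (hq : |q| ≤ 16 * x ^ (-((1 - α/2)/2)))
    (hc : HasDerivAt c c' x) (hc1 : |c x| ≤ 1) (hc2 : |c'| ≤ B / x)
    (hθ : HasDerivAt θ (pv (x ^ α + e - q) (θ x)) x)
    (hθ' : HasDerivAt θ' (pv (x ^ α + e' - q) (θ' x)) x) :
    (∃ err, |err| ≤ 6 * η / x ∧ HasDerivAt (GP α e e' c θ θ')
      (-(16 * c x * x ^ (α/2-1) * SS (pp α e' x) (θ' x) / pp α e x * SS (pp α e x) (θ x)) + err) x) ∧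
    |GP α e e' c θ θ' x| ≤ 2 * η := by
  have hp := pp_ge_one hG.one
  have hp' := pp_ge_one h1'
  have hsq := pp_sq (α := α) (e := e) (x := x) (by linarith [hG.one])
  have hsq' := pp_sq (α := α) (e := e') (x := x) (by linarith)
  have hd := pp_deriv hx hG.one
  have hd' := pp_deriv hx h1'
  rw [← hsq] at hθ
  rw [← hsq'] at hθ'
  have dS := S_deriv hp hd hθ
  have dK := K_deriv hp hd hθ
  have dS' := S_deriv hp' hd' hθ'
  have dK' := K_deriv hp' hd' hθ'
  have n1 := nu_err (t := θ x) hα hx hG.one hq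
  have n2 := nu_err (t := θ' x) hα hx h1' hq
  have sk := SK_sq hp (θ x)
  have sk' := SK_sq hp' (θ' x)
  have b1 := ebar_nonneg (e := e) hα hx
  have b2 := ebar_nonneg (e := e') hα hx
  set ν := nu (pp α e x) (pd α e x) q (θ x)
  set ν' := nu (pp α e' x) (pd α e' x) q (θ' x)
  obtain ⟨⟨r3, hr3, d3⟩, s3⟩ := osc (c := c) (F := F3 α e e')
    (Sn := fun y => SS (pp α e y) (θ y) * KK (pp α e' y) (θ' y) - KK (pp α e y) (θ y) * SS (pp α e' y) (θ' y))
    (Cs := fun y => KK (pp α e y) (θ y) * KK (pp α e' y) (θ' y) + SS (pp α e y) (θ y) * SS (pp α e' y) (θ' y))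
    (μ := ν - ν') (Ω := 2 * pp α e x - 2 * pp α e' x) hx hc hc1 hc2 hG.g3
    (by
      refine HasDerivAt.congr_deriv ((dS.mul dK').sub (dK.mul dS')) ?_
      ring)
    (sq_id sk sk').1 (sq_id sk sk').2 (by
      have e1 : ν - ν' - (2 * pp α e x - 2 * pp α e' x) = (ν - 2 * pp α e x) - (ν' - 2 * pp α e' x) := by ring
      rw [e1]
      have := abs_sub (ν - 2 * pp α e x) (ν' - 2 * pp α e' x)
      linarith)
  obtain ⟨⟨r4, hr4, d4⟩, s4⟩ := osc (c := c) (F := F4 α e e')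
    (Sn := fun y => SS (pp α e y) (θ y) * KK (pp α e' y) (θ' y) + KK (pp α e y) (θ y) * SS (pp α e' y) (θ' y))
    (Cs := fun y => KK (pp α e y) (θ y) * KK (pp α e' y) (θ' y) - SS (pp α e y) (θ y) * SS (pp α e' y) (θ' y))
    (μ := ν + ν') (Ω := 2 * pp α e x + 2 * pp α e' x) hx hc hc1 hc2 hG.g4
    (by
      refine HasDerivAt.congr_deriv ((dS.mul dK').add (dK.mul dS')) ?_
      ring)
    (by
      have := (sq_id sk (c := KK (pp α e' x) (θ' x)) (d := -SS (pp α e' x) (θ' x)) (by linarith [neg_sq (SS (pp α e' x) (θ' x))])).1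
      simpa using this)
    (by
      have := (sq_id sk (c := KK (pp α e' x) (θ' x)) (d := -SS (pp α e' x) (θ' x)) (by linarith [neg_sq (SS (pp α e' x) (θ' x))])).2
      simpa [sub_eq_add_neg] using this) (by
      have e1 : ν + ν' - (2 * pp α e x + 2 * pp α e' x) = (ν - 2 * pp α e x) + (ν' - 2 * pp α e' x) := by ring
      rw [e1]
      have := abs_add_le (ν - 2 * pp α e x) (ν' - 2 * pp α e' x)
      linarith)
  have hee : e - e' ≠ 0 := sub_ne_zero.2 hne
  have hpne : pp α e x ≠ 0 := by linarith
  have hdiff : pp α e x ^ 2 - pp α e' x ^ 2 = e - e' := by rw [hsq, hsq']; ring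
  have i3 : F3 α e e' x * (2 * pp α e x - 2 * pp α e' x) = 8 * x ^ (α/2-1) / pp α e x := by
    unfold F3
    field_simp
    linear_combination 8 * hdiff
  have i4 : F4 α e e' x * (2 * pp α e x + 2 * pp α e' x) = 8 * x ^ (α/2-1) / pp α e x := by
    unfold F4
    field_simp
    linear_combination 8 * hdiff
  refine ⟨⟨-r3 + r4, ?_, ?_⟩, ?_⟩
  · have := abs_add_le (-r3) r4
    rw [abs_neg] at this
    have e1 : 6 * η / x = 3 * η / x + 3 * η / x := by ring
    linarith
  · refine HasDerivAt.congr_deriv (d3.neg.add d4) ?_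
    rw [mul_assoc (c x) (F3 α e e' x), mul_assoc (c x) (F4 α e e' x), i3, i4]
    ring
  · unfold GP
    refine (abs_add_le _ _).trans ?_
    rw [abs_neg]
    linarith

lemma base_deriv {α e B η x q : ℝ} {θ : ℝ → ℝ} (hα : 0 < α) (hx : 0 < x) (hB : 0 ≤ B)
    (hG : Good α B η e e x)
    (hq : |q| ≤ 16 * x ^ (-((1 - α/2)/2)))
    (hθ : HasDerivAt θ (pv (x ^ α + e - q) (θ x)) x) :
    (∃ err, |err| ≤ 6 * η / x ∧ HasDerivAt (GB α e θ)
      (-(16 * 1 * x ^ (α/2-1) * SS (pp α e x) (θ x) / pp α e x * SS (pp α e x) (θ x)) + err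
        + (pd α e x / pp α e x * KK (pp α e x) (θ x) + 8 * x ^ (α/2-1) / pp α e x)) x) ∧
    |GB α e θ x| ≤ 2 * η := by
  have hp := pp_ge_one hG.one
  have hsq := pp_sq (α := α) (e := e) (x := x) (by linarith [hG.one])
  have hd := pp_deriv hx hG.one
  rw [← hsq] at hθ
  have dS := S_deriv hp hd hθ
  have dK := K_deriv hp hd hθ
  have n1 := nu_err (t := θ x) hα hx hG.one hq
  have sk := SK_sq hp (θ x)
  have b1 := ebar_nonneg (e := e) hα hx
  have hBx : |(0:ℝ)| ≤ B / x := by rw [abs_zero]; positivity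
  set ν := nu (pp α e x) (pd α e x) q (θ x)
  obtain ⟨⟨r3, hr3, d3⟩, s3⟩ := osc (c := fun _ => 1) (F := F1 α e)
    (Sn := fun y => SS (pp α e y) (θ y)) (Cs := fun y => KK (pp α e y) (θ y))
    (μ := ν) (Ω := 2 * pp α e x) hx (hasDerivAt_const _ _) (by simp) hBx hG.g1 dS
    (SS_abs hp) (KK_abs hp) (by linarith)
  obtain ⟨⟨r4, hr4, d4⟩, s4⟩ := osc (c := fun _ => 1) (F := F2 α e)
    (Sn := fun y => 2 * (SS (pp α e y) (θ y) * KK (pp α e y) (θ y)))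
    (Cs := fun y => KK (pp α e y) (θ y) ^ 2 - SS (pp α e y) (θ y) ^ 2)
    (μ := 2 * ν) (Ω := 4 * pp α e x) hx (hasDerivAt_const _ _) (by simp) hBx hG.g2
    (by
      refine HasDerivAt.congr_deriv ((dS.mul dK).const_mul 2) ?_
      ring)
    (by
      have := (abs_le_one_of_sq (a := KK (pp α e x) (θ x) ^ 2 - SS (pp α e x) (θ x) ^ 2)
        (b := 2 * (SS (pp α e x) (θ x) * KK (pp α e x) (θ x)))
        (by linear_combination (sk) * (KK (pp α e x) (θ x) ^ 2 + SS (pp α e x) (θ x) ^ 2 + 1))).2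
      exact this)
    (by
      have := (abs_le_one_of_sq (a := KK (pp α e x) (θ x) ^ 2 - SS (pp α e x) (θ x) ^ 2)
        (b := 2 * (SS (pp α e x) (θ x) * KK (pp α e x) (θ x)))
        (by linear_combination (sk) * (KK (pp α e x) (θ x) ^ 2 + SS (pp α e x) (θ x) ^ 2 + 1))).1
      exact this) (by
      have e1 : 2 * ν - 4 * pp α e x = 2 * (ν - 2 * pp α e x) := by ring
      rw [e1, abs_mul, abs_two]
      linarith)
  have hpne : pp α e x ≠ 0 := by linarith
  have i3 : F1 α e x * (2 * pp α e x) = pd α e x / pp α e x := by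
    unfold F1
    field_simp
  have i4 : F2 α e x * (4 * pp α e x) = 8 * x ^ (α/2-1) / pp α e x := by
    unfold F2
    field_simp
    try norm_num
  refine ⟨⟨r3 + r4, ?_, ?_⟩, ?_⟩
  · have := abs_add_le r3 r4
    have e1 : 6 * η / x = 3 * η / x + 3 * η / x := by ring
    linarith
  · refine HasDerivAt.congr_deriv (d3.add d4) ?_
    rw [one_mul, one_mul, i3, i4]
    linear_combination (8 * x ^ (α/2-1) / pp α e x) * sk
  · unfold GB
    refine (abs_add_le _ _).trans ?_
    linarith

section
variable {α B : ℝ} {E : ℕ → ℝ} {h : ℝ → ℝ} {X : ℕ → ℝ}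

noncomputable def GG (α : ℝ) (E X : ℕ → ℝ) (θ : ℕ → ℝ → ℝ) (i j : ℕ) : ℝ → ℝ :=
  if j = i then GB α (E i) (θ i) else GP α (E i) (E j) (cc (X j)) (θ i) (θ j)

lemma GG_deriv (S : Setup α B E h X) (hα : 0 < α) (hE : Function.Injective E) (hB : 0 ≤ B)
    (hcc : ∀ X : ℝ, 1 ≤ X → ∀ x : ℝ, 0 < x →
      ∃ c', HasDerivAt (cc X) c' x ∧ |c'| ≤ B / x ∧ (x ≤ X → c' = 0))
    {θ : ℕ → ℝ → ℝ} {x q : ℝ} (hq : |q| ≤ 16 * x ^ (-((1 - α/2)/2)))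
    (hθ : ∀ j, HasDerivAt (θ j) (pv (x ^ α + E j - q) (θ j x)) x) (i j : ℕ) (hx : 2 * X i ≤ x) :
    (∃ err, |err| ≤ 6 * ((1/2)^j/6) / x ∧ HasDerivAt (GG α E X θ i j)
      (-(QQ α (E j) (X j) x (θ j x) / pp α (E i) x * SS (pp α (E i) x) (θ i x)) + err
        + if j = i then (pd α (E i) x / pp α (E i) x * KK (pp α (E i) x) (θ i x)
            + 8 * x ^ (α/2-1) / pp α (E i) x) else 0) x) ∧
    |GG α E X θ i j x| ≤ 2 * ((1/2)^j/6) := by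
  have hX := S.one_le i
  have hxi : X i ≤ x := by linarith
  have hx0 : 0 < x := by linarith
  by_cases hji : j = i
  · subst hji
    simp only [GG, if_true]
    have := base_deriv hα hx0 hB (S.good j j x hxi hxi) hq (hθ j)
    unfold QQ
    rw [cc_one hX hx]
    exact this
  · simp only [GG, if_neg hji, add_zero]
    rcases lt_or_ge x (X j) with hxj | hxj
    · have hz : GP α (E i) (E j) (cc (X j)) (θ i) (θ j) =ᶠ[𝓝 x] fun _ => 0 := by
        filter_upwards [eventually_lt_nhds hxj] with y hy
        unfold GP; rw [cc_zero (S.one_le j) hy.le]; ring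
      refine ⟨⟨0, by rw [abs_zero]; positivity, ?_⟩, ?_⟩
      · rw [QQ_zero (S.one_le j) hxj.le]
        refine HasDerivAt.congr_deriv ((hasDerivAt_const x (0:ℝ)).congr_of_eventuallyEq hz) ?_
        simp
      · rw [hz.eq_of_nhds, abs_zero]; positivity
    · obtain ⟨c', h1, h2, -⟩ := hcc (X j) (S.one_le j) x hx0
      exact pair_deriv hα hx0 (fun hh => hji (hE hh.symm)) (S.good i j x hxi hxj) (S.one j x hxj) hq h1
        (cc_abs _ _) h2 (hθ i) (hθ j)

lemma decay (S : Setup α B E h X) (hα : 0 < α) (hα2 : α < 2) (hE : Function.Injective E) (hB : 0 ≤ B)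
    (hcc : ∀ X : ℝ, 1 ≤ X → ∀ x : ℝ, 0 < x →
      ∃ c', HasDerivAt (cc X) c' x ∧ |c'| ≤ B / x ∧ (x ≤ X → c' = 0))
    {θ : ℕ → ℝ → ℝ} (i : ℕ) {ρ : ℝ → ℝ}
    (hθ : ∀ j M x, 0 < x → x < X M → HasDerivAt (θ j)
      (pv (x ^ α + E j - ∑ k ∈ Finset.range M, QQ α (E k) (X k) x (θ k x)) (θ j x)) x)
    (hρ : ∀ M x, 0 < x → x < X M → HasDerivAt ρ
      ((x ^ α + E i - ∑ k ∈ Finset.range M, QQ α (E k) (X k) x (θ k x) - 1) * (sin (θ i x) * cos (θ i x))) x) :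
    ∃ C, ∀ x, 2 * X i ≤ x → (exp (ρ x) * cos (θ i x)) ^ 2 ≤ C / x ^ 2 := by
  set ℓ : ℝ → ℝ := fun x => 2 * ρ x + (log (DD (pp α (E i) x) (θ i x)) - log (pp α (E i) x)) with hℓ
  set a := 2 * X i with ha
  have hX := S.one_le i
  have ha0 : 0 < a := by linarith
  refine ⟨exp (ℓ a + 2 * log a + 2), fun x hx => ?_⟩
  have hx0 : 0 < x := by linarith
  obtain ⟨M, hiM, hM⟩ : ∃ M, i < M ∧ x < X M := by
    obtain ⟨n, hn⟩ := exists_nat_gt x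
    refine ⟨n + i + 1, by omega, ?_⟩
    have := S.ge (n + i + 1)
    push_cast at this
    have h0 : (0:ℝ) ≤ i := by positivity
    linarith
  have hsum : ∑ j ∈ Finset.range M, ((1:ℝ)/2)^j ≤ 2 := sum_geometric_two_le M
  set Z : ℝ → ℝ := fun y => ℓ y - ∑ j ∈ Finset.range M, GG α E X θ i j y + 2 * log y with hZ
  have hG : ∀ y ∈ Icc a x, ∀ j, _ := fun y hy j => GG_deriv S hα hE hB hcc (θ := θ)
    (S.q_small hα hα2 (fun k => θ k y) y (by linarith [hy.1]) M)
    (fun j => hθ j M y (by linarith [hy.1]) (lt_of_le_of_lt hy.2 hM)) i j hy.1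
  have hder : ∀ y ∈ Icc a x, ∃ d ≤ 0, HasDerivAt Z d y := by
    intro y hy
    have hy0 : 0 < y := by linarith [hy.1]
    have hyi : X i ≤ y := by linarith [hy.1]
    have hyM := lt_of_le_of_lt hy.2 hM
    have g := S.good i i y hyi hyi
    have hp := pp_ge_one g.one
    have hsq := pp_sq (α := α) (e := E i) (x := y) (by linarith [g.one])
    choose err herr hd using fun j => (hG y hy j).1
    have hθi := hθ i M y hy0 hyM
    have hρi := hρ M y hy0 hyM
    rw [← hsq] at hθi hρi
    have hl := ell_deriv hp (pp_deriv hy0 g.one) hθi hρi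
    have hs := HasDerivAt.fun_sum (u := Finset.range M) (fun j _ => hd j)
    refine ⟨_, ?_, (hl.sub hs).add ((Real.hasDerivAt_log hy0.ne').const_mul 2)⟩
    rw [Finset.sum_add_distrib, Finset.sum_add_distrib, Finset.sum_ite_eq' , if_pos (Finset.mem_range.2 hiM),
      Finset.sum_neg_distrib, ← Finset.sum_mul, ← Finset.sum_div]
    have he : |∑ j ∈ Finset.range M, err j| ≤ 2 / y := by
      refine (Finset.abs_sum_le_sum_abs _ _).trans ?_
      calc _ ≤ ∑ j ∈ Finset.range M, ((1:ℝ)/2)^j / y := Finset.sum_le_sum fun j _ => by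
            refine (herr j).trans (le_of_eq ?_)
            ring
        _ ≤ 2 / y := by
            rw [← Finset.sum_div]
            exact div_le_div_of_nonneg_right hsum hy0.le
    have he' := (abs_le.1 he).1
    have hw : 4 / y ≤ 8 * y ^ (α/2-1) / pp α (E i) y := by
      rw [div_le_div_iff₀ hy0 (by linarith)]
      have e1 : y ^ (α/2-1) * y = y ^ (α/2) := by
        nth_rewrite 2 [← Real.rpow_one y]
        rw [← Real.rpow_add hy0]; congr 1; ring
      rw [mul_assoc, e1]
      linarith [g.up]
    have e2 : 4 / y = 2 / y + 2 * y⁻¹ := by field_simp; norm_num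
    linarith
  have hanti : AntitoneOn Z (Icc a x) := by
    refine antitoneOn_of_deriv_nonpos (convex_Icc a x) (fun y hy => ?_) (fun y hy => ?_) (fun y hy => ?_)
    · obtain ⟨d, -, h⟩ := hder y hy
      exact h.continuousAt.continuousWithinAt
    · obtain ⟨d, -, h⟩ := hder y (interior_subset hy)
      exact h.differentiableAt.differentiableWithinAt
    · obtain ⟨d, h0, h⟩ := hder y (interior_subset hy)
      rw [h.deriv]; exact h0
  have hZx := hanti (left_mem_Icc.2 hx) (right_mem_Icc.2 hx) hx
  have hGs : ∀ y ∈ Icc a x, |∑ j ∈ Finset.range M, GG α E X θ i j y| ≤ 1 := by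
    intro y hy
    refine (Finset.abs_sum_le_sum_abs _ _).trans ?_
    calc _ ≤ ∑ j ∈ Finset.range M, 2 * (((1:ℝ)/2)^j / 6) := Finset.sum_le_sum fun j _ => (hG y hy j).2
      _ = (∑ j ∈ Finset.range M, ((1:ℝ)/2)^j) / 3 := by
        rw [Finset.sum_div]; exact Finset.sum_congr rfl fun j _ => by ring
      _ ≤ 1 := by linarith
  have g1 := abs_le.1 (hGs a (left_mem_Icc.2 hx))
  have g2 := abs_le.1 (hGs x (right_mem_Icc.2 hx))
  simp only [hZ] at hZx
  have hfin : ℓ x ≤ ℓ a + 2 * log a + 2 - 2 * log x := by linarith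
  have hp := pp_ge_one (S.one i x (by linarith))
  have hD := DD_pos hp (θ i x)
  have e1 : exp (ℓ x) = exp (ρ x) ^ 2 * (DD (pp α (E i) x) (θ i x) / pp α (E i) x) := by
    simp only [hℓ]
    rw [exp_add, exp_sub, exp_log (by linarith), exp_log (by linarith), two_mul, exp_add]; ring
  have e2 : exp (ℓ a + 2 * log a + 2 - 2 * log x) = exp (ℓ a + 2 * log a + 2) / x ^ 2 := by
    rw [exp_sub, two_mul (log x), exp_add (log x), exp_log hx0]; ring
  rw [← e2]
  refine le_trans ?_ (exp_le_exp.2 hfin)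
  rw [e1, mul_pow]
  apply mul_le_mul_of_nonneg_left _ (by positivity)
  rw [le_div_iff₀ (by linarith)]
  unfold DD
  nlinarith [sq_nonneg (cos (θ i x)), sq_nonneg (sin (θ i x)), mul_nonneg (sq_nonneg (cos (θ i x))) (by nlinarith : 0 ≤ pp α (E i) x ^ 2 - pp α (E i) x)]
end

section
variable {α B : ℝ} {E : ℕ → ℝ} {h : ℝ → ℝ} {X : ℕ → ℝ}

noncomputable def qq (α : ℝ) (E X : ℕ → ℝ) (θ : ℕ → ℝ → ℝ) (x : ℝ) : ℝ :=
  ∑ i ∈ Finset.range ⌈x⌉₊, QQ α (E i) (X i) x (θ i x)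

lemma Setup.lt_ceil (S : Setup α B E h X) (x : ℝ) : x < X ⌈x⌉₊ := by
  have h1 := S.ge ⌈x⌉₊
  have h2 := Nat.le_ceil x
  linarith

lemma Setup.sum_eq (S : Setup α B E h X) (f : ℕ → ℝ) {x : ℝ} {M M' : ℕ} (hMM : M ≤ M') (hM : x < X M) :
    ∑ i ∈ Finset.range M, QQ α (E i) (X i) x (f i) = ∑ i ∈ Finset.range M', QQ α (E i) (X i) x (f i) := by
  refine Finset.sum_subset (Finset.range_mono hMM) fun i _ hi => ?_
  have hi' : M ≤ i := by simpa using hi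
  exact QQ_zero (S.one_le i) (hM.le.trans (S.mono hi'))

lemma Setup.qq_eq (S : Setup α B E h X) (θ : ℕ → ℝ → ℝ) {x : ℝ} {M : ℕ} (hM : x < X M) :
    qq α E X θ x = ∑ i ∈ Finset.range M, QQ α (E i) (X i) x (θ i x) := by
  unfold qq
  rcases le_total M ⌈x⌉₊ with hh | hh
  · exact (S.sum_eq (fun i => θ i x) hh hM).symm
  · exact S.sum_eq (fun i => θ i x) hh (S.lt_ceil x)

lemma Setup.qq_zero (S : Setup α B E h X) (θ : ℕ → ℝ → ℝ) {x : ℝ} (hx : x < 1) : qq α E X θ x = 0 := by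
  rw [S.qq_eq θ (M := 0) (lt_of_lt_of_le hx (S.one_le 0))]; simp

lemma Setup.qq_contDiffAt (S : Setup α B E h X) {θ : ℕ → ℝ → ℝ} {n : ℕ} {x : ℝ}
    (hθ : ∀ j, ContDiffAt ℝ n (θ j) x) : ContDiffAt ℝ n (qq α E X θ) x := by
  have hx := S.lt_ceil x
  have he : qq α E X θ =ᶠ[𝓝 x] fun y => ∑ i ∈ Finset.range ⌈x⌉₊, QQ α (E i) (X i) y (θ i y) := by
    filter_upwards [eventually_lt_nhds hx] with y hy
    exact S.qq_eq θ hy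
  refine ContDiffAt.congr_of_eventuallyEq ?_ he
  refine ContDiffAt.sum fun i _ => ?_
  exact (QQ_contDiffAt (S.one_le i) (S.one i) (n : ℕ∞) (x, θ i x)).comp x
    (contDiffAt_id.prodMk (hθ i))

lemma Setup.theta_smooth (S : Setup α B E h X) {θ : ℕ → ℝ → ℝ}
    (hθ : ∀ j x, 0 < x → HasDerivAt (θ j) (pv (x ^ α + E j - qq α E X θ x) (θ j x)) x) (n : ℕ) :
    ∀ j x, 0 < x → ContDiffAt ℝ n (θ j) x := by
  induction n with
  | zero =>
    intro j x hx
    have : ContDiffOn ℝ 0 (θ j) (Ioi 0) :=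
      contDiffOn_zero.2 fun y hy => (hθ j y hy).continuousAt.continuousWithinAt
    exact_mod_cast this.contDiffAt (Ioi_mem_nhds hx)
  | succ n ih =>
    intro j x hx
    have : ContDiffOn ℝ ((n:WithTop ℕ∞) + 1) (θ j) (Ioi 0) := by
      rw [contDiffOn_succ_iff_deriv_of_isOpen isOpen_Ioi]
      refine ⟨fun y hy => (hθ j y hy).differentiableAt.differentiableWithinAt, by simp, ?_⟩
      have hc : ContDiffOn ℝ n (fun x => pv (x ^ α + E j - qq α E X θ x) (θ j x)) (Ioi 0) := by
        intro y hy
        apply ContDiffAt.contDiffWithinAt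
        have hy0 : (0:ℝ) < y := hy
        have c1 := S.qq_contDiffAt (fun k => ih k y hy0)
        have c2 : ContDiffAt ℝ n (fun x : ℝ => x ^ α) y := contDiffAt_id.rpow_const_of_ne hy0.ne'
        have c3 : ContDiffAt ℝ n (fun x => sin (θ j x)) y := (ih j y hy0).sin
        have c4 : ContDiffAt ℝ n (fun x => cos (θ j x)) y := (ih j y hy0).cos
        unfold pv
        exact (c3.pow 2).add (((c2.add contDiffAt_const).sub c1).mul (c4.pow 2))
      exact hc.congr fun y hy => (hθ j y hy).deriv
    exact_mod_cast this.contDiffAt (Ioi_mem_nhds hx)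

lemma Setup.qq_contDiff (S : Setup α B E h X) {θ : ℕ → ℝ → ℝ}
    (hθ : ∀ j x, 0 < x → HasDerivAt (θ j) (pv (x ^ α + E j - qq α E X θ x) (θ j x)) x) :
    ContDiff ℝ (⊤ : ℕ∞) (qq α E X θ) := by
  rw [contDiff_infty]
  intro n
  rw [contDiff_iff_contDiffAt]
  intro x
  rcases lt_or_ge x 1 with hx | hx
  · refine (contDiffAt_const (c := (0:ℝ))).congr_of_eventuallyEq ?_
    filter_upwards [eventually_lt_nhds hx] with y hy
    exact S.qq_zero θ hy
  · exact S.qq_contDiffAt fun j => S.theta_smooth hθ n j x (by linarith)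
end

lemma integrable_pieces {u v : ℝ → ℝ} (hu : Continuous u) (huv : ∀ x < 1, v x = u x)
    (hv : IntegrableOn (fun x => v x ^ 2) (Iic 0)) {a C : ℝ} (ha : 0 < a)
    (hd : ∀ x, a ≤ x → u x ^ 2 ≤ C / x ^ 2) : Integrable (fun x => u x ^ 2) := by
  rw [← integrableOn_univ, ← Iic_union_Ioi (a := a), ← Iic_union_Icc_eq_Iic ha.le]
  refine (IntegrableOn.union ?_ ?_).union ?_
  · refine hv.congr_fun (fun x hx => ?_) measurableSet_Iic
    simp only
    rw [huv x (by have : x ≤ 0 := hx; linarith)]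
  · exact (hu.pow 2).continuousOn.integrableOn_Icc
  · have h1 := (integrableOn_Ioi_rpow_of_lt (a := -2) (by norm_num) ha).const_mul C
    refine Integrable.mono' h1 (hu.pow 2).aestronglyMeasurable ?_
    refine (ae_restrict_iff' measurableSet_Ioi).2 (Eventually.of_forall fun x hx => ?_)
    have hx' : a < x := hx
    rw [Real.norm_of_nonneg (sq_nonneg _)]
    refine (hd x hx'.le).trans (le_of_eq ?_)
    rw [Real.rpow_neg (by linarith), div_eq_mul_inv]
    norm_num

lemma eig_of_sol {vt q u u' : ℝ → ℝ} {E : ℝ} (hvt : Continuous vt) (hq : Continuous q)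
    (hs : IsSol (fun x => E - vt x - q x) u u') (h0 : ¬ (u 0 = 0 ∧ u' 0 = 0))
    (hi : Integrable (fun x => u x ^ 2)) : HasL2Eigenfunction vt q E := by
  have du : deriv u = u' := funext fun x => (hs.d1 x).deriv
  have du' : deriv u' = fun x => -(E - vt x - q x) * u x := funext fun x => (hs.d2 x).deriv
  have hcu : Continuous u := continuous_iff_continuousAt.2 fun x => (hs.d1 x).continuousAt
  refine ⟨u, ?_, fun x => ?_, ?_, hi⟩
  · have c1 : ContDiff ℝ 1 u' := by
      rw [contDiff_one_iff_deriv]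
      refine ⟨fun x => (hs.d2 x).differentiableAt, ?_⟩
      rw [du']; fun_prop
    rw [show (2 : WithTop ℕ∞) = 1 + 1 by norm_num, contDiff_succ_iff_deriv]
    refine ⟨fun x => (hs.d1 x).differentiableAt, by simp, ?_⟩
    rw [du]; exact c1
  · rw [du, du']; ring
  · by_contra hc
    push Not at hc
    refine h0 ⟨hc 0, ?_⟩
    rw [← du]
    have : u = fun _ => 0 := funext hc
    rw [this]; simp

theorem stark_line_infinitely_many_eigenvalues
    (α : ℝ) (hα0 : 0 < α) (hα2 : α < 2)
    (vt : ℝ → ℝ) (hvt : Continuous vt)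
    (hvt0 : ∀ x : ℝ, 0 ≤ x → vt x = -(x ^ α))
    (hvtop : Filter.Tendsto vt Filter.atBot Filter.atTop)
    (h : ℝ → ℝ) (hpos : ∀ x : ℝ, 0 < x → 0 < h x)
    (htop : Filter.Tendsto h Filter.atTop Filter.atTop)
    (E : ℕ → ℝ) (hE : Function.Injective E) :
    ∃ q : ℝ → ℝ, ContDiff ℝ (⊤ : ℕ∞) q ∧
      (∀ x : ℝ, 0 < x → |q x| ≤ h x / (1 + x ^ (1 - α / 2))) ∧
      ∀ j : ℕ, HasL2Eigenfunction vt q (E j) := by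
  obtain ⟨B, hB, hcc⟩ := cc_deriv
  obtain ⟨X, S⟩ := setup_exists hα0 hα2 hB E h htop
  have hbc : ∀ j, Continuous (fun x => E j - vt x) := fun j => by fun_prop
  have hbt : ∀ j, Tendsto (fun x => E j - vt x) atBot atBot := fun j => by
    simp only [sub_eq_add_neg]
    exact tendsto_atBot_add_const_left _ _ (tendsto_neg_atTop_atBot.comp hvtop)
  choose v v' hv hv0 hvi using fun j => left_sol (fun x => E j - vt x) (hbc j) (hbt j)
  choose r φ hr1 hr2 using fun j => polar (v j 0) (v' j 0)
  obtain ⟨θ, hθ0, hθ⟩ := infinite_system (fun j x => E j - vt x) hbc (fun i x t => QQ α (E i) (X i) x t)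
    (fun i t => by
      rw [continuous_iff_continuousAt]
      intro x
      exact ((QQ_contDiffAt (S.one_le i) (S.one i) 0 (x, t)).continuousAt).comp
        (f := fun x : ℝ => (x, t)) (by fun_prop))
    (fun i n => QQ_lip hα0 hα2 (S.one_le i) (S.one i) n) X S.mono S.ge
    (fun i x t hx => QQ_zero (S.one_le i) hx) φ
  have hθb : ∀ j x, HasDerivAt (θ j) (pv (E j - vt x - qq α E X θ x) (θ j x)) x :=
    fun j x => hθ j _ x (S.lt_ceil x)
  have hvx : ∀ j x, 0 < x → E j - vt x = x ^ α + E j := fun j x hx => by rw [hvt0 x hx.le]; ring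
  have hθp : ∀ j x, 0 < x → HasDerivAt (θ j) (pv (x ^ α + E j - qq α E X θ x) (θ j x)) x :=
    fun j x hx => by rw [← hvx j x hx]; exact hθb j x
  have hqs := S.qq_contDiff hθp
  refine ⟨qq α E X θ, hqs, fun x hx => S.q_bound hα0 hα2 hpos (fun i => θ i x) x hx _, fun j => ?_⟩
  have hqc := hqs.continuous
  obtain ⟨ρ, hρ⟩ := prufer_rho (fun x => E j - vt x - qq α E X θ x) (by fun_prop) (θ j) (hθb j)
  have hs := prufer_sol _ (θ j) ρ (hθb j) hρ
  obtain ⟨C, hC⟩ := decay S hα0 hα2 hE hB hcc (θ := θ) j (ρ := ρ)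
    (fun k M x hx hM => by rw [← hvx k x hx]; exact hθ k M x hM)
    (fun M x hx hM => by
      rw [← hvx j x hx, ← S.qq_eq θ hM]; exact hρ x)
  have hs2 := hs.comb hs (r j * exp (-ρ 0)) 0
  have hee : exp (-ρ 0) * exp (ρ 0) = 1 := by rw [← exp_add]; simp
  have e1 : v j 0 = r j * exp (-ρ 0) * (exp (ρ 0) * cos (θ j 0)) + 0 * (exp (ρ 0) * cos (θ j 0)) := by
    rw [hθ0 j, hr1 j]; linear_combination -(r j * cos (φ j)) * hee
  have e2 : v' j 0 = r j * exp (-ρ 0) * -(exp (ρ 0) * sin (θ j 0)) + 0 * -(exp (ρ 0) * sin (θ j 0)) := by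
    rw [hθ0 j, hr2 j]; linear_combination (r j * sin (φ j)) * hee
  have huv := sol_unique _ _ (hbc j) _ _ _ _ (hv j) hs2 1 one_pos
    (fun x hx => by rw [S.qq_zero θ hx]; ring) e1 e2
  refine eig_of_sol hvt hqc hs2 ?_ ?_
  · intro hh
    exact hv0 j ⟨e1.trans hh.1, e2.trans hh.2⟩
  · refine integrable_pieces (v := v j) (a := 2 * X j) (C := (r j * exp (-ρ 0)) ^ 2 * C)
      (continuous_iff_continuousAt.2 fun x => (hs2.d1 x).continuousAt) huv (hvi j)
      (by linarith [S.one_le j]) (fun x hx => ?_)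
    have := mul_le_mul_of_nonneg_left (hC x hx) (sq_nonneg (r j * exp (-ρ 0)))
    calc _ = (r j * exp (-ρ 0)) ^ 2 * (exp (ρ x) * cos (θ j x)) ^ 2 := by ring
      _ ≤ _ := this
      _ = _ := by ring
end
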